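/- Let k ≥ 2 and d ≥ 2^{k+1} be integers, and let 𝔖(N) denote the singular series. There exists C_k > 0 such that for all N ≥ C_k d^{20d}, the number r_k(N) of representations of N as a sum of d positive k-th powers satisfies r_k(N) = 𝔖(N) · (Γ(1+1/k)^d / Γ(d/k)) · N^{d/k−1} · (1 + o(1)), where the o(1) term tends to 0 as N → ∞ uniformly in the dimension d. -/

import Mathlib

noncomputable def e (x : ℝ) : ℂ := Complex.exp (2 * Real.pi * Complex.I * x)

noncomputable def warGauss (k q a : ℕ) : ℂ :=
  (q : ℂ)⁻¹ * ∑ r ∈ Finset.Icc 1 q, e ((a : ℝ) * (r : ℝ) ^ k / (q : ℝ))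

/-- The singular series `𝔖(N)`. -/
noncomputable def singularSeries (k d N : ℕ) : ℂ :=
  ∑' q : ℕ, ∑ a ∈ (Finset.Icc 1 q).filter (fun a => Nat.Coprime a q),
    (warGauss k q a) ^ d * e (-((N : ℝ) * a / q))

/-- The number of representations of `N` as a sum of `d` positive `k`-th powers. -/
noncomputable def rep (k d N : ℕ) : ℕ :=
  Nat.card {x : Fin d → ℕ // (∀ i, 1 ≤ x i) ∧ ∑ i, (x i) ^ k = N}

namespace Waring

/-! ### The additive character `e` -/

lemma e_add (x y : ℝ) : e (x + y) = e x * e y := by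
  simp only [e]
  rw [← Complex.exp_add]
  push_cast
  ring_nf

@[simp] lemma e_zero : e 0 = 1 := by simp [e]

lemma e_neg (x : ℝ) : e (-x) = (starRingEnd ℂ) (e x) := by
  simp only [e]
  rw [← Complex.exp_conj]
  simp [map_ofNat (starRingEnd ℂ) 2]

lemma e_sub (x y : ℝ) : e (x - y) = e x * (starRingEnd ℂ) (e y) := by
  rw [sub_eq_add_neg, e_add, e_neg]

@[simp] lemma norm_e (x : ℝ) : ‖e x‖ = 1 := by
  have : (2 * Real.pi * Complex.I * x : ℂ) = ((2 * Real.pi * x : ℝ) : ℂ) * Complex.I := by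
    push_cast; ring
  rw [e, this, Complex.norm_exp_ofReal_mul_I]

lemma e_sum {ι : Type*} (s : Finset ι) (f : ι → ℝ) : e (∑ i ∈ s, f i) = ∏ i ∈ s, e (f i) := by
  classical
  induction s using Finset.induction_on with
  | empty => simp
  | insert a s ha ih => rw [Finset.sum_insert ha, Finset.prod_insert ha, e_add, ih]

@[simp] lemma e_int (n : ℤ) : e n = 1 := by
  rw [e, Complex.exp_eq_one_iff]
  exact ⟨n, by push_cast; ring⟩

@[simp] lemma e_nat (n : ℕ) : e n = 1 := by
  exact_mod_cast e_int n

lemma e_add_int (x : ℝ) (n : ℤ) : e (x + n) = e x := by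
  rw [e_add, e_int, mul_one]

lemma e_eq_of_sub_eq_int {x y : ℝ} (n : ℤ) (h : x - y = n) : e x = e y := by
  rw [← e_add_int y n, ← h]
  ring_nf

lemma continuous_e : Continuous e := by
  unfold e
  fun_prop

@[fun_prop]
lemma continuous_e_comp {T : Type*} [TopologicalSpace T] {f : T → ℝ} (hf : Continuous f) :
    Continuous fun t => e (f t) := continuous_e.comp hf

/-- Orthogonality of the characters `e (m α)` on an interval of length one. -/
lemma integral_e_int_mul (t : ℝ) (m : ℤ) :
    ∫ α in t..(t + 1), e (α * m) = if m = 0 then 1 else 0 := by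
  split_ifs with hm
  · simp [hm]
  · have hc : (2 * Real.pi * Complex.I * m : ℂ) ≠ 0 := by
      simp [Real.pi_ne_zero, hm]
    have h1 : ∀ α : ℝ, e (α * m) = Complex.exp ((2 * Real.pi * Complex.I * m : ℂ) * α) := by
      intro α
      rw [e]; push_cast; ring_nf
    simp_rw [h1]
    rw [integral_exp_mul_complex hc, ← h1, ← h1]
    have : (t + 1) * (m : ℝ) = t * m + m := by ring
    rw [this, e_add_int]
    simp

/-- The distance from `x` to the nearest integer. -/
noncomputable def distInt (x : ℝ) : ℝ := |x - round x|

lemma distInt_le_abs_sub_int (x : ℝ) (n : ℤ) : distInt x ≤ |x - n| := round_le x n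

lemma distInt_neg (x : ℝ) : distInt (-x) = distInt x := by
  apply le_antisymm
  · refine (distInt_le_abs_sub_int (-x) (-round x)).trans ?_
    rw [distInt, ← abs_neg]; push_cast; ring_nf; rfl
  · refine (distInt_le_abs_sub_int x (-round (-x))).trans ?_
    rw [distInt, ← abs_neg]; push_cast; ring_nf; rfl

lemma distInt_le_add_abs_sub (x y : ℝ) : distInt x ≤ distInt y + |x - y| := by
  refine (distInt_le_abs_sub_int x (round y)).trans ?_
  rw [distInt, add_comm]
  exact abs_sub_le x y _

lemma distInt_add_int (x : ℝ) (n : ℤ) : distInt (x + n) = distInt x := by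
  simp [distInt]

lemma four_mul_distInt_le_norm_one_sub_e (x : ℝ) : 4 * distInt x ≤ ‖1 - e x‖ := by
  set y := x - round x with hy
  have hxy : e x = e y := e_eq_of_sub_eq_int (round x) (by rw [hy]; ring)
  have hyl : |y| ≤ 1 / 2 := abs_sub_round x
  have h1 : ‖1 - e y‖ = 2 * |Real.sin (Real.pi * y)| := by
    have h2 : (2 * Real.pi * Complex.I * y : ℂ) = Complex.I * ((2 * Real.pi * y : ℝ) : ℂ) := by
      push_cast; ring
    rw [← norm_neg, neg_sub, e, h2, Complex.norm_exp_I_mul_ofReal_sub_one, Real.norm_eq_abs,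
      abs_mul, abs_two]
    ring_nf
  have h3 : 2 * |y| ≤ |Real.sin (Real.pi * y)| := by
    have h4 := Real.mul_abs_le_abs_sin (x := Real.pi * y) (by
      rw [abs_mul, abs_of_pos Real.pi_pos]
      nlinarith [Real.pi_pos])
    rw [abs_mul, abs_of_pos Real.pi_pos] at h4
    have : 2 / Real.pi * (Real.pi * |y|) = 2 * |y| := by
      field_simp
    linarith
  rw [hxy, h1, distInt]
  linarith

/-- `min (P, 1 / (2‖x‖))`, with value `P` where `x` is an integer. -/
noncomputable def linBound (P : ℕ) (x : ℝ) : ℝ := P / max 1 (2 * P * distInt x)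

lemma linBound_nonneg (P : ℕ) (x : ℝ) : 0 ≤ linBound P x := by
  unfold linBound; positivity

lemma linBound_le (P : ℕ) (x : ℝ) : linBound P x ≤ P := by
  apply div_le_self (Nat.cast_nonneg P) (le_max_left _ _)

lemma linBound_neg (P : ℕ) (x : ℝ) : linBound P (-x) = linBound P x := by
  rw [linBound, distInt_neg, linBound]

lemma linBound_le_of_le_distInt {P : ℕ} {x t : ℝ} (ht : 0 < t) (h : t ≤ distInt x) :
    linBound P x ≤ 1 / (2 * t) := by
  unfold linBound
  rcases Nat.eq_zero_or_pos P with rfl | hP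
  · simp; positivity
  · have hP' : (0 : ℝ) < P := by exact_mod_cast hP
    rw [div_le_div_iff₀ (by positivity) (by positivity), one_mul]
    refine le_trans ?_ (le_max_right _ _)
    nlinarith

/-- Geometric sums over an interval of integers of length at most `P`. -/
lemma norm_sum_Icc_e_linear_le (P : ℕ) (a b : ℤ) (hab : b - a < P) (x y : ℝ) :
    ‖∑ n ∈ Finset.Icc a b, e (x * n + y)‖ ≤ linBound P x := by
  have hcard : ‖∑ n ∈ Finset.Icc a b, e (x * n + y)‖ ≤ P := by
    refine (norm_sum_le _ _).trans ?_
    simp only [norm_e, Finset.sum_const, nsmul_eq_mul, mul_one, Int.card_Icc]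
    exact_mod_cast (by omega : (b + 1 - a).toNat ≤ P)
  unfold linBound
  rw [le_div_iff₀ (by positivity), mul_max_of_nonneg _ _ (norm_nonneg _)]
  refine max_le (by simpa using hcard) ?_
  by_cases hba : b < a
  · simp [Finset.Icc_eq_empty_of_lt hba]
  push Not at hba
  have htel : (1 - e x) * ∑ n ∈ Finset.Icc a b, e (x * n + y)
      = e (x * a + y) - e (x * (b + 1) + y) := by
    obtain ⟨m, rfl⟩ := Int.le.dest hba
    clear hab hcard hba
    induction m with
    | zero =>
      simp only [Nat.cast_zero, add_zero, Finset.Icc_self, Finset.sum_singleton]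
      have : x * ((a : ℝ) + 1) + y = x + (x * a + y) := by ring
      rw [this, e_add x]; ring
    | succ m ih =>
      have : Finset.Icc a (a + ((m + 1 : ℕ) : ℤ)) = insert (a + ((m + 1 : ℕ) : ℤ))
          (Finset.Icc a (a + m)) := by
        ext n; simp only [Finset.mem_Icc, Finset.mem_insert]; omega
      rw [this, Finset.sum_insert (by simp), mul_add, ih]
      push_cast
      have : x * ((a : ℝ) + (m + 1) + 1) + y = x + (x * (a + (m + 1)) + y) := by ring
      rw [this, e_add x, ← add_assoc (a : ℝ)]; ring
  have h2 : ‖1 - e x‖ * ‖∑ n ∈ Finset.Icc a b, e (x * n + y)‖ ≤ 2 := by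
    rw [← norm_mul, htel]
    refine (norm_sub_le _ _).trans ?_
    simp only [norm_e]; norm_num
  have h3 := four_mul_distInt_le_norm_one_sub_e x
  have hP' : (0 : ℝ) ≤ P := Nat.cast_nonneg P
  have h4 := mul_le_mul_of_nonneg_right h3 (norm_nonneg (∑ n ∈ Finset.Icc a b, e (x * n + y)))
  nlinarith

end Waring

namespace Waring

/-! ### The divisor bound -/

/-- The number of divisors of `n` is `O(n ^ ε)`. -/
lemma exists_card_divisors_le (ε : ℝ) (hε : 0 < ε) :
    ∃ C : ℝ, 1 ≤ C ∧ ∀ n : ℕ, n ≠ 0 → (n.divisors.card : ℝ) ≤ C * (n : ℝ) ^ ε := by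
  set A : ℝ := max 1 (1 / (ε * Real.log 2)) with hA
  set B : ℕ := ⌈(2 : ℝ) ^ (1 / ε)⌉₊ with hB
  have hA1 : 1 ≤ A := le_max_left _ _
  have hlog : 0 < Real.log 2 := Real.log_pos one_lt_two
  have hstep : ∀ p v : ℕ, p.Prime → ((v : ℝ) + 1) ≤ (if p < B then A else 1) * ((p : ℝ) ^ v) ^ ε := by
    intro p v hp
    have hp2 : (2 : ℝ) ≤ p := by exact_mod_cast hp.two_le
    split_ifs with h
    · have h1 : (2 : ℝ) ^ (v * ε) ≤ ((p : ℝ) ^ v) ^ ε := by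
        rw [← Real.rpow_natCast, ← Real.rpow_mul (by positivity)]
        exact Real.rpow_le_rpow (by norm_num) hp2 (by positivity)
      have h2 : 1 + v * ε * Real.log 2 ≤ (2 : ℝ) ^ (v * ε) := by
        rw [Real.rpow_def_of_pos (by norm_num)]
        have := Real.add_one_le_exp (Real.log 2 * (v * ε))
        linarith
      have h3 : 1 ≤ A * (ε * Real.log 2) := by
        have : 1 / (ε * Real.log 2) ≤ A := le_max_right _ _
        rwa [div_le_iff₀ (by positivity)] at this
      have hv : (0 : ℝ) ≤ v := Nat.cast_nonneg v
      calc (v : ℝ) + 1 ≤ A * (1 + v * ε * Real.log 2) := by nlinarith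
        _ ≤ A * ((p : ℝ) ^ v) ^ ε := by gcongr; exact h2.trans h1
    · push Not at h
      have h1 : (2 : ℝ) ^ (1 / ε) ≤ p := (Nat.le_ceil _).trans (by exact_mod_cast h)
      have h2 : (2 : ℝ) ≤ (p : ℝ) ^ ε := by
        calc (2 : ℝ) = ((2 : ℝ) ^ (1 / ε)) ^ ε := by
              rw [← Real.rpow_mul (by norm_num), one_div_mul_cancel hε.ne', Real.rpow_one]
          _ ≤ (p : ℝ) ^ ε := Real.rpow_le_rpow (by positivity) h1 hε.le
      have h3 : ((p : ℝ) ^ v) ^ ε = ((p : ℝ) ^ ε) ^ v := by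
        rw [← Real.rpow_natCast, ← Real.rpow_mul (by positivity), mul_comm,
          Real.rpow_mul (by positivity), Real.rpow_natCast]
      rw [one_mul, h3]
      calc (v : ℝ) + 1 ≤ (2 : ℝ) ^ v := by exact_mod_cast Nat.lt_two_pow_self
        _ ≤ _ := by gcongr
  refine ⟨A ^ B, one_le_pow₀ hA1, fun n hn => ?_⟩
  have hfac : (n : ℝ) ^ ε = ∏ p ∈ n.primeFactors, ((p : ℝ) ^ n.factorization p) ^ ε := by
    rw [Real.finsetProd_rpow _ _ (fun i _ => by positivity)]
    congr 1
    conv_lhs => rw [← Nat.prod_factorization_pow_eq_self hn]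
    rw [Finsupp.prod]
    push_cast
    rfl
  rw [Nat.card_divisors hn, hfac]
  push_cast
  calc ∏ p ∈ n.primeFactors, ((n.factorization p : ℝ) + 1)
      ≤ ∏ p ∈ n.primeFactors, ((if p < B then A else 1) * ((p : ℝ) ^ n.factorization p) ^ ε) :=
        Finset.prod_le_prod (fun _ _ => by positivity)
          fun p hp => hstep p _ (Nat.prime_of_mem_primeFactors hp)
    _ = (∏ p ∈ n.primeFactors, if p < B then A else 1) *
          ∏ p ∈ n.primeFactors, ((p : ℝ) ^ n.factorization p) ^ ε := Finset.prod_mul_distrib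
    _ ≤ _ := by
      gcongr
      rw [Finset.prod_ite, Finset.prod_const_one, mul_one, Finset.prod_const]
      apply pow_le_pow_right₀ hA1
      calc _ ≤ (Finset.range B).card := Finset.card_le_card (by intro p; simp)
        _ = B := Finset.card_range B

end Waring

namespace Waring

open Polynomial

/-! ### Weyl differencing -/

/-- The forward difference `ψ(X + h) - ψ(X)`. -/
noncomputable def fwdPoly (h : ℤ) (ψ : ℤ[X]) : ℤ[X] := taylor h ψ - ψ

lemma eval_fwdPoly (h n : ℤ) (ψ : ℤ[X]) : (fwdPoly h ψ).eval n = ψ.eval (n + h) - ψ.eval n := by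
  rw [fwdPoly, eval_sub, taylor_eval]

lemma coeff_fwdPoly (h : ℤ) (ψ : ℤ[X]) (n : ℕ) :
    (fwdPoly h ψ).coeff n = (hasseDeriv n ψ).eval h - (hasseDeriv n ψ).eval 0 := by
  rw [fwdPoly, coeff_sub, taylor_coeff, ← taylor_coeff (r := 0), taylor_zero]

lemma coeff_fwdPoly_of_natDegree_le (h : ℤ) (ψ : ℤ[X]) (t : ℕ) (hψ : ψ.natDegree ≤ t + 1) :
    (fwdPoly h ψ).coeff t = (t + 1) * ψ.coeff (t + 1) * h := by
  have hdeg : (hasseDeriv t ψ).natDegree < 2 := by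
    have := natDegree_hasseDeriv_le ψ t
    omega
  rw [coeff_fwdPoly, eval_eq_sum_range' hdeg, eval_eq_sum_range' hdeg]
  simp [Finset.sum_range_succ, hasseDeriv_coeff, add_comm 1 t, Nat.choose_succ_self_right]

lemma natDegree_fwdPoly_le (h : ℤ) (ψ : ℤ[X]) (t : ℕ) (hψ : ψ.natDegree ≤ t + 1) :
    (fwdPoly h ψ).natDegree ≤ t := by
  rw [natDegree_le_iff_coeff_eq_zero]
  intro n hn
  have hdeg : (hasseDeriv n ψ).natDegree < 1 := by
    have := natDegree_hasseDeriv_le ψ n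
    omega
  rw [coeff_fwdPoly, eval_eq_sum_range' hdeg, eval_eq_sum_range' hdeg]
  simp

lemma fwdPoly_C_mul (h c : ℤ) (ψ : ℤ[X]) : fwdPoly h (C c * ψ) = C c * fwdPoly h ψ := by
  rw [fwdPoly, taylor_mul, taylor_C, fwdPoly, mul_sub]

lemma C_dvd_fwdPoly (h : ℤ) (ψ : ℤ[X]) : C h ∣ fwdPoly h ψ := by
  rw [C_dvd_iff_dvd_coeff]
  intro n
  rw [coeff_fwdPoly]
  simpa using sub_dvd_eval_sub h 0 (hasseDeriv n ψ)

/-- A nonzero step divides the forward difference, the quotient having degree exactly one less. -/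
lemma exists_fwdPoly_eq_C_mul {h : ℤ} (hh : h ≠ 0) (ψ : ℤ[X]) (t : ℕ)
    (hψ : ψ.natDegree = t + 1) : ∃ ψ' : ℤ[X], fwdPoly h ψ = C h * ψ' ∧ ψ'.natDegree = t := by
  obtain ⟨ψ', hψ'⟩ := C_dvd_fwdPoly h ψ
  refine ⟨ψ', hψ', ?_⟩
  have h1 : ψ'.natDegree = (fwdPoly h ψ).natDegree := by
    rw [hψ', natDegree_C_mul hh]
  rw [h1]
  apply natDegree_eq_of_le_of_coeff_ne_zero (natDegree_fwdPoly_le h ψ t hψ.le)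
  rw [coeff_fwdPoly_of_natDegree_le h ψ t hψ.le]
  have h2 : ψ.coeff (t + 1) ≠ 0 := by
    rw [← hψ, coeff_natDegree, leadingCoeff_ne_zero]
    rintro rfl
    simp at hψ
  exact mul_ne_zero (mul_ne_zero (by positivity) h2) hh

/-- The iterated differenced exponential sum with steps in `(-P, P)`. -/
noncomputable def weylSum (P : ℕ) (α : ℝ) : ℕ → ℤ → ℤ → ℤ[X] → ℂ
  | 0, a, b, ψ => ∑ n ∈ Finset.Icc a b, e (α * (ψ.eval n : ℤ))
  | j + 1, a, b, ψ => ∑ h ∈ Finset.Ioo (-(P : ℤ)) P,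
      weylSum P α j (max a (a - h)) (min b (b - h)) (fwdPoly h ψ)

lemma norm_sq_weylSum_zero (P : ℕ) (α : ℝ) (a b : ℤ) (hab : b - a < P) (ψ : ℤ[X]) :
    ((‖weylSum P α 0 a b ψ‖ ^ 2 : ℝ) : ℂ) = weylSum P α 1 a b ψ := by
  have h1 : ((‖weylSum P α 0 a b ψ‖ ^ 2 : ℝ) : ℂ)
      = weylSum P α 0 a b ψ * (starRingEnd ℂ) (weylSum P α 0 a b ψ) := by
    rw [Complex.mul_conj, Complex.normSq_eq_norm_sq]
  rw [h1]
  simp only [weylSum, map_sum, Finset.sum_mul_sum]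
  rw [← Finset.sum_product', Finset.sum_sigma']
  symm
  refine Finset.sum_nbij' (fun x => (x.2 + x.1, x.2)) (fun x => ⟨x.1 - x.2, x.2⟩) ?_ ?_ ?_ ?_ ?_
  · rintro ⟨h, n⟩
    simp only [Finset.mem_sigma, Finset.mem_Ioo, Finset.mem_Icc, Finset.mem_product]
    omega
  · rintro ⟨m, n⟩
    simp only [Finset.mem_sigma, Finset.mem_Ioo, Finset.mem_Icc, Finset.mem_product]
    omega
  · rintro ⟨h, n⟩ _
    simp
  · rintro ⟨m, n⟩ _
    simp
  · rintro ⟨h, n⟩ _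
    dsimp only
    rw [eval_fwdPoly, ← e_sub]
    push_cast
    ring_nf

lemma weylSum_one_re (P : ℕ) (α : ℝ) (a b : ℤ) (hab : b - a < P) (ψ : ℤ[X]) :
    (weylSum P α 1 a b ψ).re = ‖weylSum P α 0 a b ψ‖ ^ 2 := by
  rw [← norm_sq_weylSum_zero P α a b hab ψ, Complex.ofReal_re]

/-- The Weyl differencing inequality. -/
lemma norm_weylSum_zero_pow_le (P : ℕ) (α : ℝ) (j : ℕ) (a b : ℤ) (hab : b - a < P) (ψ : ℤ[X]) :
    (‖weylSum P α 0 a b ψ‖ ^ 2 ^ (j + 1)) * (2 * P) ^ (j + 2)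
      ≤ (2 * P) ^ 2 ^ (j + 1) * (weylSum P α (j + 1) a b ψ).re := by
  induction j generalizing a b ψ with
  | zero =>
    rw [zero_add, weylSum_one_re P α a b hab]
    simp [mul_comm]
  | succ j ih =>
    have h1 : ‖weylSum P α 0 a b ψ‖ ^ 2 ≤ ∑ h ∈ Finset.Ioo (-(P : ℤ)) P,
        ‖weylSum P α 0 (max a (a - h)) (min b (b - h)) (fwdPoly h ψ)‖ := by
      have : ‖weylSum P α 0 a b ψ‖ ^ 2 = ‖weylSum P α 1 a b ψ‖ := by
        rw [← norm_sq_weylSum_zero P α a b hab ψ]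
        simp
      rw [this]
      exact norm_sum_le _ _
    have hcard : ((Finset.Ioo (-(P : ℤ)) P).card : ℝ) ≤ 2 * P := by
      rw [Int.card_Ioo]
      exact_mod_cast (by omega : ((P : ℤ) - -(P : ℤ) - 1).toNat ≤ 2 * P)
    have hre : (weylSum P α (j + 2) a b ψ).re = ∑ h ∈ Finset.Ioo (-(P : ℤ)) P,
        (weylSum P α (j + 1) (max a (a - h)) (min b (b - h)) (fwdPoly h ψ)).re := by
      rw [weylSum, Complex.re_sum]
    have hpow : 2 ^ (j + 1) - 1 + 1 = 2 ^ (j + 1) := Nat.sub_add_cancel Nat.one_le_two_pow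
    have h2 : ‖weylSum P α 0 a b ψ‖ ^ 2 ^ (j + 2) ≤ (2 * P) ^ (2 ^ (j + 1) - 1) *
        ∑ h ∈ Finset.Ioo (-(P : ℤ)) P,
          ‖weylSum P α 0 (max a (a - h)) (min b (b - h)) (fwdPoly h ψ)‖ ^ 2 ^ (j + 1) := by
      calc ‖weylSum P α 0 a b ψ‖ ^ 2 ^ (j + 2)
          = (‖weylSum P α 0 a b ψ‖ ^ 2) ^ 2 ^ (j + 1) := by rw [← pow_mul]; ring_nf
        _ ≤ (∑ h ∈ Finset.Ioo (-(P : ℤ)) P,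
            ‖weylSum P α 0 (max a (a - h)) (min b (b - h)) (fwdPoly h ψ)‖) ^ 2 ^ (j + 1) := by
              gcongr
        _ ≤ _ := by
              rw [← hpow, add_tsub_cancel_right]
              refine (pow_sum_le_card_mul_sum_pow (fun _ _ => norm_nonneg _) _).trans ?_
              gcongr
    have hP : (0 : ℝ) ≤ 2 * P := by positivity
    calc ‖weylSum P α 0 a b ψ‖ ^ 2 ^ (j + 1 + 1) * (2 * P : ℝ) ^ (j + 1 + 2)
        ≤ ((2 * P : ℝ) ^ (2 ^ (j + 1) - 1) * ∑ h ∈ Finset.Ioo (-(P : ℤ)) P,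
          ‖weylSum P α 0 (max a (a - h)) (min b (b - h)) (fwdPoly h ψ)‖ ^ 2 ^ (j + 1)) *
            (2 * P : ℝ) ^ (j + 1 + 2) := by gcongr
      _ = (2 * P : ℝ) ^ 2 ^ (j + 1) * ∑ h ∈ Finset.Ioo (-(P : ℤ)) P,
          ‖weylSum P α 0 (max a (a - h)) (min b (b - h)) (fwdPoly h ψ)‖ ^ 2 ^ (j + 1) *
            (2 * P : ℝ) ^ (j + 2) := by
          rw [← Finset.sum_mul, ← hpow, add_tsub_cancel_right]
          ring
      _ ≤ (2 * P : ℝ) ^ 2 ^ (j + 1) * ∑ h ∈ Finset.Ioo (-(P : ℤ)) P, (2 * P : ℝ) ^ 2 ^ (j + 1) *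
          (weylSum P α (j + 1) (max a (a - h)) (min b (b - h)) (fwdPoly h ψ)).re := by
          refine mul_le_mul_of_nonneg_left (Finset.sum_le_sum fun h _ => ?_) (by positivity)
          exact ih (max a (a - h)) (min b (b - h)) (by omega) _
      _ = _ := by
          rw [hre, ← Finset.mul_sum]
          ring

end Waring

namespace Waring

open Polynomial

/-! ### Hua's lemma -/

/-- The number of solutions of the differenced equation counted by `weylSum`. -/
noncomputable def weylCount (P : ℕ) : ℕ → ℤ → ℤ → ℤ[X] → ℤ → ℕ
  | 0, a, b, ψ, m => ((Finset.Icc a b).filter fun n => ψ.eval n = m).card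
  | j + 1, a, b, ψ, m => ∑ h ∈ Finset.Ioo (-(P : ℤ)) P,
      weylCount P j (max a (a - h)) (min b (b - h)) (fwdPoly h ψ) m

@[fun_prop]
lemma continuous_weylSum (P j : ℕ) (a b : ℤ) (ψ : ℤ[X]) :
    Continuous fun α => weylSum P α j a b ψ := by
  induction j generalizing a b ψ with
  | zero => simp only [weylSum]; fun_prop
  | succ j ih =>
    simp only [weylSum]
    exact continuous_finsetSum _ fun h _ => ih _ _ _

lemma integral_e_mul_weylSum (P j : ℕ) (a b : ℤ) (ψ : ℤ[X]) (t : ℝ) (l : ℤ) :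
    ∫ α in t..(t + 1), e (α * l) * weylSum P α j a b ψ = weylCount P j a b ψ (-l) := by
  induction j generalizing a b ψ with
  | zero =>
    simp only [weylSum, weylCount, Finset.mul_sum]
    rw [intervalIntegral.integral_finsetSum fun n _ =>
      (Continuous.intervalIntegrable (by fun_prop) _ _)]
    have : ∀ n : ℤ, ∫ α in t..(t + 1), e (α * l) * e (α * (ψ.eval n : ℤ))
        = if ψ.eval n = -l then 1 else 0 := by
      intro n
      simp_rw [← e_add, ← mul_add, ← Int.cast_add]
      rw [integral_e_int_mul]
      congr 1
      rw [add_comm, add_eq_zero_iff_eq_neg]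
    simp_rw [this]
    simp
  | succ j ih =>
    simp only [weylSum, weylCount, Finset.mul_sum]
    rw [intervalIntegral.integral_finsetSum fun n _ =>
      (Continuous.intervalIntegrable (by fun_prop) _ _)]
    simp_rw [ih]
    push_cast
    rfl

lemma weylCount_le_trivial (P j : ℕ) (a b : ℤ) (hab : b - a < P) (ψ : ℤ[X]) (m : ℤ) :
    weylCount P j a b ψ m ≤ (2 * P) ^ j * P := by
  induction j generalizing a b ψ with
  | zero =>
    simp only [weylCount, pow_zero, one_mul]
    refine (Finset.card_filter_le _ _).trans ?_
    rw [Int.card_Icc]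
    omega
  | succ j ih =>
    simp only [weylCount]
    refine (Finset.sum_le_card_nsmul _ _ _
      fun h _ => ih (max a (a - h)) (min b (b - h)) (by omega) _).trans ?_
    rw [Int.card_Ioo, smul_eq_mul, pow_succ', mul_assoc]
    exact Nat.mul_le_mul_right _ (by omega)

lemma weylCount_C_mul (P j : ℕ) (a b : ℤ) (ψ : ℤ[X]) {c : ℤ} (hc : c ≠ 0) (m : ℤ) :
    weylCount P j a b (C c * ψ) (c * m) = weylCount P j a b ψ m := by
  induction j generalizing a b ψ with
  | zero => simp [weylCount, hc]
  | succ j ih => simp only [weylCount, fwdPoly_C_mul, ih]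

lemma weylCount_C_mul_of_not_dvd (P j : ℕ) (a b : ℤ) (ψ : ℤ[X]) {c m : ℤ} (hcm : ¬ c ∣ m) :
    weylCount P j a b (C c * ψ) m = 0 := by
  induction j generalizing a b ψ with
  | zero =>
    simp only [weylCount, Finset.card_eq_zero, Finset.filter_eq_empty_iff]
    intro n _ h
    apply hcm
    rw [← h, eval_mul, eval_C]
    exact dvd_mul_right _ _
  | succ j ih => simp only [weylCount, fwdPoly_C_mul, ih, Finset.sum_const_zero]

lemma card_filter_eval_eq_le (a b : ℤ) (ψ : ℤ[X]) (m : ℤ) (hψ : 0 < ψ.natDegree) :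
    ((Finset.Icc a b).filter fun n => ψ.eval n = m).card ≤ ψ.natDegree := by
  have hne : ψ - C m ≠ 0 := by
    intro h
    rw [sub_eq_zero.mp h, natDegree_C] at hψ
    exact hψ.ne rfl
  calc _ ≤ (ψ - C m).roots.toFinset.card := by
        apply Finset.card_le_card
        intro n hn
        rw [Finset.mem_filter] at hn
        rw [Multiset.mem_toFinset, mem_roots hne, IsRoot, eval_sub, eval_C, hn.2, sub_self]
    _ ≤ (ψ - C m).roots.card := Multiset.toFinset_card_le _
    _ ≤ (ψ - C m).natDegree := card_roots' _
    _ = ψ.natDegree := natDegree_sub_C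

lemma card_filter_dvd_le (s : Finset ℤ) {m : ℤ} (hm : m ≠ 0) :
    (s.filter fun h => h ∣ m).card ≤ 2 * m.natAbs.divisors.card := by
  calc (s.filter fun h => h ∣ m).card
      ≤ (m.natAbs.divisors.image (fun n : ℕ => (n : ℤ)) ∪
          m.natAbs.divisors.image (fun n : ℕ => -(n : ℤ))).card := by
        apply Finset.card_le_card
        intro h hh
        rw [Finset.mem_filter] at hh
        simp only [Finset.mem_union, Finset.mem_image, Nat.mem_divisors]
        have h1 : h.natAbs ∣ m.natAbs := Int.natAbs_dvd_natAbs.mpr hh.2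
        have h2 : m.natAbs ≠ 0 := Int.natAbs_ne_zero.mpr hm
        rcases Int.natAbs_eq h with h3 | h3
        · exact Or.inl ⟨_, ⟨h1, h2⟩, h3.symm⟩
        · exact Or.inr ⟨_, ⟨h1, h2⟩, h3.symm⟩
    _ ≤ _ := by
        refine (Finset.card_union_le _ _).trans ?_
        rw [two_mul]
        exact add_le_add Finset.card_image_le Finset.card_image_le

lemma weylCount_le_of_ne_zero (P j t : ℕ) (hjt : j < t) (a b : ℤ) (ψ : ℤ[X])
    (hψ : ψ.natDegree = t) {m : ℤ} (hm : m ≠ 0) :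
    weylCount P j a b ψ m ≤ (2 * m.natAbs.divisors.card) ^ j * t := by
  induction j generalizing a b ψ t m with
  | zero =>
    simp only [weylCount, pow_zero, one_mul]
    rw [← hψ]
    exact card_filter_eval_eq_le a b ψ m (by omega)
  | succ j ih =>
    obtain ⟨t, rfl⟩ : ∃ t', t = t' + 1 := ⟨t - 1, by omega⟩
    have key : ∀ h ∈ Finset.Ioo (-(P : ℤ)) P,
        weylCount P j (max a (a - h)) (min b (b - h)) (fwdPoly h ψ) m ≤
          if h ∣ m then (2 * m.natAbs.divisors.card) ^ j * (t + 1) else 0 := by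
      intro h _
      split_ifs with hd
      · obtain ⟨m', rfl⟩ := hd
        have hh : h ≠ 0 := left_ne_zero_of_mul hm
        have hm' : m' ≠ 0 := right_ne_zero_of_mul hm
        obtain ⟨ψ', h1, h2⟩ := exists_fwdPoly_eq_C_mul hh ψ t hψ
        rw [h1, weylCount_C_mul P j _ _ ψ' hh]
        refine (ih t (by omega) _ _ ψ' h2 hm').trans ?_
        have : m'.natAbs.divisors.card ≤ (h * m').natAbs.divisors.card := by
          apply Finset.card_le_card
          apply Nat.divisors_subset_of_dvd (Int.natAbs_ne_zero.mpr hm)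
          rw [Int.natAbs_mul]
          exact dvd_mul_left _ _
        gcongr
        omega
      · obtain ⟨ψ', h1⟩ := C_dvd_fwdPoly h ψ
        rw [h1, weylCount_C_mul_of_not_dvd P j _ _ ψ' hd]
    simp only [weylCount]
    refine (Finset.sum_le_sum key).trans ?_
    rw [← Finset.sum_filter, Finset.sum_const, smul_eq_mul, pow_succ', mul_assoc]
    exact Nat.mul_le_mul_right _ (card_filter_dvd_le _ hm)

lemma weylCount_zero_le (P j t : ℕ) (hjt : j < t) (a b : ℤ) (hab : b - a < P) (ψ : ℤ[X])
    (hψ : ψ.natDegree = t) (hP : 0 < P) :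
    weylCount P j a b ψ 0 ≤ (j + t) * (2 * P) ^ j := by
  induction j generalizing a b ψ t with
  | zero =>
    simp only [weylCount, pow_zero, mul_one, zero_add]
    rw [← hψ]
    exact card_filter_eval_eq_le a b ψ 0 (by omega)
  | succ j ih =>
    obtain ⟨t, rfl⟩ : ∃ t', t = t' + 1 := ⟨t - 1, by omega⟩
    have key : ∀ h ∈ Finset.Ioo (-(P : ℤ)) P,
        weylCount P j (max a (a - h)) (min b (b - h)) (fwdPoly h ψ) 0 ≤
          (if h = 0 then (2 * P) ^ j * P else 0) + (j + t) * (2 * P) ^ j := by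
      intro h _
      by_cases hh : h = 0
      · rw [if_pos hh]
        exact (weylCount_le_trivial P j _ _ (by omega) _ _).trans (Nat.le_add_right _ _)
      · rw [if_neg hh, zero_add]
        obtain ⟨ψ', h1, h2⟩ := exists_fwdPoly_eq_C_mul hh ψ t hψ
        have h3 := weylCount_C_mul P j (max a (a - h)) (min b (b - h)) ψ' hh 0
        rw [mul_zero] at h3
        rw [h1, h3]
        exact ih t (by omega) _ _ (by omega) ψ' h2
    simp only [weylCount]
    refine (Finset.sum_le_sum key).trans ?_
    rw [Finset.sum_add_distrib, Finset.sum_ite_eq' , Finset.sum_const, smul_eq_mul, Int.card_Ioo]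
    have h4 : ((P : ℤ) - -(P : ℤ) - 1).toNat ≤ 2 * P := by omega
    calc _ ≤ (2 * P) ^ j * P + 2 * P * ((j + t) * (2 * P) ^ j) := by
          gcongr
          split_ifs <;> simp
      _ ≤ 2 * ((2 * P) ^ j * P) + 2 * P * ((j + t) * (2 * P) ^ j) := by
          exact Nat.add_le_add_right (Nat.le_mul_of_pos_left _ two_pos) _
      _ ≤ (j + 1 + (t + 1)) * (2 * P) ^ (j + 1) := by
          rw [pow_succ]; nlinarith [Nat.zero_le ((2 * P) ^ j * P)]

/-- The exponential sum over the first `P` `k`-th powers. -/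
noncomputable def powSum (k P : ℕ) (α : ℝ) : ℂ := ∑ n ∈ Finset.Icc 1 P, e (α * (n : ℝ) ^ k)

@[fun_prop]
lemma continuous_powSum (k P : ℕ) : Continuous (powSum k P) := by
  unfold powSum; fun_prop

lemma powSum_eq_weylSum (k P Q : ℕ) (α : ℝ) :
    powSum k P α = weylSum Q α 0 1 P ((X : ℤ[X]) ^ k) := by
  simp only [powSum, weylSum]
  refine Finset.sum_nbij' (fun n => (n : ℤ)) (fun n => n.toNat) ?_ ?_ ?_ ?_ ?_
  · intro n; simp only [Finset.mem_Icc]; omega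
  · intro n; simp only [Finset.mem_Icc]; omega
  · intro n _; simp
  · intro n hn; simp only [Finset.mem_Icc] at hn; simp; omega
  · intro n _; simp

lemma norm_powSum_le (k P : ℕ) (α : ℝ) : ‖powSum k P α‖ ≤ P := by
  refine (norm_sum_le _ _).trans ?_
  simp

/-- Even moments of `powSum` are exponential sums with nonnegative integer multiplicities. -/
lemma exists_norm_powSum_pow_eq_sum (k P j : ℕ) : ∃ (ι : Type) (_ : Fintype ι) (l : ι → ℤ),
    Fintype.card ι = P ^ 2 ^ (j + 1) ∧ (∀ u, (l u).natAbs ≤ 2 ^ (j + 1) * P ^ k) ∧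
    ∀ α, ((‖powSum k P α‖ ^ 2 ^ (j + 1) : ℝ) : ℂ) = ∑ u, e (α * l u) := by
  induction j with
  | zero =>
    refine ⟨↥(Finset.Icc 1 P) × ↥(Finset.Icc 1 P), inferInstance,
      fun u => (u.1 : ℤ) ^ k - (u.2 : ℤ) ^ k, by simp [sq], ?_, ?_⟩
    · rintro ⟨⟨m, hm⟩, ⟨n, hn⟩⟩
      simp only [Finset.mem_Icc] at hm hn
      refine (Int.natAbs_sub_le _ _).trans ?_
      simp only [Int.natAbs_pow, Int.natAbs_natCast]
      have := Nat.pow_le_pow_left hm.2 k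
      have := Nat.pow_le_pow_left hn.2 k
      norm_num
      omega
    · intro α
      have h1 : ((‖powSum k P α‖ ^ 2 ^ (0 + 1) : ℝ) : ℂ)
          = powSum k P α * (starRingEnd ℂ) (powSum k P α) := by
        rw [Complex.mul_conj, Complex.normSq_eq_norm_sq]; simp
      rw [h1, powSum, map_sum, Finset.sum_mul_sum, Fintype.sum_prod_type,
        ← Finset.sum_coe_sort]
      refine Finset.sum_congr rfl fun m _ => ?_
      rw [← Finset.sum_coe_sort]
      refine Finset.sum_congr rfl fun n _ => ?_
      rw [← e_sub]
      push_cast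
      ring_nf
  | succ j ih =>
    obtain ⟨ι, _, l, h1, h2, h3⟩ := ih
    refine ⟨ι × ι, inferInstance, fun u => l u.1 + l u.2, ?_, ?_, ?_⟩
    · rw [Fintype.card_prod, h1]; ring
    · rintro ⟨u, v⟩
      refine (Int.natAbs_add_le _ _).trans ?_
      have := h2 u
      have := h2 v
      rw [pow_succ 2 (j + 1)]
      linarith
    · intro α
      have : ‖powSum k P α‖ ^ 2 ^ (j + 1 + 1)
          = ‖powSum k P α‖ ^ 2 ^ (j + 1) * ‖powSum k P α‖ ^ 2 ^ (j + 1) := by ring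
      rw [this]
      push_cast at h3 ⊢
      rw [h3, Finset.sum_mul_sum, Fintype.sum_prod_type]
      refine Finset.sum_congr rfl fun m _ => Finset.sum_congr rfl fun n _ => ?_
      rw [← e_add]
      push_cast
      ring_nf

lemma integral_norm_powSum_pow_step (k P j : ℕ) (hj : j + 1 < k) (hP : 0 < P) (t D : ℝ)
    (hD : ∀ m : ℕ, m ≠ 0 → m ≤ 2 ^ (j + 1) * P ^ k → (m.divisors.card : ℝ) ≤ D) :
    (∫ α in t..(t + 1), ‖powSum k P α‖ ^ 2 ^ (j + 2)) * (2 * P) ^ (j + 2) ≤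
      (2 * P) ^ 2 ^ (j + 1) *
        ((∫ α in t..(t + 1), ‖powSum k P α‖ ^ 2 ^ (j + 1)) * ((j + 1 + k) * (2 * P) ^ (j + 1)) +
          P ^ 2 ^ (j + 1) * ((2 * D) ^ (j + 1) * k)) := by
  obtain ⟨ι, _, l, h1, h2, h3⟩ := exists_norm_powSum_pow_eq_sum k P j
  classical
  have hdeg : ((X : ℤ[X]) ^ k).natDegree = k := natDegree_X_pow k
  have hzero : ((Finset.univ.filter fun u => l u = 0).card : ℝ)
      = ∫ α in t..(t + 1), ‖powSum k P α‖ ^ 2 ^ (j + 1) := by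
    apply Complex.ofReal_injective
    rw [← intervalIntegral.integral_ofReal]
    simp_rw [h3]
    rw [intervalIntegral.integral_finsetSum fun n _ =>
      (Continuous.intervalIntegrable (by fun_prop) _ _)]
    simp_rw [integral_e_int_mul]
    simp
  have hint : ∫ α in t..(t + 1), ‖powSum k P α‖ ^ 2 ^ (j + 1) *
      (weylSum P α (j + 1) 1 P ((X : ℤ[X]) ^ k)).re
      = ∑ u, (weylCount P (j + 1) 1 P ((X : ℤ[X]) ^ k) (-l u) : ℝ) := by
    have h4 : ∀ α, ‖powSum k P α‖ ^ 2 ^ (j + 1) * (weylSum P α (j + 1) 1 P ((X : ℤ[X]) ^ k)).re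
        = (∑ u, e (α * l u) * weylSum P α (j + 1) 1 P ((X : ℤ[X]) ^ k)).re := by
      intro α
      rw [← Finset.sum_mul, ← h3, Complex.re_ofReal_mul]
    simp_rw [h4]
    have h5 := intervalIntegral.intervalIntegral_re (μ := MeasureTheory.volume) (a := t)
      (b := t + 1) (𝕜 := ℂ)
      (f := fun α => ∑ u, e (α * l u) * weylSum P α (j + 1) 1 P ((X : ℤ[X]) ^ k))
      (Continuous.intervalIntegrable (by fun_prop) _ _)
    simp only [RCLike.re_to_complex] at h5
    rw [h5, intervalIntegral.integral_finsetSum fun n _ =>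
      (Continuous.intervalIntegrable (by fun_prop) _ _)]
    simp_rw [integral_e_mul_weylSum]
    simp
  have hcount : ∀ u, (weylCount P (j + 1) 1 P ((X : ℤ[X]) ^ k) (-l u) : ℝ) ≤
      (if l u = 0 then ((j + 1 + k) * (2 * P) ^ (j + 1) : ℝ) else 0) + (2 * D) ^ (j + 1) * k := by
    intro u
    have hD0 : 0 ≤ D := by
      have := hD 1 one_ne_zero (Nat.one_le_iff_ne_zero.mpr (by positivity))
      exact (Nat.cast_nonneg _).trans this
    by_cases hu : l u = 0
    · rw [if_pos hu, hu, neg_zero]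
      have := weylCount_zero_le P (j + 1) k hj 1 P (by omega) _ hdeg hP
      have h6 : (weylCount P (j + 1) 1 P ((X : ℤ[X]) ^ k) 0 : ℝ) ≤
          (j + 1 + k) * (2 * P) ^ (j + 1) := by exact_mod_cast this
      refine h6.trans (le_add_of_nonneg_right (by positivity))
    · rw [if_neg hu, zero_add]
      have := weylCount_le_of_ne_zero P (j + 1) k hj 1 P _ hdeg (neg_ne_zero.mpr hu)
      rw [Int.natAbs_neg] at this
      have h6 : (weylCount P (j + 1) 1 P ((X : ℤ[X]) ^ k) (-l u) : ℝ) ≤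
          (2 * ((l u).natAbs.divisors.card : ℝ)) ^ (j + 1) * k := by exact_mod_cast this
      refine h6.trans ?_
      gcongr
      exact hD _ (Int.natAbs_ne_zero.mpr hu) (h2 u)
  rw [← intervalIntegral.integral_mul_const]
  calc ∫ α in t..(t + 1), ‖powSum k P α‖ ^ 2 ^ (j + 2) * (2 * P : ℝ) ^ (j + 2)
      ≤ ∫ α in t..(t + 1), (2 * P : ℝ) ^ 2 ^ (j + 1) * (‖powSum k P α‖ ^ 2 ^ (j + 1) *
          (weylSum P α (j + 1) 1 P ((X : ℤ[X]) ^ k)).re) := by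
        apply intervalIntegral.integral_mono (by linarith)
          (Continuous.intervalIntegrable (by fun_prop) _ _)
          (Continuous.intervalIntegrable ?_ _ _)
        · intro α
          have h6 := norm_weylSum_zero_pow_le P α j 1 P (by omega) ((X : ℤ[X]) ^ k)
          rw [← powSum_eq_weylSum] at h6
          have h7 := mul_le_mul_of_nonneg_left h6
            (by positivity : 0 ≤ ‖powSum k P α‖ ^ 2 ^ (j + 1))
          have h8 : ‖powSum k P α‖ ^ 2 ^ (j + 2) = ‖powSum k P α‖ ^ 2 ^ (j + 1) *
            ‖powSum k P α‖ ^ 2 ^ (j + 1) := by ring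
          dsimp only
          rw [h8]
          linarith
        · have := Complex.continuous_re.comp (continuous_weylSum P (j + 1) 1 P ((X : ℤ[X]) ^ k))
          have h9 := continuous_powSum k P
          exact continuous_const.mul ((h9.norm.pow _).mul this)
    _ = (2 * P : ℝ) ^ 2 ^ (j + 1) *
        ∑ u, (weylCount P (j + 1) 1 P ((X : ℤ[X]) ^ k) (-l u) : ℝ) := by
        rw [intervalIntegral.integral_const_mul, hint]
    _ ≤ (2 * P : ℝ) ^ 2 ^ (j + 1) * ∑ u, ((if l u = 0 then
        ((j + 1 + k) * (2 * P) ^ (j + 1) : ℝ) else 0) + (2 * D) ^ (j + 1) * k) := by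
        gcongr with u
        exact hcount u
    _ = _ := by
        rw [Finset.sum_add_distrib, ← Finset.sum_filter, Finset.sum_const, Finset.sum_const,
          Finset.card_univ, h1, nsmul_eq_mul, nsmul_eq_mul, hzero]
        push_cast
        ring

lemma exists_pow_card_divisors_le (k j c : ℕ) (ε : ℝ) (hε : 0 < ε) :
    ∃ C : ℝ, 1 ≤ C ∧ ∀ P : ℕ, 0 < P → ∃ D : ℝ, 0 ≤ D ∧ D ^ j ≤ C * (P : ℝ) ^ ε ∧
      ∀ m : ℕ, m ≠ 0 → m ≤ c * P ^ k → (m.divisors.card : ℝ) ≤ D := by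
  set δ : ℝ := ε / ((k + 1) * (j + 1)) with hδ
  have hδ0 : 0 < δ := by positivity
  obtain ⟨C, hC, h⟩ := exists_card_divisors_le δ hδ0
  refine ⟨max 1 ((C * (c : ℝ) ^ δ) ^ j), le_max_left _ _, fun P hP => ?_⟩
  have hP1 : (1 : ℝ) ≤ P := by exact_mod_cast hP
  refine ⟨C * (c * (P : ℝ) ^ k) ^ δ, by positivity, ?_, ?_⟩
  · have h1 : (((P : ℝ) ^ k) ^ δ) ^ j ≤ (P : ℝ) ^ ε := by
      rw [← Real.rpow_natCast, ← Real.rpow_natCast, ← Real.rpow_mul (by positivity),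
        ← Real.rpow_mul (by positivity)]
      apply Real.rpow_le_rpow_of_exponent_le hP1
      have : ε = (k + 1) * δ * (j + 1) := by rw [hδ]; field_simp
      rw [this, ← mul_assoc]
      gcongr <;> linarith
    calc (C * (c * (P : ℝ) ^ k) ^ δ) ^ j
        = (C * (c : ℝ) ^ δ) ^ j * (((P : ℝ) ^ k) ^ δ) ^ j := by
          rw [Real.mul_rpow (by positivity) (by positivity)]; ring
      _ ≤ max 1 ((C * (c : ℝ) ^ δ) ^ j) * (P : ℝ) ^ ε := by
          gcongr
          exact le_max_right _ _
  · intro m hm hmP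
    refine (h m hm).trans ?_
    gcongr
    exact_mod_cast hmP

/-- Hua's inequality. -/
lemma exists_integral_norm_powSum_pow_le (k j : ℕ) (hjk : j + 1 ≤ k) (ε : ℝ) (hε : 0 < ε) :
    ∃ C : ℝ, 0 ≤ C ∧ ∀ P : ℕ, 0 < P → ∀ t : ℝ,
      (∫ α in t..(t + 1), ‖powSum k P α‖ ^ 2 ^ (j + 1)) * (P : ℝ) ^ (j + 1) ≤
        C * (P : ℝ) ^ 2 ^ (j + 1) * (P : ℝ) ^ ε := by
  induction j with
  | zero =>
    refine ⟨1, zero_le_one, fun P hP t => ?_⟩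
    have hP1 : (1 : ℝ) ≤ P := by exact_mod_cast hP
    have h1 : ∫ α in t..(t + 1), ‖powSum k P α‖ ^ 2 ^ (0 + 1) = P := by
      have h2 : ∀ α, ((‖powSum k P α‖ ^ 2 ^ (0 + 1) : ℝ) : ℂ) =
          ∑ m ∈ Finset.Icc 1 P, ∑ n ∈ Finset.Icc 1 P, e (α * ((m : ℤ) ^ k - (n : ℤ) ^ k : ℤ)) := by
        intro α
        have h1 : ((‖powSum k P α‖ ^ 2 ^ (0 + 1) : ℝ) : ℂ)
            = powSum k P α * (starRingEnd ℂ) (powSum k P α) := by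
          rw [Complex.mul_conj, Complex.normSq_eq_norm_sq]; simp
        rw [h1, powSum, map_sum, Finset.sum_mul_sum]
        refine Finset.sum_congr rfl fun m _ => Finset.sum_congr rfl fun n _ => ?_
        rw [← e_neg, ← e_add]
        push_cast
        ring_nf
      apply Complex.ofReal_injective
      rw [← intervalIntegral.integral_ofReal]
      simp_rw [h2]
      rw [intervalIntegral.integral_finsetSum fun n _ =>
        (Continuous.intervalIntegrable (by fun_prop) _ _)]
      have h3 : ∀ m ∈ Finset.Icc 1 P, ∫ α in t..(t + 1), ∑ n ∈ Finset.Icc 1 P,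
          e (α * ((m : ℤ) ^ k - (n : ℤ) ^ k : ℤ)) = 1 := by
        intro m hm
        rw [intervalIntegral.integral_finsetSum fun n _ =>
          (Continuous.intervalIntegrable (by fun_prop) _ _)]
        simp_rw [integral_e_int_mul]
        rw [Finset.sum_eq_single_of_mem m hm]
        · simp
        · intro n _ hn
          rw [if_neg]
          rw [sub_eq_zero]
          norm_cast
          exact fun h => hn (Nat.pow_left_injective (by omega) h).symm
      rw [Finset.sum_congr rfl h3]
      simp
    rw [h1]
    have := Real.one_le_rpow hP1 hε.le
    have h4 : (0 : ℝ) ≤ P ^ 2 := by positivity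
    norm_num
    nlinarith
  | succ j ih =>
    obtain ⟨C, hC, h⟩ := ih (by omega)
    obtain ⟨C₁, hC₁, h₁⟩ := exists_pow_card_divisors_le k (j + 1) (2 ^ (j + 1)) ε hε
    set A : ℝ := 2 ^ 2 ^ (j + 1) * (C * ((j + 1 + k) * 2 ^ (j + 1)) + 2 ^ (j + 1) * C₁ * k) with hA
    refine ⟨A, by positivity, fun P hP t => ?_⟩
    obtain ⟨D, hD0, hD1, hD2⟩ := h₁ P hP
    have h2 := integral_norm_powSum_pow_step k P j (by omega) hP t D hD2
    have h3 := h P hP t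
    set I₁ := ∫ α in t..(t + 1), ‖powSum k P α‖ ^ 2 ^ (j + 1)
    have hI : 0 ≤ ∫ α in t..(t + 1), ‖powSum k P α‖ ^ 2 ^ (j + 2) :=
      intervalIntegral.integral_nonneg (by linarith) fun _ _ => by positivity
    set I₂ := ∫ α in t..(t + 1), ‖powSum k P α‖ ^ 2 ^ (j + 2)
    calc I₂ * (P : ℝ) ^ (j + 2) ≤ I₂ * (2 * P) ^ (j + 2) := by
          gcongr; linarith [(Nat.cast_nonneg P : (0 : ℝ) ≤ P)]
      _ ≤ _ := h2
      _ = 2 ^ 2 ^ (j + 1) * P ^ 2 ^ (j + 1) * ((j + 1 + k) * 2 ^ (j + 1) *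
            (I₁ * P ^ (j + 1)) + P ^ 2 ^ (j + 1) * (2 ^ (j + 1) * D ^ (j + 1) * k)) := by
          rw [mul_pow (2 : ℝ), mul_pow (2 : ℝ), mul_pow (2 : ℝ)]; ring
      _ ≤ 2 ^ 2 ^ (j + 1) * P ^ 2 ^ (j + 1) * ((j + 1 + k) * 2 ^ (j + 1) *
            (C * (P : ℝ) ^ 2 ^ (j + 1) * (P : ℝ) ^ ε) +
              P ^ 2 ^ (j + 1) * (2 ^ (j + 1) * (C₁ * (P : ℝ) ^ ε) * k)) := by
          gcongr
      _ = A * (P : ℝ) ^ 2 ^ (j + 1 + 1) * (P : ℝ) ^ ε := by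
          rw [hA, pow_succ 2 (j + 1), pow_mul (P : ℝ)]; ring

end Waring

namespace Waring

open Polynomial

/-- Iterated sums of `g` over products `m * h₁ * ⋯ * hⱼ` with `|hᵢ| < P`. -/
noncomputable def prodSum (P : ℕ) (g : ℤ → ℝ) : ℕ → ℤ → ℝ
  | 0, m => g m
  | j + 1, m => ∑ h ∈ Finset.Ioo (-(P : ℤ)) P, prodSum P g j (m * h)

lemma norm_weylSum_le_prodSum (P : ℕ) (α : ℝ) (j : ℕ) (a b : ℤ) (hab : b - a < P) (ψ : ℤ[X])
    (hψ : ψ.natDegree ≤ j + 1) :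
    ‖weylSum P α j a b ψ‖ ≤
      prodSum P (fun m => linBound P (α * m)) j ((j + 1).factorial * ψ.coeff (j + 1)) := by
  induction j generalizing a b ψ with
  | zero =>
    simp only [weylSum, prodSum]
    have h1 : ∀ n : ℤ, e (α * (ψ.eval n : ℤ)) =
        e (α * ((ψ.coeff 1 : ℤ) : ℝ) * n + α * (ψ.coeff 0 : ℤ)) := by
      intro n
      have h2 : ψ.eval n = ψ.coeff 1 * n + ψ.coeff 0 := by
        conv_lhs => rw [Polynomial.eq_X_add_C_of_natDegree_le_one hψ]
        simp
      rw [h2]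
      push_cast
      ring_nf
    simp_rw [h1]
    have := norm_sum_Icc_e_linear_le P a b hab (α * ((ψ.coeff 1 : ℤ) : ℝ)) (α * (ψ.coeff 0 : ℤ))
    simpa using this
  | succ j ih =>
    simp only [weylSum, prodSum]
    refine (norm_sum_le _ _).trans (Finset.sum_le_sum fun h _ => ?_)
    have hdeg : (fwdPoly h ψ).natDegree ≤ j + 1 :=
      natDegree_fwdPoly_le h ψ (j + 1) hψ
    refine (ih _ _ (by omega) _ hdeg).trans (le_of_eq ?_)
    rw [coeff_fwdPoly_of_natDegree_le h ψ (j + 1) hψ, Nat.factorial_succ (j + 1)]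
    push_cast
    ring_nf

lemma prodSum_zero_right (P : ℕ) (g : ℤ → ℝ) (hg : 0 ≤ g 0) (j : ℕ) :
    prodSum P g j 0 ≤ (2 * P) ^ j * g 0 := by
  induction j with
  | zero => simp [prodSum]
  | succ j ih =>
    simp only [prodSum, zero_mul, Finset.sum_const, nsmul_eq_mul, Int.card_Ioo]
    have h4 : ((((P : ℤ) - -(P : ℤ) - 1).toNat : ℕ) : ℝ) ≤ 2 * P := by
      have : ((P : ℤ) - -(P : ℤ) - 1).toNat ≤ 2 * P := by omega
      exact_mod_cast this
    calc _ ≤ ((((P : ℤ) - -(P : ℤ) - 1).toNat : ℕ) : ℝ) * ((2 * P) ^ j * g 0) := by gcongr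
      _ ≤ (2 * P : ℝ) * ((2 * P) ^ j * g 0) := by gcongr
      _ = _ := by ring

lemma prodSum_le (P : ℕ) (g : ℤ → ℝ) (hg : ∀ m, 0 ≤ g m) (D : ℝ) (hD0 : 0 ≤ D) (j : ℕ)
    (hD : ∀ m : ℕ, m ≠ 0 → m ≤ P ^ j → (m.divisors.card : ℝ) ≤ D) (hP : 0 < P) (m : ℤ) :
    prodSum P g j m * (2 * P) ≤ j * (2 * P) ^ j * g 0 +
      2 * P * (2 * D) ^ j *
        ∑ u ∈ (Finset.Icc (-((P : ℤ) ^ j)) (P ^ j)).filter (· ≠ 0), g (m * u) := by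
  classical
  induction j generalizing m with
  | zero =>
    simp only [prodSum, pow_zero, CharP.cast_eq_zero, zero_mul, zero_add, mul_one]
    rw [mul_comm]
    gcongr
    calc g m = g (m * 1) := by rw [mul_one]
      _ ≤ _ := Finset.single_le_sum (f := fun u => g (m * u)) (fun u _ => hg _) (by simp)
  | succ j ih =>
    have hD' : ∀ m : ℕ, m ≠ 0 → m ≤ P ^ j → (m.divisors.card : ℝ) ≤ D := fun m hm hmP =>
      hD m hm (hmP.trans (Nat.pow_le_pow_right hP (Nat.le_succ j)))
    set T := (Finset.Icc (-((P : ℤ) ^ (j + 1))) (P ^ (j + 1))).filter (· ≠ 0) with hT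
    have key : ∀ h ∈ Finset.Ioo (-(P : ℤ)) P, prodSum P g j (m * h) * (2 * P) ≤
        (if h = 0 then (2 * P) ^ (j + 1) * g 0 else 0) + (j * (2 * P) ^ j * g 0 +
          2 * P * (2 * D) ^ j * ∑ u ∈ T, if h ∣ u then g (m * u) else 0) := by
      intro h hh
      have hs : 0 ≤ ∑ u ∈ T, if h ∣ u then g (m * u) else 0 :=
        Finset.sum_nonneg fun u _ => by split_ifs; exacts [hg _, le_rfl]
      have hg0 := hg 0
      by_cases h0 : h = 0
      · rw [if_pos h0, h0, mul_zero]
        have := prodSum_zero_right P g (hg 0) j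
        rw [h0] at hs
        have h1 : prodSum P g j 0 * (2 * P) ≤ (2 * P) ^ (j + 1) * g 0 := by
          calc _ ≤ ((2 * P) ^ j * g 0) * (2 * P : ℝ) := by gcongr
            _ = _ := by ring
        refine h1.trans (le_add_of_nonneg_right ?_)
        positivity
      · rw [if_neg h0, zero_add]
        refine (ih hD' (m * h)).trans ?_
        gcongr
        rw [← Finset.sum_filter]
        have hinj : Set.InjOn (fun u : ℤ => h * u)
            ((Finset.Icc (-((P : ℤ) ^ j)) (P ^ j)).filter (· ≠ 0)) :=
          fun x _ y _ hxy => mul_left_cancel₀ h0 hxy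
        have h2 := Finset.sum_image (f := fun u => g (m * u)) hinj
        simp only [mul_assoc]
        rw [← h2]
        apply Finset.sum_le_sum_of_subset_of_nonneg
        · intro v hv
          rw [Finset.mem_image] at hv
          obtain ⟨u, hu, rfl⟩ := hv
          rw [Finset.mem_filter, Finset.mem_Icc, ← abs_le] at hu
          rw [Finset.mem_Ioo, ← abs_lt] at hh
          rw [Finset.mem_filter, hT, Finset.mem_filter, Finset.mem_Icc, ← abs_le, abs_mul]
          refine ⟨⟨?_, mul_ne_zero h0 hu.2⟩, dvd_mul_right _ _⟩
          rw [pow_succ']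
          exact mul_le_mul hh.le hu.1 (abs_nonneg _) (by positivity)
        · intro u _ _
          exact hg _
    have hcard : ∑ h ∈ Finset.Ioo (-(P : ℤ)) P, ∑ u ∈ T, (if h ∣ u then g (m * u) else 0) ≤
        2 * D * ∑ u ∈ T, g (m * u) := by
      rw [Finset.sum_comm, Finset.mul_sum]
      refine Finset.sum_le_sum fun u hu => ?_
      rw [hT, Finset.mem_filter, Finset.mem_Icc, ← abs_le] at hu
      rw [← Finset.sum_filter, Finset.sum_const, nsmul_eq_mul]
      have h1 := card_filter_dvd_le (Finset.Ioo (-(P : ℤ)) P) hu.2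
      have h2 : (((Finset.Ioo (-(P : ℤ)) P).filter fun h => h ∣ u).card : ℝ) ≤
          2 * (u.natAbs.divisors.card : ℝ) := by exact_mod_cast h1
      have h3 := hD u.natAbs (Int.natAbs_ne_zero.mpr hu.2) (by
        rw [Int.abs_eq_natAbs] at hu; exact_mod_cast hu.1)
      have := hg (m * u)
      gcongr
      linarith
    simp only [prodSum]
    rw [Finset.sum_mul]
    refine (Finset.sum_le_sum key).trans ?_
    rw [Finset.sum_add_distrib, Finset.sum_add_distrib, Finset.sum_ite_eq', Finset.sum_const,
      nsmul_eq_mul, Int.card_Ioo, ← Finset.mul_sum]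
    have h4 : ((((P : ℤ) - -(P : ℤ) - 1).toNat : ℕ) : ℝ) ≤ 2 * P := by
      have : ((P : ℤ) - -(P : ℤ) - 1).toNat ≤ 2 * P := by omega
      exact_mod_cast this
    have hg0 := hg 0
    rw [if_pos (by simp [hP])]
    calc _ ≤ (2 * P : ℝ) ^ (j + 1) * g 0 + (2 * P * (j * (2 * P) ^ j * g 0) +
          2 * P * (2 * D) ^ j * (2 * D * ∑ u ∈ T, g (m * u))) := by gcongr
      _ = _ := by push_cast; ring

end Waring

namespace Waring

lemma min_le_distInt_div (q s : ℕ) (hq : 0 < q) (hs : s ≤ q) :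
    min (s : ℝ) ((q - s : ℕ) : ℝ) / q ≤ distInt ((s : ℝ) / q) := by
  have hq' : (0 : ℝ) < q := by exact_mod_cast hq
  rw [distInt, div_le_iff₀ hq', Nat.cast_sub hs]
  set n := round ((s : ℝ) / q)
  have h1 : |(s : ℝ) / q - n| * q = |(s : ℝ) - n * q| := by
    rw [← abs_of_pos hq', ← abs_mul, abs_of_pos hq']
    congr 1
    field_simp
  rw [h1]
  rcases le_or_gt n 0 with hn | hn
  · have : (n : ℝ) ≤ 0 := by exact_mod_cast hn
    refine (min_le_left _ _).trans (le_trans ?_ (le_abs_self _))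
    nlinarith
  · have : (1 : ℝ) ≤ n := by exact_mod_cast hn
    refine (min_le_right _ _).trans (le_trans ?_ (neg_le_abs _))
    nlinarith

/-- Majorant for `linBound P` at distance about `t / q` from the integers. -/
noncomputable def blockBound (P q t : ℕ) : ℝ := if t ≤ 2 then (P : ℝ) else q / (2 * ((t : ℝ) - 2))

lemma blockBound_nonneg (P q t : ℕ) : 0 ≤ blockBound P q t := by
  unfold blockBound
  split_ifs with h
  · positivity
  · have : (3 : ℝ) ≤ t := by exact_mod_cast (by omega : 3 ≤ t)
    have : 0 ≤ (t : ℝ) - 2 := by linarith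
    positivity

lemma sum_blockBound_le (P q n : ℕ) (hq : 0 < q) (hn : n ≤ q + 3) :
    ∑ t ∈ Finset.range n, blockBound P q t ≤ 3 * P + q / 2 * (1 + Real.log q) := by
  calc ∑ t ∈ Finset.range n, blockBound P q t
      ≤ ∑ t ∈ Finset.range (q + 3), blockBound P q t :=
        Finset.sum_le_sum_of_subset_of_nonneg (Finset.range_mono hn)
          fun t _ _ => blockBound_nonneg P q t
    _ = ∑ i ∈ Finset.range q, (q : ℝ) / 2 * ((i : ℝ) + 1)⁻¹ + 3 * P := by
        rw [Finset.sum_range_succ', Finset.sum_range_succ', Finset.sum_range_succ']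
        have h1 : ∀ i : ℕ, blockBound P q (i + 1 + 1 + 1) = (q : ℝ) / 2 * ((i : ℝ) + 1)⁻¹ := by
          intro i
          rw [blockBound, if_neg (by omega), div_mul_eq_div_div, div_eq_mul_inv]
          push_cast
          ring_nf
        simp_rw [h1]
        simp only [blockBound, zero_add, Nat.reduceAdd, Nat.reduceLeDiff, if_true]
        ring
    _ ≤ _ := by
        rw [← Finset.mul_sum]
        have h2 := harmonic_le_one_add_log q
        rw [harmonic] at h2
        push_cast at h2
        have := mul_le_mul_of_nonneg_left h2 (by positivity : (0 : ℝ) ≤ q / 2)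
        linarith

lemma sum_linBound_block_le (P q : ℕ) (hq : 0 < q) (a : ℤ) (hcop : IsCoprime a (q : ℤ)) (α : ℝ)
    (hα : |α - a / q| ≤ 1 / (q : ℝ) ^ 2) (y : ℝ) :
    ∑ r ∈ Finset.range q, linBound P (y + α * r) ≤ 6 * P + q * (1 + Real.log q) := by
  have hq' : (0 : ℝ) < q := by exact_mod_cast hq
  set c : ℤ := ⌊y * q⌋ with hc
  have hc1 : 0 ≤ y * q - c := sub_nonneg.mpr (Int.floor_le _)
  have hc2 : y * q - c < 1 := by linarith [Int.lt_floor_add_one (y * q)]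
  set σ : ℕ → ℕ := fun r => ((c + a * r) % q).toNat with hσ
  have hσr : ∀ r, ((σ r : ℕ) : ℤ) = (c + a * r) % q := fun r =>
    Int.toNat_of_nonneg (Int.emod_nonneg _ (by exact_mod_cast hq.ne'))
  have hσlt : ∀ r, σ r < q := fun r => by
    have := Int.emod_lt_of_pos (c + a * r) (by exact_mod_cast hq : (0 : ℤ) < q)
    have := hσr r
    omega
  have hinj : Set.InjOn σ (Finset.range q) := by
    intro r hr r' hr' h
    rw [Finset.coe_range, Set.mem_Iio] at hr hr'
    have h1 : (c + a * r) % q = (c + a * r') % q := by rw [← hσr, ← hσr, h]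
    have h2 : (q : ℤ) ∣ a * ((r : ℤ) - r') := by
      have := Int.ModEq.dvd h1.symm
      have h3 : a * ((r : ℤ) - r') = c + a * r - (c + a * r') := by ring
      rwa [h3]
    have h3 : (q : ℤ) ∣ (r : ℤ) - r' := hcop.symm.dvd_of_dvd_mul_left h2
    have h4 := Int.eq_zero_of_abs_lt_dvd h3 (by rw [abs_lt]; omega)
    omega
  have hpt : ∀ r ∈ Finset.range q, linBound P (y + α * r) ≤
      blockBound P q (σ r) + blockBound P q (q - σ r) := by
    intro r hr
    rw [Finset.mem_range] at hr
    by_cases h1 : σ r ≤ 2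
    · rw [blockBound, if_pos h1]
      exact (linBound_le _ _).trans (le_add_of_nonneg_right (blockBound_nonneg _ _ _))
    by_cases h2 : q - σ r ≤ 2
    · rw [blockBound.eq_1 P q (q - σ r), if_pos h2]
      exact (linBound_le _ _).trans (le_add_of_nonneg_left (blockBound_nonneg _ _ _))
    have hd := min_le_distInt_div q (σ r) hq (hσlt r).le
    set t : ℕ := min (σ r) (q - σ r) with ht
    have ht3 : 3 ≤ t := by omega
    have ht3' : (3 : ℝ) ≤ t := by exact_mod_cast ht3
    rw [← Nat.cast_min, ← ht] at hd
    have hz : (σ r : ℝ) / q = ((c + a * r : ℤ) : ℝ) / q + ((-((c + a * r) / q) : ℤ) : ℝ) := by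
      have h3 := Int.emod_add_mul_ediv (c + a * r) q
      rw [← hσr] at h3
      have h4 : ((σ r : ℕ) : ℝ) + q * (((c + a * r) / q : ℤ) : ℝ) = ((c + a * r : ℤ) : ℝ) := by
        rw [← h3]; push_cast; rw [h3]
      rw [← h4]
      push_cast
      field_simp
      ring
    rw [hz, distInt_add_int] at hd
    have hclose : |((c + a * r : ℤ) : ℝ) / q - (y + α * r)| ≤ 2 / q := by
      have h5 : ((c + a * r : ℤ) : ℝ) / q - (y + α * r) =
          -((y * q - c) / q) - (α - a / q) * r := by
        push_cast; field_simp; ring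
      rw [h5]
      have h6 : |-((y * q - c) / q)| ≤ 1 / q := by
        rw [abs_neg, abs_div, abs_of_nonneg hc1, abs_of_pos hq']
        gcongr
      have h7 : |(α - a / q) * r| ≤ 1 / q := by
        rw [abs_mul, Nat.abs_cast]
        calc _ ≤ 1 / (q : ℝ) ^ 2 * q := by gcongr
          _ = 1 / q := by field_simp
      have h8 := abs_sub (-((y * q - c) / q)) ((α - a / q) * r)
      have h9 : (2 : ℝ) / q = 1 / q + 1 / q := by ring
      linarith
    have hdist : ((t : ℝ) - 2) / q ≤ distInt (y + α * r) := by
      have := distInt_le_add_abs_sub (((c + a * r : ℤ) : ℝ) / q) (y + α * r)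
      rw [sub_div]
      linarith
    have h8 := linBound_le_of_le_distInt (P := P) (div_pos (by linarith) hq') hdist
    have h9 : 1 / (2 * (((t : ℝ) - 2) / q)) = blockBound P q t := by
      rw [blockBound, if_neg (by omega)]
      field_simp
    rw [h9] at h8
    refine h8.trans ?_
    rcases min_choice (σ r) (q - σ r) with h | h
    · rw [ht, h]; exact le_add_of_nonneg_right (blockBound_nonneg _ _ _)
    · rw [ht, h]; exact le_add_of_nonneg_left (blockBound_nonneg _ _ _)
  calc ∑ r ∈ Finset.range q, linBound P (y + α * r)
      ≤ ∑ r ∈ Finset.range q, (blockBound P q (σ r) + blockBound P q (q - σ r)) :=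
        Finset.sum_le_sum hpt
    _ = ∑ s ∈ (Finset.range q).image σ, (blockBound P q s + blockBound P q (q - s)) :=
        (Finset.sum_image (f := fun s => blockBound P q s + blockBound P q (q - s)) hinj).symm
    _ ≤ ∑ s ∈ Finset.range q, (blockBound P q s + blockBound P q (q - s)) := by
        apply Finset.sum_le_sum_of_subset_of_nonneg
        · intro s hs
          rw [Finset.mem_image] at hs
          obtain ⟨r, _, rfl⟩ := hs
          exact Finset.mem_range.mpr (hσlt r)
        · intro s _ _
          exact add_nonneg (blockBound_nonneg _ _ _) (blockBound_nonneg _ _ _)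
    _ ≤ (3 * P + q / 2 * (1 + Real.log q)) + (3 * P + q / 2 * (1 + Real.log q)) := by
        rw [Finset.sum_add_distrib]
        refine add_le_add (sum_blockBound_le P q q hq (by omega)) ?_
        have h1 : ∑ s ∈ Finset.range q, blockBound P q (q - s)
            = ∑ s ∈ Finset.range q, blockBound P q (s + 1) := by
          rw [← Finset.sum_range_reflect]
          refine Finset.sum_congr rfl fun s hs => ?_
          rw [Finset.mem_range] at hs
          congr 1
          omega
        rw [h1]
        refine le_trans ?_ (sum_blockBound_le P q (q + 1) hq (by omega))
        rw [Finset.sum_range_succ']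
        exact le_add_of_nonneg_right (blockBound_nonneg _ _ _)
    _ = _ := by ring

lemma sum_linBound_le (P q : ℕ) (hq : 0 < q) (a : ℤ) (hcop : IsCoprime a (q : ℤ)) (α : ℝ)
    (hα : |α - a / q| ≤ 1 / (q : ℝ) ^ 2) (M : ℕ) :
    ∑ m ∈ Finset.range (M + 1), linBound P (α * m) ≤
      ((M : ℝ) / q + 1) * (6 * P + q * (1 + Real.log q)) := by
  have hblock : ∀ L : ℕ, ∑ m ∈ Finset.range (L * q), linBound P (α * m) ≤
      L * (6 * P + q * (1 + Real.log q)) := by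
    intro L
    induction L with
    | zero => simp
    | succ L ih =>
      rw [Nat.succ_mul, Finset.sum_range_add]
      have h := sum_linBound_block_le P q hq a hcop α hα (α * (L * q))
      have h2 : ∀ r : ℕ, α * ((L * q + r : ℕ) : ℝ) = α * (L * q) + α * r := by
        intro r; push_cast; ring
      simp_rw [h2]
      push_cast
      linarith
  have hlog : 0 ≤ Real.log q := Real.log_natCast_nonneg q
  calc ∑ m ∈ Finset.range (M + 1), linBound P (α * m)
      ≤ ∑ m ∈ Finset.range ((M / q + 1) * q), linBound P (α * m) := by
        apply Finset.sum_le_sum_of_subset_of_nonneg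
        · apply Finset.range_mono
          rw [Nat.succ_le_iff, mul_comm]
          exact Nat.lt_mul_div_succ M hq
        · intro m _ _; exact linBound_nonneg _ _
    _ ≤ ((M / q + 1 : ℕ) : ℝ) * (6 * P + q * (1 + Real.log q)) := hblock _
    _ ≤ _ := by
        gcongr
        push_cast
        gcongr
        exact Nat.cast_div_le

end Waring

namespace Waring

open Polynomial

lemma sum_filter_ne_zero_le (f : ℤ → ℝ) (hf : ∀ u, 0 ≤ f u) (hneg : ∀ u, f (-u) = f u) (c U : ℕ)
    (hc : 0 < c) :
    ∑ u ∈ (Finset.Icc (-(U : ℤ)) U).filter (· ≠ 0), f (c * u) ≤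
      2 * ∑ m ∈ Finset.range (c * U + 1), f m := by
  classical
  have hsub : (Finset.Icc (-(U : ℤ)) U).filter (· ≠ 0) ⊆
      (Finset.Icc 1 U).image (fun n : ℕ => (n : ℤ)) ∪
        (Finset.Icc 1 U).image (fun n : ℕ => -(n : ℤ)) := by
    intro u hu
    simp only [Finset.mem_filter, Finset.mem_Icc] at hu
    simp only [Finset.mem_union, Finset.mem_image, Finset.mem_Icc]
    rcases lt_or_gt_of_ne hu.2 with h | h
    · exact Or.inr ⟨u.natAbs, by omega, by omega⟩
    · exact Or.inl ⟨u.natAbs, by omega, by omega⟩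
  have hpos : ∑ n ∈ Finset.Icc 1 U, f (c * n) ≤ ∑ m ∈ Finset.range (c * U + 1), f m := by
    have hinj : Set.InjOn (fun n : ℕ => c * n) (Finset.Icc 1 U) :=
      fun x _ y _ h => Nat.eq_of_mul_eq_mul_left hc h
    have h1 := Finset.sum_image (f := fun m : ℕ => f m) hinj
    push_cast at h1
    rw [← h1]
    apply Finset.sum_le_sum_of_subset_of_nonneg
    · intro m hm
      rw [Finset.mem_image] at hm
      obtain ⟨n, hn, rfl⟩ := hm
      rw [Finset.mem_Icc] at hn
      rw [Finset.mem_range, Nat.lt_succ_iff]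
      exact Nat.mul_le_mul_left _ hn.2
    · intro m _ _; exact hf _
  refine (Finset.sum_le_sum_of_subset_of_nonneg hsub fun u _ _ => hf _).trans ?_
  have h2 := Finset.sum_union_inter (f := fun u => f (c * u))
    (s₁ := (Finset.Icc 1 U).image (fun n : ℕ => (n : ℤ)))
    (s₂ := (Finset.Icc 1 U).image (fun n : ℕ => -(n : ℤ)))
  have h3 : 0 ≤ ∑ u ∈ (Finset.Icc 1 U).image (fun n : ℕ => (n : ℤ)) ∩
      (Finset.Icc 1 U).image (fun n : ℕ => -(n : ℤ)), f (c * u) :=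
    Finset.sum_nonneg fun u _ => hf _
  rw [Finset.sum_image (by intro x _ y _ h; simpa using h),
    Finset.sum_image (by intro x _ y _ h; simpa using h)] at h2
  simp only [mul_neg, hneg] at h2
  linarith

/-- Weyl's inequality, uniformly for sums of length at most `P`. -/
lemma exists_norm_powSum_pow_le (k : ℕ) (hk : 2 ≤ k) (ε : ℝ) (hε : 0 < ε) :
    ∃ C : ℝ, 0 ≤ C ∧ ∀ P n q : ℕ, 0 < P → n ≤ P → 0 < q → ∀ a : ℤ, IsCoprime a (q : ℤ) →
      ∀ α : ℝ, |α - a / q| ≤ 1 / (q : ℝ) ^ 2 →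
      ‖powSum k n α‖ ^ 2 ^ (k - 1) ≤ C * ((P : ℝ) ^ ε * (q : ℝ) ^ ε) * (P : ℝ) ^ 2 ^ (k - 1) *
        (1 / P + 1 / q + q / (P : ℝ) ^ k) := by
  obtain ⟨j, rfl⟩ := Nat.exists_eq_add_of_le' hk
  obtain ⟨C₁, hC₁, hdiv⟩ := exists_pow_card_divisors_le (j + 1) (j + 1) 1 ε hε
  set F : ℕ := (j + 2).factorial with hF
  have hF1 : (1 : ℝ) ≤ F := by exact_mod_cast Nat.factorial_pos _
  set c : ℝ := 7 + 1 / ε with hc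
  have hc0 : 0 < c := by positivity
  set A : ℝ := (j + 1) * 2 ^ (j + 1) + 2 * 2 ^ (j + 1) * C₁ * (2 * (2 * c * F)) with hA
  refine ⟨2 ^ 2 ^ (j + 1) * A, by positivity, fun P n q hP hn hq a hcop α hα => ?_⟩
  have hP1 : (1 : ℝ) ≤ P := by exact_mod_cast hP
  have hq1 : (1 : ℝ) ≤ q := by exact_mod_cast hq
  have hPε : 1 ≤ (P : ℝ) ^ ε := Real.one_le_rpow hP1 hε.le
  have hqε : 1 ≤ (q : ℝ) ^ ε := Real.one_le_rpow hq1 hε.le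
  obtain ⟨D, hD0, hD1, hD2⟩ := hdiv P hP
  set g : ℤ → ℝ := fun m => linBound P (α * m) with hg
  set E : ℝ := P ^ (j + 1) + P ^ (j + 2) / q + q with hE
  have hE0 : 0 < E := by positivity
  have hsum : ∑ m ∈ Finset.range (F * P ^ (j + 1) + 1), linBound P (α * m) ≤
      2 * c * F * (q : ℝ) ^ ε * E := by
    refine (sum_linBound_le P q hq a hcop α hα _).trans ?_
    have hlog : 6 * (P : ℝ) + q * (1 + Real.log q) ≤ c * (q : ℝ) ^ ε * (P + q) := by
      have h1 : Real.log q ≤ (q : ℝ) ^ ε / ε := Real.log_le_rpow_div (by positivity) hε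
      have h2 : 1 + Real.log q ≤ (1 + 1 / ε) * (q : ℝ) ^ ε := by
        rw [add_mul, one_mul, one_div, inv_mul_eq_div]; linarith
      have h3 : 0 ≤ 1 / ε := by positivity
      have h4 : (P : ℝ) ≤ (q : ℝ) ^ ε * P := le_mul_of_one_le_left (by positivity) hqε
      have h5 : (q : ℝ) * (1 + Real.log q) ≤ q * ((1 + 1 / ε) * (q : ℝ) ^ ε) := by gcongr
      have h6 : 0 ≤ 1 / ε * (q : ℝ) ^ ε * P := by positivity
      have h7 : 0 ≤ (q : ℝ) ^ ε * q := by positivity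
      have h8 : 0 ≤ (q : ℝ) ^ ε * P := by positivity
      rw [hc]
      nlinarith
    have hprod : (((F * P ^ (j + 1) : ℕ) : ℝ) / q + 1) * (P + q) ≤ 2 * F * E := by
      have h1 : (((F * P ^ (j + 1) : ℕ) : ℝ) / q + 1) * (P + q) =
          F * (P ^ (j + 2) / q) + F * P ^ (j + 1) + P + q := by
        push_cast; field_simp; ring
      have h2 : (P : ℝ) ≤ P ^ (j + 1) := le_self_pow₀ hP1 (by omega)
      have h3 : (P : ℝ) ^ (j + 1) ≤ F * P ^ (j + 1) := le_mul_of_one_le_left (by positivity) hF1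
      have h4 : (q : ℝ) ≤ F * q := le_mul_of_one_le_left (by positivity) hF1
      have h5 : (0 : ℝ) ≤ F * (P ^ (j + 2) / q) := by positivity
      rw [h1, hE]
      nlinarith
    calc _ ≤ (((F * P ^ (j + 1) : ℕ) : ℝ) / q + 1) * (c * (q : ℝ) ^ ε * (P + q)) := by gcongr
      _ = c * (q : ℝ) ^ ε * ((((F * P ^ (j + 1) : ℕ) : ℝ) / q + 1) * (P + q)) := by ring
      _ ≤ c * (q : ℝ) ^ ε * (2 * F * E) := by gcongr
      _ = _ := by ring
  have hB := prodSum_le P g (fun m => linBound_nonneg _ _) D hD0 (j + 1)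
    (fun m hm hmP => hD2 m hm (by simpa using hmP)) hP F
  have hT := sum_filter_ne_zero_le g (fun m => linBound_nonneg _ _)
    (fun u => by simp only [hg]; push_cast; rw [mul_neg, linBound_neg]) F (P ^ (j + 1))
    (Nat.factorial_pos _)
  push_cast at hT
  have hB' : prodSum P g (j + 1) F * (2 * P) ≤
      P * (A * ((P : ℝ) ^ ε * (q : ℝ) ^ ε) * E) := by
    have hg0 : g 0 ≤ P := linBound_le _ _
    have h1 : (P : ℝ) ^ (j + 1) ≤ (P : ℝ) ^ ε * (q : ℝ) ^ ε * E := by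
      have h2 : (P : ℝ) ^ (j + 1) ≤ E := by
        have : (0 : ℝ) ≤ P ^ (j + 2) / q := by positivity
        rw [hE]; linarith
      have h3 : 1 ≤ (P : ℝ) ^ ε * (q : ℝ) ^ ε := one_le_mul_of_one_le_of_one_le hPε hqε
      exact h2.trans (le_mul_of_one_le_left hE0.le h3)
    calc _ ≤ _ := hB
      _ ≤ ((j + 1 : ℕ) : ℝ) * (2 * P) ^ (j + 1) * P + 2 * P * (2 * D) ^ (j + 1) *
          (2 * (2 * c * F * (q : ℝ) ^ ε * E)) := by
          gcongr
          exact hT.trans (mul_le_mul_of_nonneg_left (by simpa [hg] using hsum) (by norm_num))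
      _ = (j + 1) * 2 ^ (j + 1) * P * P ^ (j + 1) + 2 * P * (2 ^ (j + 1) * D ^ (j + 1)) *
          (2 * (2 * c * F * (q : ℝ) ^ ε * E)) := by
          rw [mul_pow, mul_pow]; push_cast; ring
      _ ≤ (j + 1) * 2 ^ (j + 1) * P * ((P : ℝ) ^ ε * (q : ℝ) ^ ε * E) +
          2 * P * (2 ^ (j + 1) * (C₁ * (P : ℝ) ^ ε)) * (2 * (2 * c * F * (q : ℝ) ^ ε * E)) := by
          gcongr
      _ = _ := by rw [hA]; ring
  have hW := norm_weylSum_zero_pow_le P α j 1 n (by omega) ((X : ℤ[X]) ^ (j + 2))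
  rw [← powSum_eq_weylSum] at hW
  have hW2 := norm_weylSum_le_prodSum P α (j + 1) 1 n (by omega) ((X : ℤ[X]) ^ (j + 2))
    (natDegree_X_pow_le _)
  rw [coeff_X_pow_self, mul_one] at hW2
  have hW3 := (Complex.re_le_norm _).trans hW2
  have hEE : 1 / (P : ℝ) + 1 / q + q / (P : ℝ) ^ (j + 2) = E / (P : ℝ) ^ (j + 2) := by
    rw [hE]; field_simp; ring
  rw [show j + 2 - 1 = j + 1 by omega, hEE, ← mul_div_assoc, le_div_iff₀ (by positivity)]
  have hP0 : (0 : ℝ) < P := by linarith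
  refine le_of_mul_le_mul_right ?_ hP0
  calc ‖powSum (j + 2) n α‖ ^ 2 ^ (j + 1) * (P : ℝ) ^ (j + 2) * P
      ≤ ‖powSum (j + 2) n α‖ ^ 2 ^ (j + 1) * (2 * P : ℝ) ^ (j + 2) * (2 * P) := by
        gcongr <;> linarith
    _ ≤ (2 * P) ^ 2 ^ (j + 1) * prodSum P g (j + 1) F * (2 * P) := by
        refine mul_le_mul_of_nonneg_right (hW.trans ?_) (by positivity)
        gcongr
    _ = (2 * P) ^ 2 ^ (j + 1) * (prodSum P g (j + 1) F * (2 * P)) := by ring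
    _ ≤ (2 * P) ^ 2 ^ (j + 1) * (P * (A * ((P : ℝ) ^ ε * (q : ℝ) ^ ε) * E)) := by gcongr
    _ = _ := by rw [mul_pow]; ring

end Waring

namespace Waring

/-- The contribution of the denominator `q` to the singular series. -/
noncomputable def singTerm (k d N q : ℕ) : ℂ :=
  ∑ a ∈ (Finset.Icc 1 q).filter (fun a => Nat.Coprime a q),
    (warGauss k q a) ^ d * e (-((N : ℝ) * a / q))

lemma singularSeries_eq (k d N : ℕ) : singularSeries k d N = ∑' q, singTerm k d N q := rfl

lemma warGauss_eq (k q a : ℕ) : warGauss k q a = (q : ℂ)⁻¹ * powSum k q ((a : ℝ) / q) := by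
  rw [warGauss, powSum]
  congr 1
  exact Finset.sum_congr rfl fun r _ => by ring_nf

lemma norm_warGauss_le_one (k q a : ℕ) : ‖warGauss k q a‖ ≤ 1 := by
  rw [warGauss_eq, norm_mul, norm_inv, Complex.norm_natCast]
  have := norm_powSum_le k q ((a : ℝ) / q)
  calc _ ≤ (q : ℝ)⁻¹ * q := by gcongr
    _ ≤ 1 := inv_mul_le_one

lemma exists_sum_norm_warGauss_pow_le (k : ℕ) (hk : 2 ≤ k) :
    ∃ C : ℝ, 0 ≤ C ∧ ∀ d q : ℕ, 2 ^ (k + 1) ≤ d → 0 < q →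
      ∑ a ∈ (Finset.Icc 1 q).filter (fun a => Nat.Coprime a q), ‖warGauss k q a‖ ^ d ≤
        C * (q : ℝ) ^ (-(5 / 2) : ℝ) := by
  obtain ⟨C, hC, h⟩ := exists_norm_powSum_pow_le k hk (1 / 16) (by norm_num)
  refine ⟨(3 * C) ^ 4, by positivity, fun d q hd hq => ?_⟩
  have hq1 : (1 : ℝ) ≤ q := by exact_mod_cast hq
  have hq0 : (0 : ℝ) < q := by linarith
  have key : ∀ a ∈ (Finset.Icc 1 q).filter (fun a => Nat.Coprime a q),
      ‖warGauss k q a‖ ^ d ≤ (3 * C) ^ 4 * (q : ℝ) ^ (-(7 / 2) : ℝ) := by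
    intro a ha
    rw [Finset.mem_filter] at ha
    have h1 := h q q q hq le_rfl hq a (Nat.isCoprime_iff_coprime.mpr ha.2) ((a : ℝ) / q)
      (by simp)
    have h2 : ‖warGauss k q a‖ ^ 2 ^ (k - 1) ≤ 3 * C * (q : ℝ) ^ (-(7 / 8) : ℝ) := by
      rw [warGauss_eq, norm_mul, norm_inv, Complex.norm_natCast, mul_pow, inv_pow,
        inv_mul_le_iff₀ (by positivity)]
      refine h1.trans ?_
      have h3 : (q : ℝ) / (q : ℝ) ^ k ≤ 1 / q := by
        rw [div_le_div_iff₀ (by positivity) hq0, one_mul, ← sq]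
        exact pow_le_pow_right₀ hq1 hk
      have h4 : (q : ℝ) ^ (1 / 16 : ℝ) * (q : ℝ) ^ (1 / 16 : ℝ) * (1 / q) =
          (q : ℝ) ^ (-(7 / 8) : ℝ) := by
        rw [one_div (q : ℝ), ← Real.rpow_neg_one, ← Real.rpow_add hq0, ← Real.rpow_add hq0]
        norm_num
      calc _ ≤ C * ((q : ℝ) ^ (1 / 16 : ℝ) * (q : ℝ) ^ (1 / 16 : ℝ)) * (q : ℝ) ^ 2 ^ (k - 1) *
            (1 / q + 1 / q + 1 / q) := by gcongr
        _ = (q : ℝ) ^ 2 ^ (k - 1) * (3 * C *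
            ((q : ℝ) ^ (1 / 16 : ℝ) * (q : ℝ) ^ (1 / 16 : ℝ) * (1 / q))) := by ring
        _ = _ := by rw [h4]
    calc ‖warGauss k q a‖ ^ d ≤ ‖warGauss k q a‖ ^ 2 ^ (k + 1) :=
          pow_le_pow_of_le_one (norm_nonneg _) (norm_warGauss_le_one k q a) hd
      _ = (‖warGauss k q a‖ ^ 2 ^ (k - 1)) ^ 4 := by
          rw [← pow_mul, show k + 1 = k - 1 + 2 by omega, pow_add]
          norm_num
      _ ≤ (3 * C * (q : ℝ) ^ (-(7 / 8) : ℝ)) ^ 4 := by gcongr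
      _ = _ := by
          rw [mul_pow, ← Real.rpow_natCast ((q : ℝ) ^ (-(7 / 8) : ℝ)), ← Real.rpow_mul hq0.le]
          norm_num
  refine (Finset.sum_le_sum key).trans ?_
  rw [Finset.sum_const, nsmul_eq_mul]
  have hcard : ((((Finset.Icc 1 q).filter (fun a => Nat.Coprime a q)).card : ℕ) : ℝ) ≤ q := by
    have := Finset.card_filter_le (Finset.Icc 1 q) (fun a => Nat.Coprime a q)
    rw [Nat.card_Icc, Nat.add_sub_cancel] at this
    exact_mod_cast this
  calc _ ≤ (q : ℝ) * ((3 * C) ^ 4 * (q : ℝ) ^ (-(7 / 2) : ℝ)) := by gcongr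
    _ = (3 * C) ^ 4 * ((q : ℝ) ^ (1 : ℝ) * (q : ℝ) ^ (-(7 / 2) : ℝ)) := by
        rw [Real.rpow_one]; ring
    _ = _ := by rw [← Real.rpow_add hq0]; norm_num

lemma norm_singTerm_le_sum (k d N q : ℕ) : ‖singTerm k d N q‖ ≤
    ∑ a ∈ (Finset.Icc 1 q).filter (fun a => Nat.Coprime a q), ‖warGauss k q a‖ ^ d := by
  refine (norm_sum_le _ _).trans (Finset.sum_le_sum fun a _ => ?_)
  rw [norm_mul, norm_e, mul_one, norm_pow]

lemma exists_norm_singTerm_le (k : ℕ) (hk : 2 ≤ k) :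
    ∃ C : ℝ, 0 ≤ C ∧ ∀ d N q : ℕ, 2 ^ (k + 1) ≤ d →
      ‖singTerm k d N q‖ ≤ C * (q : ℝ) ^ (-(5 / 2) : ℝ) := by
  obtain ⟨C, hC, h⟩ := exists_sum_norm_warGauss_pow_le k hk
  refine ⟨C, hC, fun d N q hd => ?_⟩
  rcases Nat.eq_zero_or_pos q with rfl | hq
  · simp only [singTerm, zero_lt_one, Finset.Icc_eq_empty_of_lt, Finset.filter_empty,
      Finset.sum_empty, norm_zero]
    positivity
  · exact (norm_singTerm_le_sum k d N q).trans (h d q hd hq)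

lemma summable_singTerm (k : ℕ) (hk : 2 ≤ k) (d N : ℕ) (hd : 2 ^ (k + 1) ≤ d) :
    Summable (singTerm k d N) := by
  obtain ⟨C, hC, h⟩ := exists_norm_singTerm_le k hk
  refine Summable.of_norm_bounded ?_ (fun q => h d N q hd)
  exact (Real.summable_nat_rpow.mpr (by norm_num)).mul_left C

lemma exists_norm_singularSeries_sub_sum_le (k : ℕ) (hk : 2 ≤ k) :
    ∃ C : ℝ, 0 ≤ C ∧ ∀ d N Y : ℕ, 2 ^ (k + 1) ≤ d →
      ‖singularSeries k d N - ∑ q ∈ Finset.range (Y + 1), singTerm k d N q‖ ≤ C / (Y + 1) := by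
  obtain ⟨C, hC, h⟩ := exists_norm_singTerm_le k hk
  have hs : Summable fun q : ℕ => (q : ℝ) ^ (-(3 / 2) : ℝ) :=
    Real.summable_nat_rpow.mpr (by norm_num)
  set Z := ∑' q : ℕ, (q : ℝ) ^ (-(3 / 2) : ℝ) with hZ
  refine ⟨C * Z, mul_nonneg hC (tsum_nonneg fun q => by positivity), fun d N Y hd => ?_⟩
  have hsum := summable_singTerm k hk d N hd
  rw [singularSeries_eq, ← hsum.sum_add_tsum_nat_add (Y + 1), add_sub_cancel_left]
  have hs' := (summable_nat_add_iff (Y + 1)).mpr hs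
  have hb : ∀ q : ℕ, ‖singTerm k d N (q + (Y + 1))‖ ≤
      C / (Y + 1) * ((q + (Y + 1) : ℕ) : ℝ) ^ (-(3 / 2) : ℝ) := by
    intro q
    refine (h d N _ hd).trans ?_
    have h0 : (0 : ℝ) < ((q + (Y + 1) : ℕ) : ℝ) := by positivity
    have h1 : ((q + (Y + 1) : ℕ) : ℝ) ^ (-(5 / 2) : ℝ) =
        (((q + (Y + 1) : ℕ) : ℝ))⁻¹ * ((q + (Y + 1) : ℕ) : ℝ) ^ (-(3 / 2) : ℝ) := by
      rw [← Real.rpow_neg_one, ← Real.rpow_add h0]; norm_num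
    rw [h1, ← mul_assoc, div_eq_mul_inv C]
    gcongr
    push_cast
    linarith [(Nat.cast_nonneg q : (0 : ℝ) ≤ q)]
  refine (tsum_of_norm_bounded ((hs'.mul_left _).hasSum) hb).trans ?_
  rw [tsum_mul_left, mul_div_right_comm]
  gcongr
  rw [hZ, ← hs.sum_add_tsum_nat_add (Y + 1)]
  exact le_add_of_nonneg_left (Finset.sum_nonneg fun q _ => by positivity)

end Waring

namespace Waring

/-- The number of solutions of `x₁ ^ k + ⋯ + x_d ^ k = n` in the finite ring `R`. -/
def solCount (R : Type*) [CommRing R] [Fintype R] [DecidableEq R] (k : ℕ) : ℕ → R → ℕ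
  | 0, n => if n = 0 then 1 else 0
  | d + 1, n => ∑ y, solCount R k d (n - y ^ k)

lemma solCount_ringEquiv {R S : Type*} [CommRing R] [Fintype R] [DecidableEq R] [CommRing S]
    [Fintype S] [DecidableEq S] (φ : R ≃+* S) (k d : ℕ) (n : R) :
    solCount S k d (φ n) = solCount R k d n := by
  induction d generalizing n with
  | zero => simp [solCount]
  | succ d ih =>
    simp only [solCount]
    rw [← Equiv.sum_comp φ.toEquiv]
    refine Finset.sum_congr rfl fun y _ => ?_
    rw [← ih]
    simp

lemma solCount_prod {R S : Type*} [CommRing R] [Fintype R] [DecidableEq R] [CommRing S]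
    [Fintype S] [DecidableEq S] (k d : ℕ) (m : R) (n : S) :
    solCount (R × S) k d (m, n) = solCount R k d m * solCount S k d n := by
  induction d generalizing m n with
  | zero => simp only [solCount, Prod.mk_eq_zero]; split_ifs <;> simp_all
  | succ d ih =>
    simp only [solCount]
    rw [Fintype.sum_prod_type, Finset.sum_mul_sum]
    refine Finset.sum_congr rfl fun y _ => Finset.sum_congr rfl fun z _ => ?_
    rw [← ih]
    simp

lemma solCount_mul (k d : ℕ) {Q R : ℕ} [NeZero Q] [NeZero R] [NeZero (Q * R)]
    (h : Nat.Coprime Q R) (n : ℕ) :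
    solCount (ZMod (Q * R)) k d n = solCount (ZMod Q) k d n * solCount (ZMod R) k d n := by
  rw [← solCount_prod, ← solCount_ringEquiv (ZMod.chineseRemainder h)]
  congr 1
  rw [map_natCast]
  rfl

lemma sum_zmod_eq_sum_Icc {M : Type*} [AddCommMonoid M] (Q : ℕ) [NeZero Q] (f : ZMod Q → M) :
    ∑ z, f z = ∑ r ∈ Finset.Icc 1 Q, f r := by
  symm
  refine Finset.sum_nbij (fun r : ℕ => (r : ZMod Q)) (by simp) ?_ ?_ (by simp)
  · intro r hr s hs h
    simp only [Finset.coe_Icc, Set.mem_Icc] at hr hs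
    have h1 : (Q : ℤ) ∣ (s : ℤ) - r :=
      Int.ModEq.dvd ((ZMod.intCast_eq_intCast_iff _ _ _).mp (by exact_mod_cast h))
    have := Int.eq_zero_of_abs_lt_dvd h1 (by rw [abs_lt]; omega)
    omega
  · intro z _
    have hQ := NeZero.pos Q
    have hz := ZMod.val_lt z
    by_cases h0 : z.val = 0
    · refine ⟨Q, by simp; omega, ?_⟩
      simp [(ZMod.val_eq_zero z).mp h0]
    · exact ⟨z.val, by simp; omega, by simp⟩

lemma stdAddChar_natCast (Q : ℕ) [NeZero Q] (r : ℕ) :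
    ZMod.stdAddChar (r : ZMod Q) = e ((r : ℝ) / Q) := by
  have := ZMod.stdAddChar_coe (N := Q) (r : ℤ)
  rw [Int.cast_natCast] at this
  rw [this, e]
  congr 1
  push_cast
  ring

lemma solCount_mul_eq_sum_stdAddChar (k d Q : ℕ) [NeZero Q] (n : ZMod Q) :
    (solCount (ZMod Q) k d n : ℂ) * Q =
      ∑ b : ZMod Q, (∑ y : ZMod Q, ZMod.stdAddChar (b * y ^ k)) ^ d *
        ZMod.stdAddChar (-(b * n)) := by
  induction d generalizing n with
  | zero =>
    have h := AddChar.sum_mulShift (R := ZMod Q) (R' := ℂ) (-n)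
      (ZMod.isPrimitive_stdAddChar Q)
    simp only [solCount, pow_zero, one_mul]
    simp only [mul_neg] at h
    rw [h]
    split_ifs <;> simp_all
  | succ d ih =>
    simp only [solCount]
    push_cast
    rw [Finset.sum_mul]
    simp_rw [ih]
    rw [Finset.sum_comm]
    refine Finset.sum_congr rfl fun b _ => ?_
    rw [← Finset.mul_sum, pow_succ, mul_assoc]
    congr 1
    rw [Finset.sum_mul]
    refine Finset.sum_congr rfl fun y _ => ?_
    rw [← AddChar.map_add_eq_mul]
    ring_nf

/-- The density of solutions of `x₁ ^ k + ⋯ + x_d ^ k ≡ N` modulo `Q`. -/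
noncomputable def localDensity (k d N Q : ℕ) [NeZero Q] : ℝ :=
  (solCount (ZMod Q) k d N : ℝ) * Q / (Q : ℝ) ^ d

lemma localDensity_eq_sum_Icc (k d N Q : ℕ) [NeZero Q] :
    (localDensity k d N Q : ℂ) =
      ∑ b ∈ Finset.Icc 1 Q, warGauss k Q b ^ d * e (-((N : ℝ) * b / Q)) := by
  rw [localDensity]
  push_cast
  rw [solCount_mul_eq_sum_stdAddChar, sum_zmod_eq_sum_Icc, Finset.sum_div]
  refine Finset.sum_congr rfl fun b _ => ?_
  rw [warGauss, mul_pow, sum_zmod_eq_sum_Icc, inv_pow]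
  have h1 : ∀ r : ℕ, ZMod.stdAddChar ((b : ZMod Q) * (r : ZMod Q) ^ k) =
      e ((b : ℝ) * (r : ℝ) ^ k / Q) := by
    intro r
    have := stdAddChar_natCast Q (b * r ^ k)
    push_cast at this
    exact this
  have h2 : ZMod.stdAddChar (-((b : ZMod Q) * (N : ZMod Q))) = e (-((N : ℝ) * b / Q)) := by
    have := stdAddChar_natCast Q (b * N)
    push_cast at this
    rw [e_neg, AddChar.map_neg_eq_conj, this, mul_comm (b : ℝ)]
  simp_rw [h1, h2]
  rw [div_eq_mul_inv]
  ring

lemma sum_range_mul_of_periodic {M : Type*} [AddCommMonoid M] (F : ℕ → M) (q : ℕ)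
    (hF : ∀ r, F (r + q) = F r) (g : ℕ) :
    ∑ r ∈ Finset.range (g * q), F r = g • ∑ r ∈ Finset.range q, F r := by
  have hF' : ∀ g r, F (g * q + r) = F r := by
    intro g r
    induction g with
    | zero => simp
    | succ g ih => rw [← ih, ← hF (g * q + r)]; congr 1; ring
  induction g with
  | zero => simp
  | succ g ih =>
    rw [Nat.succ_mul, Finset.sum_range_add, ih, succ_nsmul]
    simp_rw [hF']

lemma sum_Icc_eq_sum_range {M : Type*} [AddCommMonoid M] (F : ℕ → M) (n : ℕ) :
    ∑ r ∈ Finset.Icc 1 n, F r = ∑ r ∈ Finset.range n, F (r + 1) := by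
  rw [← Finset.Ico_succ_right_eq_Icc, Finset.sum_Ico_eq_sum_range]
  simp [add_comm]

lemma e_mul_pow_div_periodic (a k q r : ℕ) :
    e ((a : ℝ) * ((r + q : ℕ) : ℝ) ^ k / q) = e ((a : ℝ) * (r : ℝ) ^ k / q) := by
  rcases Nat.eq_zero_or_pos q with rfl | hq
  · simp
  obtain ⟨c, hc⟩ : (q : ℤ) ∣ ((r + q : ℕ) : ℤ) ^ k - (r : ℤ) ^ k := by
    refine dvd_trans ?_ (sub_dvd_pow_sub_pow _ _ _)
    push_cast
    simp
  have hc' : ((r + q : ℕ) : ℝ) ^ k - (r : ℝ) ^ k = q * c := by exact_mod_cast hc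
  apply e_eq_of_sub_eq_int (n := a * c)
  have hq' : (q : ℝ) ≠ 0 := by positivity
  rw [← sub_div, ← mul_sub, hc']
  push_cast
  field_simp

lemma warGauss_mul_mul (k q a g : ℕ) (hg : 0 < g) :
    warGauss k (q * g) (a * g) = warGauss k q a := by
  have hg' : (g : ℝ) ≠ 0 := by positivity
  have hg'' : (g : ℂ) ≠ 0 := by exact_mod_cast hg.ne'
  rw [warGauss, warGauss]
  have h1 : ∀ r : ℕ, e (((a * g : ℕ) : ℝ) * (r : ℝ) ^ k / ((q * g : ℕ) : ℝ)) =
      e ((a : ℝ) * (r : ℝ) ^ k / q) := by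
    intro r
    congr 1
    push_cast
    rw [mul_right_comm, mul_div_mul_right _ _ hg']
  simp_rw [h1]
  rw [sum_Icc_eq_sum_range, mul_comm q g,
    sum_range_mul_of_periodic (fun r => e ((a : ℝ) * ((r + 1 : ℕ) : ℝ) ^ k / q)) q
      (fun r => by rw [add_right_comm]; exact e_mul_pow_div_periodic a k q (r + 1)) g,
    sum_Icc_eq_sum_range, nsmul_eq_mul]
  push_cast
  rw [mul_inv, mul_mul_mul_comm, mul_comm (g : ℂ)⁻¹]
  field_simp

lemma localDensity_eq_sum_singTerm (k d N Q : ℕ) [NeZero Q] :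
    (localDensity k d N Q : ℂ) = ∑ q ∈ Q.divisors, singTerm k d N q := by
  have hQ := NeZero.pos Q
  rw [localDensity_eq_sum_Icc]
  simp only [singTerm]
  rw [Finset.sum_sigma']
  symm
  refine Finset.sum_nbij' (fun x : (_ : ℕ) × ℕ => x.2 * (Q / x.1))
    (fun b => ⟨Q / Nat.gcd b Q, b / Nat.gcd b Q⟩) ?_ ?_ ?_ ?_ ?_
  · rintro ⟨q, a⟩ h
    simp only [Finset.mem_sigma, Nat.mem_divisors, Finset.mem_filter, Finset.mem_Icc] at h ⊢
    obtain ⟨⟨⟨g, rfl⟩, -⟩, ⟨h1, h2⟩, -⟩ := h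
    have hq : 0 < q := Nat.pos_of_mul_pos_right hQ
    have hg : 0 < g := Nat.pos_of_mul_pos_left hQ
    rw [Nat.mul_div_cancel_left _ hq]
    exact ⟨Nat.mul_pos h1 hg, Nat.mul_le_mul_right _ h2⟩
  · intro b hb
    simp only [Finset.mem_Icc, Finset.mem_sigma, Nat.mem_divisors, Finset.mem_filter] at hb ⊢
    have hg : 0 < Nat.gcd b Q := Nat.gcd_pos_of_pos_right _ hQ
    refine ⟨⟨Nat.div_dvd_of_dvd (Nat.gcd_dvd_right _ _), hQ.ne'⟩, ⟨?_, ?_⟩, ?_⟩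
    · exact Nat.div_pos (Nat.le_of_dvd hb.1 (Nat.gcd_dvd_left _ _)) hg
    · exact Nat.div_le_div_right hb.2
    · exact Nat.coprime_div_gcd_div_gcd hg
  · rintro ⟨q, a⟩ h
    simp only [Finset.mem_sigma, Nat.mem_divisors, Finset.mem_filter, Finset.mem_Icc] at h
    obtain ⟨⟨⟨g, rfl⟩, -⟩, ⟨h1, h2⟩, h3⟩ := h
    have hq : 0 < q := Nat.pos_of_mul_pos_right hQ
    have hg : 0 < g := Nat.pos_of_mul_pos_left hQ
    simp only [Nat.mul_div_cancel_left _ hq, Nat.gcd_mul_right, h3.gcd_eq_one, one_mul,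
      Nat.mul_div_cancel _ hg]
  · intro b hb
    simp only
    rw [Nat.div_div_self (Nat.gcd_dvd_right _ _) hQ.ne', Nat.div_mul_cancel (Nat.gcd_dvd_left _ _)]
  · rintro ⟨q, a⟩ h
    simp only [Finset.mem_sigma, Nat.mem_divisors, Finset.mem_filter, Finset.mem_Icc] at h
    obtain ⟨⟨⟨g, rfl⟩, -⟩, -, -⟩ := h
    have hq : 0 < q := Nat.pos_of_mul_pos_right hQ
    have hg : 0 < g := Nat.pos_of_mul_pos_left hQ
    have hg' : (g : ℝ) ≠ 0 := by positivity
    simp only [Nat.mul_div_cancel_left _ hq]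
    rw [warGauss_mul_mul k q a g hg]
    congr 3
    push_cast
    rw [← mul_assoc, mul_div_mul_right _ _ hg']

end Waring

namespace Waring

/-- The exponent beyond which `1 + p ^ a ℤ` has no torsion modulo powers of `p`. -/
def unitExp (p : ℕ) : ℕ := if p = 2 then 2 else 1

lemma one_le_unitExp (p : ℕ) : 1 ≤ unitExp p := by unfold unitExp; split_ifs <;> norm_num

lemma emultiplicity_pow_sub_pow_eq {p : ℕ} (hp : p.Prime) {x y : ℤ}
    (hxy : (p : ℤ) ^ unitExp p ∣ x - y) (hx : ¬(p : ℤ) ∣ x) (k : ℕ) :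
    emultiplicity (p : ℤ) (x ^ k - y ^ k) = emultiplicity (p : ℤ) (x - y) + emultiplicity p k := by
  by_cases h2 : p = 2
  · subst h2
    have h := Int.two_pow_sub_pow' k (by simpa [unitExp] using hxy) (by exact_mod_cast hx)
    have h3 : emultiplicity (2 : ℤ) (k : ℤ) = emultiplicity 2 k := by
      exact_mod_cast Int.natCast_emultiplicity 2 k
    rw [h3] at h
    exact_mod_cast h
  · have h1 : (p : ℤ) ∣ x - y := by simpa [unitExp, h2] using hxy
    exact Int.emultiplicity_pow_sub_pow hp (hp.odd_of_ne_two h2) h1 hx k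

/-- Integers congruent to `1` modulo a fixed power of `p` are `k`-th powers modulo all powers. -/
lemma exists_pow_sub_dvd {p : ℕ} (hp : p.Prime) {k : ℕ} (hk : 0 < k) {v : ℕ}
    (hv : unitExp p + padicValNat p k ≤ v) (m : ℤ)
    (hm : (p : ℤ) ^ (unitExp p + padicValNat p k) ∣ m - 1) :
    ∃ y : ℤ, (p : ℤ) ^ v ∣ y ^ k - m := by
  have := Fact.mk hp
  set a := unitExp p with ha
  set τ := padicValNat p k with hτ
  have hτ' : emultiplicity p k = (τ : ℕ∞) := (padicValNat_eq_emultiplicity hk.ne').symm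
  have hp0 : (p : ℤ) ≠ 0 := by exact_mod_cast hp.ne_zero
  have hndvd : ∀ t : ℤ, ¬(p : ℤ) ∣ 1 + p ^ a * t := by
    intro t h
    have h1 : (p : ℤ) ∣ p ^ a * t :=
      (dvd_pow_self _ (by have := one_le_unitExp p; omega)).mul_right _
    have h2 : (p : ℤ) ∣ 1 := (dvd_add_left h1).mp h
    exact hp.one_lt.ne' (by exact_mod_cast Int.eq_one_of_dvd_one (by positivity) h2)
  have hg : ∀ t : ℤ, ∃ g : ℤ, (1 + p ^ a * t) ^ k - 1 = p ^ (a + τ) * g := by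
    intro t
    have h1 : (p : ℤ) ^ a ∣ (1 + p ^ a * t) - 1 := ⟨t, by ring⟩
    have h2 := emultiplicity_pow_sub_pow_eq hp h1 (hndvd t) k
    rw [one_pow, hτ'] at h2
    have h3 : (p : ℤ) ^ (a + τ) ∣ (1 + p ^ a * t) ^ k - 1 := by
      rw [pow_dvd_iff_le_emultiplicity, h2]
      push_cast
      gcongr
      exact pow_dvd_iff_le_emultiplicity.mp h1
    exact h3
  choose g hg using hg
  set L := p ^ (v - (a + τ)) with hL
  have : NeZero L := ⟨(pow_pos hp.pos _).ne'⟩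
  have hpow : (p : ℤ) ^ v = p ^ (a + τ) * (L : ℕ) := by
    rw [hL]; push_cast; rw [← pow_add]; congr 1; omega
  have hinj : Function.Injective fun t : ZMod L => ((g (t.val : ℤ) : ℤ) : ZMod L) := by
    intro t t' h
    simp only at h
    rw [ZMod.intCast_eq_intCast_iff_dvd_sub] at h
    have h1 : (p : ℤ) ^ v ∣ (1 + p ^ a * (t'.val : ℤ)) ^ k - (1 + p ^ a * (t.val : ℤ)) ^ k := by
      have h2 : (1 + (p : ℤ) ^ a * (t'.val : ℤ)) ^ k - (1 + p ^ a * (t.val : ℤ)) ^ k =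
          p ^ (a + τ) * (g t'.val - g t.val) := by
        rw [mul_sub, ← hg, ← hg]; ring
      rw [h2, hpow]
      exact mul_dvd_mul_left _ h
    have h3 : (p : ℤ) ^ a ∣ (1 + p ^ a * (t'.val : ℤ)) - (1 + p ^ a * (t.val : ℤ)) :=
      ⟨t'.val - t.val, by ring⟩
    rw [pow_dvd_iff_le_emultiplicity, emultiplicity_pow_sub_pow_eq hp h3 (hndvd _) k, hτ'] at h1
    have h4 : ((v - τ : ℕ) : ℕ∞) ≤
        emultiplicity (p : ℤ) ((1 + p ^ a * (t'.val : ℤ)) - (1 + p ^ a * (t.val : ℤ))) := by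
      rw [ENat.natCast_sub]
      exact tsub_le_iff_right.mpr h1
    rw [← pow_dvd_iff_le_emultiplicity] at h4
    have h5 : (p : ℤ) ^ a * (L : ℕ) ∣ p ^ a * ((t'.val : ℤ) - t.val) := by
      have h6 : (p : ℤ) ^ a * (L : ℕ) = p ^ (v - τ) := by
        rw [hL]; push_cast; rw [← pow_add]; congr 1; omega
      have h9 : (p : ℤ) ^ a * ((t'.val : ℤ) - t.val) =
          (1 + p ^ a * (t'.val : ℤ)) - (1 + p ^ a * (t.val : ℤ)) := by ring
      rw [h6, h9]
      exact h4
    have h7 : (L : ℤ) ∣ (t'.val : ℤ) - t.val :=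
      (mul_dvd_mul_iff_left (pow_ne_zero _ hp0)).mp h5
    have h8 := Int.eq_zero_of_abs_lt_dvd h7 (by
      rw [abs_lt]
      have := ZMod.val_lt t
      have := ZMod.val_lt t'
      omega)
    exact ZMod.val_injective L (by omega)
  obtain ⟨s, hs⟩ := hm
  obtain ⟨t, ht⟩ := Finite.surjective_of_injective hinj (s : ZMod L)
  simp only at ht
  rw [ZMod.intCast_eq_intCast_iff_dvd_sub] at ht
  refine ⟨1 + p ^ a * (t.val : ℤ), ?_⟩
  have h1 : (1 + (p : ℤ) ^ a * (t.val : ℤ)) ^ k - m = -(p ^ (a + τ) * (s - g t.val)) := by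
    rw [mul_sub, ← hs, ← hg]; ring
  rw [h1, hpow, dvd_neg]
  exact mul_dvd_mul_left _ ht

/-- `m` is the `k`-th power of a unit plus `s` further `k`-th powers. -/
def UnitRep (R : Type*) [CommRing R] (k : ℕ) : ℕ → R → Prop
  | 0, m => ∃ x : Rˣ, (x : R) ^ k = m
  | s + 1, m => ∃ y : R, UnitRep R k s (m - y ^ k)

lemma UnitRep.succ {R : Type*} [CommRing R] {k : ℕ} (hk : 0 < k) {s : ℕ} {m : R}
    (h : UnitRep R k s m) : UnitRep R k (s + 1) m :=
  ⟨0, by simpa [zero_pow hk.ne'] using h⟩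

lemma UnitRep.mono {R : Type*} [CommRing R] {k : ℕ} (hk : 0 < k) {s t : ℕ} (hst : s ≤ t) {m : R}
    (h : UnitRep R k s m) : UnitRep R k t m := by
  induction t, hst using Nat.le_induction with
  | base => exact h
  | succ t _ ih => exact ih.succ hk

lemma UnitRep.map {R S : Type*} [CommRing R] [CommRing S] (f : R →+* S) {k s : ℕ} {m : R}
    (h : UnitRep R k s m) : UnitRep S k s (f m) := by
  induction s generalizing m with
  | zero =>
    obtain ⟨x, hx⟩ := h
    exact ⟨Units.map f x, by rw [← hx, map_pow]; rfl⟩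
  | succ s ih =>
    obtain ⟨y, hy⟩ := h
    exact ⟨f y, by simpa using ih hy⟩

lemma UnitRep.natCast_succ {R : Type*} [CommRing R] (k j : ℕ) :
    UnitRep R k j ((j + 1 : ℕ) : R) := by
  induction j with
  | zero => exact ⟨1, by simp⟩
  | succ j ih => exact ⟨1, by simpa using ih⟩

lemma UnitRep.solCount_pos {R : Type*} [CommRing R] [Fintype R] [DecidableEq R] {k s : ℕ} {m : R}
    (h : UnitRep R k s m) : 0 < solCount R k (s + 1) m := by
  induction s generalizing m with
  | zero =>
    obtain ⟨x, hx⟩ := h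
    rw [solCount]
    refine Finset.sum_pos' (fun _ _ => Nat.zero_le _) ⟨(x : R), Finset.mem_univ _, ?_⟩
    simp [solCount, hx]
  | succ s ih =>
    obtain ⟨y, hy⟩ := h
    rw [solCount]
    exact Finset.sum_pos' (fun _ _ => Nat.zero_le _) ⟨y, Finset.mem_univ _, ih hy⟩

lemma exists_pow_eq_of_castHom {p : ℕ} (hp : p.Prime) {k : ℕ} (hk : 0 < k) {v : ℕ}
    {γ : ℕ} (hγ : γ = unitExp p + padicValNat p k) (hv : γ ≤ v) (u : ZMod (p ^ v))
    (x : (ZMod (p ^ γ))ˣ)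
    (hx : (x : ZMod (p ^ γ)) ^ k = ZMod.castHom (pow_dvd_pow p hv) (ZMod (p ^ γ)) u) :
    ∃ y : ZMod (p ^ v), y ^ k = u := by
  have : NeZero (p ^ v) := ⟨(pow_pos hp.pos _).ne'⟩
  set π := ZMod.castHom (pow_dvd_pow p hv) (ZMod (p ^ γ)) with hπ
  obtain ⟨z, hz⟩ := ZMod.unitsMap_surjective (pow_dvd_pow p hv) x
  have hz' : π (z : ZMod (p ^ v)) = x := by rw [← hz]; rfl
  set w : ZMod (p ^ v) := u * ((z⁻¹ : (ZMod (p ^ v))ˣ) : ZMod (p ^ v)) ^ k with hw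
  have hzz : (z : ZMod (p ^ v)) ^ k * ((z⁻¹ : (ZMod (p ^ v))ˣ) : ZMod (p ^ v)) ^ k = 1 := by
    rw [← mul_pow, Units.mul_inv, one_pow]
  have hπw : π w = 1 := by
    rw [hw, map_mul, ← hx, ← hz', ← map_pow π, ← map_mul, hzz, map_one]
  have h1 : (((w.val : ℕ) : ℤ) : ZMod (p ^ γ)) = ((1 : ℤ) : ZMod (p ^ γ)) := by
    have : π ((w.val : ℕ) : ZMod (p ^ v)) = 1 := by rw [ZMod.natCast_zmod_val, hπw]
    rw [map_natCast] at this
    simpa using this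
  rw [eq_comm, ZMod.intCast_eq_intCast_iff_dvd_sub] at h1
  obtain ⟨y, hy⟩ := exists_pow_sub_dvd hp hk (hγ ▸ hv) (w.val : ℤ)
    (by rw [← hγ]; exact_mod_cast h1)
  have hyw : (y : ZMod (p ^ v)) ^ k = w := by
    have h2 := (ZMod.intCast_eq_intCast_iff_dvd_sub (w.val : ℤ) (y ^ k) (p ^ v)).mpr
      (by exact_mod_cast hy)
    push_cast at h2
    rw [ZMod.natCast_zmod_val] at h2
    exact h2.symm
  refine ⟨y * z, ?_⟩
  rw [mul_pow, hyw, hw, mul_assoc, mul_comm (_ ^ k), hzz, mul_one]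

lemma pow_le_card_castHom_fiber {p : ℕ} (hp : p.Prime) {γ v : ℕ} (hv : γ ≤ v) [NeZero (p ^ v)]
    (z : ZMod (p ^ γ)) :
    p ^ (v - γ) ≤ (Finset.univ.filter fun y : ZMod (p ^ v) =>
      ZMod.castHom (pow_dvd_pow p hv) (ZMod (p ^ γ)) y = z).card := by
  have : NeZero (p ^ γ) := ⟨(pow_pos hp.pos _).ne'⟩
  rw [← Finset.card_range (p ^ (v - γ))]
  apply Finset.card_le_card_of_injOn fun t : ℕ => ((z.val + p ^ γ * t : ℕ) : ZMod (p ^ v))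
  · intro t _
    simp only [Finset.coe_filter, Finset.mem_univ, true_and, Set.mem_ofPred_eq]
    rw [map_natCast]
    push_cast
    rw [ZMod.natCast_zmod_val, ← Nat.cast_pow, ZMod.natCast_self, zero_mul, add_zero]
  · have hz := ZMod.val_lt z
    have hlt : ∀ t ∈ Finset.range (p ^ (v - γ)), z.val + p ^ γ * t < p ^ v := by
      intro t ht
      rw [Finset.mem_range] at ht
      calc z.val + p ^ γ * t < p ^ γ * (t + 1) := by rw [mul_add, mul_one]; omega
        _ ≤ p ^ γ * p ^ (v - γ) := Nat.mul_le_mul_left _ ht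
        _ = p ^ v := by rw [← pow_add]; congr 1; omega
    intro t ht t' ht' h
    simp only at h
    rw [ZMod.natCast_eq_natCast_iff', Nat.mod_eq_of_lt (hlt t ht), Nat.mod_eq_of_lt (hlt t' ht')]
      at h
    exact Nat.eq_of_mul_eq_mul_left (pow_pos hp.pos γ) (by omega)

lemma UnitRep.pow_le_solCount {p : ℕ} (hp : p.Prime) {k : ℕ} (hk : 0 < k) {v : ℕ}
    (hv : unitExp p + padicValNat p k ≤ v) [NeZero (p ^ v)] {s : ℕ} {n : ZMod (p ^ v)}
    (h : UnitRep (ZMod (p ^ (unitExp p + padicValNat p k))) k s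
      (ZMod.castHom (pow_dvd_pow p hv) _ n)) :
    (p ^ (v - (unitExp p + padicValNat p k))) ^ s ≤ solCount (ZMod (p ^ v)) k (s + 1) n := by
  induction s generalizing n with
  | zero =>
    obtain ⟨x, hx⟩ := h
    obtain ⟨y, hy⟩ := exists_pow_eq_of_castHom hp hk rfl hv n x hx
    rw [pow_zero, solCount]
    refine Nat.succ_le_of_lt (Finset.sum_pos' (fun _ _ => Nat.zero_le _)
      ⟨y, Finset.mem_univ _, ?_⟩)
    simp [solCount, hy]
  | succ s ih =>
    obtain ⟨z, hz⟩ := h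
    rw [solCount, pow_succ']
    calc _ ≤ (Finset.univ.filter fun y : ZMod (p ^ v) => ZMod.castHom (pow_dvd_pow p hv)
          (ZMod (p ^ (unitExp p + padicValNat p k))) y = z).card •
            (p ^ (v - (unitExp p + padicValNat p k))) ^ s := by
          rw [smul_eq_mul]
          exact Nat.mul_le_mul_right _ (pow_le_card_castHom_fiber hp hv z)
      _ ≤ ∑ y ∈ Finset.univ.filter fun y : ZMod (p ^ v) => ZMod.castHom (pow_dvd_pow p hv)
          (ZMod (p ^ (unitExp p + padicValNat p k))) y = z,
            solCount (ZMod (p ^ v)) k (s + 1) (n - y ^ k) := by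
          apply Finset.card_nsmul_le_sum
          intro y hy
          rw [Finset.mem_filter] at hy
          apply ih
          rw [map_sub, map_pow, hy.2]
          exact hz
      _ ≤ _ := Finset.sum_le_sum_of_subset (Finset.subset_univ _)

end Waring

namespace Waring

lemma unitRep_of_card_le {n k s : ℕ} [NeZero n] (hk : 0 < k) (hn : n ≤ s + 1) (m : ZMod n) :
    UnitRep (ZMod n) k s m := by
  have h := UnitRep.natCast_succ (R := ZMod n) k (m - 1).val
  have h1 := ZMod.val_lt (m - 1)
  push_cast at h
  rw [ZMod.natCast_zmod_val, sub_add_cancel] at h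
  exact h.mono hk (by omega)

section CauchyDavenport

open scoped Pointwise

lemma pred_le_mul_card_image_pow {p : ℕ} [Fact p.Prime] {k : ℕ} (hk : 0 < k) :
    p ≤ k * ((Finset.univ.image fun x : ZMod p => x ^ k).card - 1) + 1 := by
  classical
  set A := Finset.univ.image fun x : ZMod p => x ^ k
  set B := ((Finset.univ : Finset (ZMod p)).erase 0).image fun x : ZMod p => x ^ k
  have h1 : ((Finset.univ : Finset (ZMod p)).erase 0).card ≤ k * B.card := by
    apply Finset.card_le_mul_card_image
    intro a _
    calc _ ≤ (Polynomial.nthRoots k a).toFinset.card := by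
          apply Finset.card_le_card
          intro x hx
          rw [Finset.mem_filter] at hx
          rw [Multiset.mem_toFinset, Polynomial.mem_nthRoots hk]
          exact hx.2
      _ ≤ Multiset.card (Polynomial.nthRoots k a) := Multiset.toFinset_card_le _
      _ ≤ k := Polynomial.card_nthRoots k a
  rw [Finset.card_erase_of_mem (Finset.mem_univ _), Finset.card_univ, ZMod.card] at h1
  have h2 : insert 0 B ⊆ A := by
    intro x hx
    rw [Finset.mem_insert] at hx
    rcases hx with rfl | hx
    · exact Finset.mem_image.mpr ⟨0, Finset.mem_univ _, zero_pow hk.ne'⟩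
    · obtain ⟨y, _, hy⟩ := Finset.mem_image.mp hx
      exact Finset.mem_image.mpr ⟨y, Finset.mem_univ _, hy⟩
  have h3 : (0 : ZMod p) ∉ B := by
    intro h
    obtain ⟨y, hy, hy0⟩ := Finset.mem_image.mp h
    exact (Finset.mem_erase.mp hy).1 (eq_zero_of_pow_eq_zero hy0)
  have h4 := Finset.card_le_card h2
  rw [Finset.card_insert_of_notMem h3] at h4
  have h5 : k * B.card ≤ k * (A.card - 1) := Nat.mul_le_mul_left _ (by omega)
  omega

/-- Modulo a prime, everything is `1` plus a sum of `k` powers with exponent `k`. -/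
lemma unitRep_zmod_prime {p : ℕ} [Fact p.Prime] {k : ℕ} (hk : 0 < k) (m : ZMod p) :
    UnitRep (ZMod p) k k m := by
  classical
  set A := Finset.univ.image fun x : ZMod p => x ^ k with hA
  have hmem : ∀ j : ℕ, ∀ x ∈ j • A, UnitRep (ZMod p) k j (1 + x) := by
    intro j
    induction j with
    | zero =>
      intro x hx
      rw [zero_nsmul, Finset.mem_zero] at hx
      exact ⟨1, by simp [hx]⟩
    | succ j ih =>
      intro x hx
      rw [succ_nsmul, Finset.mem_add] at hx
      obtain ⟨y, hy, z, hz, rfl⟩ := hx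
      obtain ⟨a, _, rfl⟩ := Finset.mem_image.mp hz
      refine ⟨a, ?_⟩
      have : 1 + (y + a ^ k) - a ^ k = 1 + y := by ring
      rw [this]
      exact ih y hy
  have hne : A.Nonempty := ⟨_, Finset.mem_image_of_mem _ (Finset.mem_univ 0)⟩
  have hcard : ∀ j : ℕ, min p (j * (A.card - 1) + 1) ≤ (j • A).card := by
    intro j
    induction j with
    | zero => simp
    | succ j ih =>
      have h := ZMod.cauchy_davenport (Fact.out : p.Prime) (s := j • A) (t := A)
        (Finset.Nonempty.nsmul hne) hne
      rw [succ_nsmul, add_mul, one_mul]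
      have := hne.card_pos
      omega
  have huniv : k • A = Finset.univ := by
    rw [← Finset.card_eq_iff_eq_univ, ZMod.card]
    have h1 := hcard k
    have h2 := pred_le_mul_card_image_pow (p := p) hk
    have h3 := Finset.card_le_univ (k • A)
    rw [ZMod.card] at h3
    rw [← hA] at h2
    omega
  have h := hmem k (m - 1) (huniv ▸ Finset.mem_univ _)
  rwa [add_sub_cancel] at h

end CauchyDavenport

lemma four_mul_le_two_pow {k : ℕ} (hk : 2 ≤ k) : 4 * k ≤ 2 ^ (k + 1) := by
  induction k, hk using Nat.le_induction with
  | base => norm_num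
  | succ k hk ih => rw [pow_succ]; omega

lemma mul_self_le_two_pow {k : ℕ} (hk : 2 ≤ k) : k * k ≤ 2 ^ (k + 1) := by
  induction k, hk using Nat.le_induction with
  | base => norm_num
  | succ k hk ih =>
    rcases Nat.lt_or_ge k 3 with h | h
    · interval_cases k
      norm_num
    · rw [pow_succ]; nlinarith

lemma unitRep_zmod_prime_pow {p : ℕ} (hp : p.Prime) {k : ℕ} (hk : 2 ≤ k)
    (m : ZMod (p ^ (unitExp p + padicValNat p k))) :
    UnitRep (ZMod (p ^ (unitExp p + padicValNat p k))) k (2 ^ (k + 1) - 1) m := by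
  have hk0 : 0 < k := by omega
  have := Fact.mk hp
  have : NeZero (p ^ (unitExp p + padicValNat p k)) := ⟨(pow_pos hp.pos _).ne'⟩
  have h4 := four_mul_le_two_pow hk
  have hτ : p ^ padicValNat p k ≤ k := Nat.le_of_dvd hk0 pow_padicValNat_dvd
  by_cases h2 : p = 2
  · apply unitRep_of_card_le hk0
    have h1 : p ^ (unitExp p + padicValNat p k) ≤ 4 * k := by
      rw [pow_add]
      have : p ^ unitExp p = 4 := by simp [unitExp, h2]
      rw [this]
      exact Nat.mul_le_mul_left _ hτ
    omega
  have hu : unitExp p = 1 := by simp [unitExp, h2]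
  by_cases hpk : p ∣ k
  · apply unitRep_of_card_le hk0
    have h1 : p ^ (unitExp p + padicValNat p k) ≤ k * k := by
      rw [pow_add, hu, pow_one]
      exact Nat.mul_le_mul (Nat.le_of_dvd hk0 hpk) hτ
    have := mul_self_le_two_pow hk
    omega
  · have hexp : unitExp p + padicValNat p k = 1 := by
      rw [hu, padicValNat.eq_zero_of_not_dvd hpk]
    have hdvd : p ^ (unitExp p + padicValNat p k) ∣ p := by rw [hexp, pow_one]
    have h := (unitRep_zmod_prime hk0 ((m.val : ℕ) : ZMod p)).map
      (ZMod.castHom hdvd (ZMod (p ^ (unitExp p + padicValNat p k))))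
    rw [map_natCast, ZMod.natCast_zmod_val] at h
    exact h.mono hk0 (by omega)

end Waring

namespace Waring

lemma pow_le_solCount_zmod_prime_pow {p : ℕ} (hp : p.Prime) {k : ℕ} (hk : 2 ≤ k) (v : ℕ)
    [NeZero (p ^ v)] (d : ℕ) (hd : 2 ^ (k + 1) ≤ d) (n : ZMod (p ^ v)) :
    (p ^ v) ^ d ≤ solCount (ZMod (p ^ v)) k d n * p ^ v *
      (p ^ (unitExp p + padicValNat p k)) ^ (2 ^ (k + 1) - 1) := by
  have hk0 : 0 < k := by omega
  obtain ⟨s, hs⟩ : ∃ s, 2 ^ (k + 1) = s + 1 :=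
    ⟨2 ^ (k + 1) - 1, by have := Nat.one_le_two_pow (n := k + 1); omega⟩
  have hunit := unitRep_zmod_prime_pow hp hk
  rw [hs, Nat.add_sub_cancel] at hunit ⊢
  rw [hs] at hd
  set γ := unitExp p + padicValNat p k with hγ
  induction d, hd using Nat.le_induction generalizing n with
  | base =>
    rcases le_or_gt γ v with hv | hv
    · have h := (hunit (ZMod.castHom (pow_dvd_pow p hv) _ n)).pow_le_solCount hp hk0 hv
      calc (p ^ v) ^ (s + 1) = (p ^ (v - γ)) ^ s * p ^ v * (p ^ γ) ^ s := by
            have h1 : p ^ v = p ^ (v - γ) * p ^ γ := by rw [← pow_add]; congr 1; omega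
            rw [pow_succ]
            nth_rewrite 1 [h1]
            rw [mul_pow]
            ring
        _ ≤ _ := by gcongr
    · have h := ((hunit (n.val : ℕ)).map
        (ZMod.castHom (pow_dvd_pow p hv.le) (ZMod (p ^ v)))).solCount_pos
      rw [map_natCast, ZMod.natCast_zmod_val] at h
      calc (p ^ v) ^ (s + 1) = 1 * p ^ v * (p ^ v) ^ s := by ring
        _ ≤ _ := by
          gcongr
          exacts [h, hp.one_lt.le]
  | succ d hd ih =>
    rw [solCount, Finset.sum_mul, Finset.sum_mul]
    calc (p ^ v) ^ (d + 1) = ∑ _y : ZMod (p ^ v), (p ^ v) ^ d := by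
          rw [Finset.sum_const, Finset.card_univ, ZMod.card, smul_eq_mul, pow_succ']
      _ ≤ _ := Finset.sum_le_sum fun y _ => ih _

/-- The sum of the singular series over the divisors of `Q`. -/
noncomputable def divSum (k d N Q : ℕ) : ℝ := (∑ q ∈ Q.divisors, singTerm k d N q).re

lemma divSum_eq (k d N Q : ℕ) [NeZero Q] : divSum k d N Q = localDensity k d N Q := by
  rw [divSum, ← localDensity_eq_sum_singTerm, Complex.ofReal_re]

lemma divSum_mul (k d N : ℕ) {Q R : ℕ} (h : Nat.Coprime Q R) :
    divSum k d N (Q * R) = divSum k d N Q * divSum k d N R := by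
  rcases Nat.eq_zero_or_pos Q with rfl | hQ
  · simp [divSum]
  rcases Nat.eq_zero_or_pos R with rfl | hR
  · simp [divSum]
  have : NeZero Q := ⟨hQ.ne'⟩
  have : NeZero R := ⟨hR.ne'⟩
  have : NeZero (Q * R) := ⟨(Nat.mul_pos hQ hR).ne'⟩
  rw [divSum_eq, divSum_eq, divSum_eq, localDensity, localDensity, localDensity,
    solCount_mul k d h]
  push_cast
  rw [mul_pow, div_mul_div_comm]
  ring

lemma singTerm_one (k d N : ℕ) : singTerm k d N 1 = 1 := by
  have h : (Finset.Icc 1 1).filter (fun a => Nat.Coprime a 1) = {1} := by ext; simp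
  rw [singTerm, h]
  simp only [Finset.sum_singleton, warGauss, Finset.Icc_self, Nat.cast_one, div_one, inv_one,
    one_mul, one_pow]
  have h1 : e (1 : ℝ) = 1 := by simpa using e_nat 1
  have h2 : e (-((N : ℝ) * 1)) = 1 := by
    rw [mul_one, e_neg, e_nat, map_one]
  rw [h1, h2]
  simp

lemma divSum_one (k d N : ℕ) : divSum k d N 1 = 1 := by simp [divSum, singTerm_one]

lemma exists_le_divSum_prime_pow (k : ℕ) (hk : 2 ≤ k) (p : ℕ) :
    ∃ c : ℝ, 0 < c ∧ c ≤ 1 ∧ (p.Prime → ∀ d N v : ℕ, 2 ^ (k + 1) ≤ d →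
      c ≤ divSum k d N (p ^ v)) := by
  by_cases hp : p.Prime
  · set M := (p ^ (unitExp p + padicValNat p k)) ^ (2 ^ (k + 1) - 1) with hM
    have hM1 : 1 ≤ M := Nat.one_le_pow _ _ (pow_pos hp.pos _)
    have hM1' : (1 : ℝ) ≤ M := by exact_mod_cast hM1
    refine ⟨(M : ℝ)⁻¹, by positivity, inv_le_one_of_one_le₀ hM1', fun _ d N v hd => ?_⟩
    have : NeZero (p ^ v) := ⟨(pow_pos hp.pos _).ne'⟩
    have h := pow_le_solCount_zmod_prime_pow hp hk v d hd (N : ZMod (p ^ v))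
    rw [← hM] at h
    have hpv : (0 : ℝ) < ((p ^ v : ℕ) : ℝ) := by exact_mod_cast pow_pos hp.pos _
    rw [divSum_eq, localDensity, inv_le_iff_one_le_mul₀ (by positivity), div_mul_eq_mul_div,
      le_div_iff₀ (by positivity), one_mul]
    exact_mod_cast h
  · exact ⟨1, one_pos, le_rfl, fun h => absurd h hp⟩

lemma exists_one_sub_le_divSum_prime_pow (k : ℕ) (hk : 2 ≤ k) :
    ∃ C : ℝ, 0 ≤ C ∧ ∀ p : ℕ, p.Prime → ∀ d N v : ℕ, 2 ^ (k + 1) ≤ d →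
      1 - C * (p : ℝ) ^ (-(5 / 2) : ℝ) ≤ divSum k d N (p ^ v) := by
  obtain ⟨C, hC, h⟩ := exists_norm_singTerm_le k hk
  refine ⟨2 * C, by positivity, fun p hp d N v hd => ?_⟩
  have hp2 : (2 : ℝ) ≤ p := by exact_mod_cast hp.two_le
  have hp0 : (0 : ℝ) ≤ p := by linarith
  set x := (p : ℝ) ^ (-(5 / 2) : ℝ) with hx
  have hx0 : 0 ≤ x := by positivity
  have hx2 : x ≤ 1 / 2 := by
    calc x ≤ (p : ℝ) ^ (-1 : ℝ) := Real.rpow_le_rpow_of_exponent_le (by linarith) (by norm_num)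
      _ = (p : ℝ)⁻¹ := Real.rpow_neg_one _
      _ ≤ _ := by rw [one_div]; exact inv_anti₀ two_pos hp2
  have hgeom : ∀ v : ℕ, ∑ i ∈ Finset.range v, x ^ (i + 1) ≤ 2 * x := by
    intro v
    have hs := (summable_geometric_of_lt_one hx0 (by linarith : x < 1)).sum_le_tsum
      (Finset.range v) (fun _ _ => by positivity)
    rw [tsum_geometric_of_lt_one hx0 (by linarith)] at hs
    have h3 : (1 - x)⁻¹ ≤ 2 := by
      rw [inv_le_comm₀ (by linarith) two_pos]
      linarith
    calc _ = x * ∑ i ∈ Finset.range v, x ^ i := by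
          rw [Finset.mul_sum]; exact Finset.sum_congr rfl fun i _ => pow_succ' x i
      _ ≤ x * 2 := by gcongr; linarith
      _ = _ := by ring
  have h1 : ‖∑ i ∈ Finset.range v, singTerm k d N (p ^ (i + 1))‖ ≤ C * (2 * x) := by
    calc _ ≤ ∑ i ∈ Finset.range v, C * x ^ (i + 1) := by
          refine norm_sum_le_of_le _ fun i _ => ?_
          refine (h d N (p ^ (i + 1)) hd).trans_eq ?_
          rw [hx, Nat.cast_pow, ← Real.rpow_natCast, ← Real.rpow_natCast, ← Real.rpow_mul hp0,
            ← Real.rpow_mul hp0, mul_comm (-(5 / 2) : ℝ)]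
      _ ≤ _ := by rw [← Finset.mul_sum]; gcongr; exact hgeom v
  rw [divSum, Nat.divisors_prime_pow hp, Finset.sum_map, Finset.sum_range_succ']
  simp only [Function.Embedding.coeFn_mk, pow_zero, singTerm_one, Complex.add_re, Complex.one_re]
  have h2 := (Complex.abs_re_le_norm _).trans h1
  rw [abs_le] at h2
  linarith [h2.1]

lemma one_sub_sum_le_prod {ι : Type*} (s : Finset ι) (x y : ι → ℝ) (hx : ∀ i ∈ s, 0 ≤ x i)
    (hy0 : ∀ i ∈ s, 0 ≤ y i) (hy : ∀ i ∈ s, 1 - x i ≤ y i) :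
    1 - ∑ i ∈ s, x i ≤ ∏ i ∈ s, y i := by
  classical
  induction s using Finset.induction_on with
  | empty => simp
  | insert a s ha ih =>
    rw [Finset.sum_insert ha, Finset.prod_insert ha]
    have h1 := ih (fun i hi => hx i (Finset.mem_insert_of_mem hi))
      (fun i hi => hy0 i (Finset.mem_insert_of_mem hi))
      (fun i hi => hy i (Finset.mem_insert_of_mem hi))
    have h2 := hx a (Finset.mem_insert_self _ _)
    have h3 := hy a (Finset.mem_insert_self _ _)
    have h4 := hy0 a (Finset.mem_insert_self _ _)
    have h5 : 0 ≤ ∑ i ∈ s, x i :=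
      Finset.sum_nonneg fun i hi => hx i (Finset.mem_insert_of_mem hi)
    have h6 : 0 ≤ ∏ i ∈ s, y i :=
      Finset.prod_nonneg fun i hi => hy0 i (Finset.mem_insert_of_mem hi)
    rcases le_or_gt (1 - ∑ i ∈ s, x i) 0 with h | h
    · nlinarith [mul_nonneg h4 h6]
    · calc 1 - (x a + ∑ i ∈ s, x i) ≤ (1 - x a) * (1 - ∑ i ∈ s, x i) := by nlinarith
        _ ≤ y a * (1 - ∑ i ∈ s, x i) := by gcongr
        _ ≤ _ := by gcongr

lemma exists_le_divSum (k : ℕ) (hk : 2 ≤ k) :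
    ∃ c : ℝ, 0 < c ∧ ∀ d N Q : ℕ, 2 ^ (k + 1) ≤ d → 0 < Q → c ≤ divSum k d N Q := by
  choose c hc0 hc1 hc using exists_le_divSum_prime_pow k hk
  obtain ⟨C, hC, hC'⟩ := exists_one_sub_le_divSum_prime_pow k hk
  have hsum : Summable fun p : ℕ => C * (p : ℝ) ^ (-(5 / 2) : ℝ) :=
    (Real.summable_nat_rpow.mpr (by norm_num)).mul_left C
  obtain ⟨S, hS⟩ := summable_iff_vanishing_norm.mp hsum (1 / 2) (by norm_num)
  refine ⟨(∏ p ∈ S, c p) * (1 / 2), mul_pos (Finset.prod_pos fun p _ => hc0 p) (by norm_num),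
    fun d N Q hd hQ => ?_⟩
  have hfac : divSum k d N Q = ∏ p ∈ Q.primeFactors, divSum k d N (p ^ Q.factorization p) := by
    have := Nat.multiplicative_factorization (divSum k d N) (fun x y h => divSum_mul k d N h)
      (divSum_one k d N) hQ.ne'
    rw [this, Finsupp.prod]
    rfl
  have hprime : ∀ p ∈ Q.primeFactors, p.Prime := fun p hp => Nat.prime_of_mem_primeFactors hp
  have hpos : ∀ p ∈ Q.primeFactors, 0 ≤ divSum k d N (p ^ Q.factorization p) := fun p hp =>
    (hc0 p).le.trans (hc p (hprime p hp) d N _ hd)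
  rw [hfac, ← Finset.prod_inter_mul_prod_sdiff Q.primeFactors S]
  have h1 : ∏ p ∈ S, c p ≤
      ∏ p ∈ Q.primeFactors ∩ S, divSum k d N (p ^ Q.factorization p) := by
    calc _ ≤ ∏ p ∈ Q.primeFactors ∩ S, c p :=
          Finset.prod_le_prod_of_subset_of_le_one Finset.inter_subset_right
            (fun p _ => (hc0 p).le) (fun p _ _ => hc1 p)
      _ ≤ _ := Finset.prod_le_prod (fun p _ => (hc0 p).le) fun p hp =>
          hc p (hprime p (Finset.mem_inter.mp hp).1) d N _ hd
  have h2 : (1 / 2 : ℝ) ≤ ∏ p ∈ Q.primeFactors \ S, divSum k d N (p ^ Q.factorization p) := by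
    have h3 := one_sub_sum_le_prod (Q.primeFactors \ S) (fun p => C * (p : ℝ) ^ (-(5 / 2) : ℝ))
      (fun p => divSum k d N (p ^ Q.factorization p)) (fun p _ => by positivity)
      (fun p hp => hpos p (Finset.sdiff_subset hp))
      (fun p hp => hC' p (hprime p (Finset.sdiff_subset hp)) d N _ hd)
    have h4 := hS (Q.primeFactors \ S) Finset.sdiff_disjoint
    rw [Real.norm_eq_abs, abs_lt] at h4
    linarith [h4.2]
  have h5 : 0 ≤ ∏ p ∈ S, c p := Finset.prod_nonneg fun p _ => (hc0 p).le
  exact mul_le_mul h1 h2 (by norm_num) (h5.trans h1)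

/-- The singular series is bounded away from `0`, uniformly in the number of variables. -/
lemma exists_le_norm_singularSeries (k : ℕ) (hk : 2 ≤ k) :
    ∃ c : ℝ, 0 < c ∧ ∀ d N : ℕ, 2 ^ (k + 1) ≤ d → c ≤ ‖singularSeries k d N‖ := by
  obtain ⟨c, hc, h⟩ := exists_le_divSum k hk
  refine ⟨c, hc, fun d N hd => ?_⟩
  have hs := (summable_singTerm k hk d N hd).hasSum
  rw [← singularSeries_eq] at hs
  have ht : Filter.Tendsto (fun n : ℕ => insert 0 (n.factorial).divisors) Filter.atTop
      Filter.atTop := by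
    apply Filter.tendsto_atTop_finset_of_monotone
    · intro m n hmn
      exact Finset.insert_subset_insert _
        (Nat.divisors_subset_of_dvd (Nat.factorial_ne_zero n) (Nat.factorial_dvd_factorial hmn))
    · intro q
      refine ⟨q, ?_⟩
      rcases Nat.eq_zero_or_pos q with rfl | hq
      · exact Finset.mem_insert_self _ _
      · exact Finset.mem_insert_of_mem (Nat.mem_divisors.mpr
          ⟨Nat.dvd_factorial hq le_rfl, Nat.factorial_ne_zero q⟩)
  have h0 : singTerm k d N 0 = 0 := by simp [singTerm]
  have hlim : Filter.Tendsto (fun n : ℕ => divSum k d N n.factorial) Filter.atTop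
      (nhds (singularSeries k d N).re) := by
    refine ((Complex.continuous_re.tendsto _).comp (Filter.Tendsto.comp hs ht)).congr fun n => ?_
    simp only [Function.comp_apply]
    rw [Finset.sum_insert_zero h0, divSum]
  have h1 : c ≤ (singularSeries k d N).re :=
    ge_of_tendsto' hlim fun n => h d N _ hd (Nat.factorial_pos n)
  exact h1.trans (Complex.re_le_norm _)

end Waring

namespace Waring

open MeasureTheory

/-- The smooth weight `exp (-t ^ k / N)`. -/
noncomputable def wt (k N : ℕ) (t : ℝ) : ℝ := Real.exp (-(t ^ k / N))

lemma wt_pos (k N : ℕ) (t : ℝ) : 0 < wt k N t := Real.exp_pos _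

lemma wt_zero {k : ℕ} (hk : 0 < k) (N : ℕ) : wt k N 0 = 1 := by simp [wt, zero_pow hk.ne']

lemma wt_anti (k N : ℕ) {s t : ℝ} (hs : 0 ≤ s) (hst : s ≤ t) : wt k N t ≤ wt k N s := by
  unfold wt
  gcongr

/-- The weighted exponential sum over `k`-th powers. -/
noncomputable def wSum (k N P : ℕ) (α : ℝ) : ℂ :=
  ∑ n ∈ Finset.Icc 1 P, (wt k N n : ℂ) * e (α * (n : ℝ) ^ k)

@[fun_prop]
lemma continuous_wSum (k N P : ℕ) : Continuous (wSum k N P) := by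
  unfold wSum
  fun_prop

lemma wSum_pow_eq (k N P d : ℕ) (α : ℝ) :
    wSum k N P α ^ d = ∑ x ∈ Fintype.piFinset fun _ : Fin d => Finset.Icc 1 P,
      (Real.exp (-((∑ i, x i ^ k : ℕ) / N : ℝ)) : ℂ) * e (α * (∑ i, x i ^ k : ℕ)) := by
  rw [wSum, ← Fin.prod_const, Finset.prod_univ_sum]
  refine Finset.sum_congr rfl fun x _ => ?_
  rw [Finset.prod_mul_distrib]
  congr 1
  · rw [← Complex.ofReal_prod]
    congr 1
    simp only [wt]
    rw [← Real.exp_sum, Finset.sum_neg_distrib, ← Finset.sum_div]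
    push_cast
    rfl
  · rw [← e_sum, ← Finset.mul_sum]
    push_cast
    rfl

lemma rep_eq_card (k d N P : ℕ) (hk : 0 < k) (hP : N ≤ P ^ k) :
    rep k d N = ((Fintype.piFinset fun _ : Fin d => Finset.Icc 1 P).filter
      fun x => ∑ i, x i ^ k = N).card := by
  rw [rep, ← Nat.card_eq_finsetCard]
  refine Nat.card_congr (Equiv.subtypeEquivRight fun x => ?_)
  simp only [Finset.mem_filter, Fintype.mem_piFinset, Finset.mem_Icc]
  refine ⟨fun h => ⟨fun i => ⟨h.1 i, ?_⟩, h.2⟩, fun h => ⟨fun i => (h.1 i).1, h.2⟩⟩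
  have h1 : x i ^ k ≤ N :=
    h.2 ▸ Finset.single_le_sum (f := fun i => x i ^ k) (fun _ _ => Nat.zero_le _)
      (Finset.mem_univ i)
  exact (Nat.pow_le_pow_iff_left hk.ne').mp (h1.trans hP)

lemma integral_wSum_pow (k d N P : ℕ) (hk : 0 < k) (hN : 0 < N) (hP : N ≤ P ^ k) (t : ℝ) :
    ∫ α in t..(t + 1), wSum k N P α ^ d * e (-(N * α)) =
      ((Real.exp (-1) : ℝ) : ℂ) * rep k d N := by
  have h1 : ∀ α : ℝ, wSum k N P α ^ d * e (-(N * α)) =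
      ∑ x ∈ Fintype.piFinset fun _ : Fin d => Finset.Icc 1 P,
      (Real.exp (-((∑ i, x i ^ k : ℕ) / N : ℝ)) : ℂ) *
        e (α * (((∑ i, x i ^ k : ℕ) : ℤ) - (N : ℤ) : ℤ)) := by
    intro α
    rw [wSum_pow_eq, Finset.sum_mul]
    refine Finset.sum_congr rfl fun x _ => ?_
    rw [mul_assoc, ← e_add]
    congr 2
    push_cast
    ring
  simp_rw [h1]
  rw [intervalIntegral.integral_finsetSum]
  · simp_rw [intervalIntegral.integral_const_mul, integral_e_int_mul]
    rw [rep_eq_card k d N P hk hP, Finset.card_filter, Nat.cast_sum, Finset.mul_sum]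
    refine Finset.sum_congr rfl fun x _ => ?_
    by_cases h : ∑ i, x i ^ k = N
    · have hN' : (N : ℝ) ≠ 0 := by exact_mod_cast hN.ne'
      simp [h, hN']
    · have h2 : ((∑ i, x i ^ k : ℕ) : ℤ) - (N : ℤ) ≠ 0 := by
        rw [sub_ne_zero]; exact_mod_cast h
      rw [if_neg h2, if_neg h]
      simp
  · intro x _
    apply Continuous.intervalIntegrable
    fun_prop

lemma sum_wt_le (k N P : ℕ) (hk : 0 < k) (hN : 0 < N) :
    ∑ n ∈ Finset.Icc 1 P, wt k N n ≤ Real.Gamma (1 + 1 / k) * (N : ℝ) ^ (1 / k : ℝ) := by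
  have hk' : (0 : ℝ) < k := by exact_mod_cast hk
  have hN' : (0 : ℝ) < N := by exact_mod_cast hN
  have h1 := integral_exp_neg_mul_rpow (p := k) (b := (N : ℝ)⁻¹) hk' (by positivity)
  have h2 := integrableOn_rpow_mul_exp_neg_mul_rpow (s := 0) (p := k) (b := (N : ℝ)⁻¹)
    (by norm_num) hk' (by positivity)
  have hw : ∀ t ∈ Set.Ioi (0 : ℝ), wt k N t = Real.exp (-(N : ℝ)⁻¹ * t ^ (k : ℝ)) := by
    intro t _
    rw [wt, Real.rpow_natCast, neg_mul, div_eq_inv_mul]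
  have hint : IntegrableOn (wt k N) (Set.Ioi 0) := by
    refine h2.congr_fun (fun t ht => ?_) measurableSet_Ioi
    simp only [Real.rpow_zero, one_mul]
    exact (hw t ht).symm
  have h3 : ∫ t in Set.Ioi 0, wt k N t = Real.Gamma (1 + 1 / k) * (N : ℝ) ^ (1 / k : ℝ) := by
    rw [setIntegral_congr_fun measurableSet_Ioi hw, h1, Real.inv_rpow hN'.le, neg_div,
      Real.rpow_neg hN'.le, inv_inv, mul_comm, add_comm]
  rw [← h3, sum_Icc_eq_sum_range]
  have h4 := AntitoneOn.sum_le_integral (x₀ := 0) (a := P) (f := wt k N)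
    (fun s hs t ht hst => wt_anti k N hs.1 hst)
  simp only [zero_add] at h4
  refine h4.trans ?_
  rw [intervalIntegral.integral_of_le (by positivity)]
  exact setIntegral_mono_set hint (ae_of_all _ fun t => (wt_pos k N t).le)
    Set.Ioc_subset_Ioi_self.eventuallyLE

lemma norm_wSum_le (k N P : ℕ) (hk : 0 < k) (hN : 0 < N) (α : ℝ) :
    ‖wSum k N P α‖ ≤ Real.Gamma (1 + 1 / k) * (N : ℝ) ^ (1 / k : ℝ) := by
  refine le_trans (norm_sum_le_of_le _ fun n _ => ?_) (sum_wt_le k N P hk hN)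
  rw [norm_mul, norm_e, mul_one, Complex.norm_real, Real.norm_of_nonneg (wt_pos k N n).le]

/-- Summation by parts in the form used for weighted exponential sums. -/
lemma sum_Icc_mul_eq_sub (f φ : ℕ → ℂ) (P : ℕ) :
    ∑ n ∈ Finset.Icc 1 P, φ n * f n =
      ∑ n ∈ Finset.range P, (φ n - φ (n + 1)) * ∑ m ∈ Finset.Icc 1 n, f m +
        φ P * ∑ m ∈ Finset.Icc 1 P, f m := by
  induction P with
  | zero => simp
  | succ P ih =>
    rw [Finset.sum_Icc_succ_top (by omega), ih, Finset.sum_range_succ,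
      Finset.sum_Icc_succ_top (by omega)]
    ring

/-- The weighted sum is a convex combination of unweighted sums. -/
lemma exists_wSum_eq_sum_powSum (k N P : ℕ) (hk : 0 < k) :
    ∃ μ : ℕ → ℝ, (∀ n, 0 ≤ μ n) ∧ ∑ n ∈ Finset.range (P + 1), μ n = 1 ∧
      ∀ α, wSum k N P α = ∑ n ∈ Finset.range (P + 1), (μ n : ℂ) * powSum k n α := by
  refine ⟨fun n => if n = P then wt k N P else max 0 (wt k N n - wt k N (n + 1)), ?_, ?_, ?_⟩
  · intro n
    dsimp only
    split_ifs
    exacts [(wt_pos _ _ _).le, le_max_left _ _]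
  all_goals
    have hμ : ∀ n ∈ Finset.range P, (if n = P then wt k N P else
        max 0 (wt k N n - wt k N (n + 1))) = wt k N n - wt k N ((n + 1 : ℕ) : ℝ) := by
      intro n hn
      rw [if_neg (Finset.mem_range.mp hn).ne, max_eq_right, Nat.cast_add_one]
      rw [sub_nonneg]
      exact wt_anti k N (by positivity) (by linarith)
  · rw [Finset.sum_range_succ, Finset.sum_congr rfl hμ, Finset.sum_range_sub', if_pos rfl]
    simp [wt_zero hk]
  · intro α
    rw [Finset.sum_range_succ, wSum, sum_Icc_mul_eq_sub _ (fun n : ℕ => (wt k N n : ℂ))]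
    dsimp only
    rw [if_pos rfl]
    congr 1
    refine Finset.sum_congr rfl fun n hn => ?_
    rw [hμ n hn]
    push_cast
    rfl

end Waring

namespace Waring

open MeasureTheory

/-- A pointwise power mean bound for the weighted sum. -/
lemma exists_norm_wSum_pow_le (k N P : ℕ) (hk : 0 < k) :
    ∃ μ : ℕ → ℝ, (∀ n, 0 ≤ μ n) ∧ ∑ n ∈ Finset.range (P + 1), μ n = 1 ∧
      ∀ (m : ℕ) (α : ℝ), ‖wSum k N P α‖ ^ m ≤
        ∑ n ∈ Finset.range (P + 1), μ n * ‖powSum k n α‖ ^ m := by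
  obtain ⟨μ, h0, h1, h⟩ := exists_wSum_eq_sum_powSum k N P hk
  refine ⟨μ, h0, h1, fun m α => ?_⟩
  refine le_trans ?_ (Real.pow_arith_mean_le_arith_mean_pow _ μ (fun n => ‖powSum k n α‖)
    (fun n _ => h0 n) h1 (fun n _ => norm_nonneg _) m)
  gcongr
  rw [h]
  refine norm_sum_le_of_le _ fun n _ => ?_
  rw [norm_mul, Complex.norm_real, Real.norm_of_nonneg (h0 n)]

lemma exists_integral_norm_wSum_pow_le (k : ℕ) (hk : 2 ≤ k) (ε : ℝ) (hε : 0 < ε) :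
    ∃ C : ℝ, 0 ≤ C ∧ ∀ N P : ℕ, 0 < P → ∀ t : ℝ,
      ∫ α in t..(t + 1), ‖wSum k N P α‖ ^ 2 ^ k ≤ C * (P : ℝ) ^ (2 ^ k - k) * (P : ℝ) ^ ε := by
  obtain ⟨j, rfl⟩ : ∃ j, k = j + 1 := ⟨k - 1, by omega⟩
  obtain ⟨C, hC, h⟩ := exists_integral_norm_powSum_pow_le (j + 1) j le_rfl ε hε
  refine ⟨C, hC, fun N P hP t => ?_⟩
  obtain ⟨μ, h0, h1, hμ⟩ := exists_norm_wSum_pow_le (j + 1) N P (by omega)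
  have hlt : j + 1 < 2 ^ (j + 1) := Nat.lt_two_pow_self
  have hn : ∀ n ∈ Finset.range (P + 1), ∫ α in t..(t + 1), ‖powSum (j + 1) n α‖ ^ 2 ^ (j + 1) ≤
      C * (P : ℝ) ^ (2 ^ (j + 1) - (j + 1)) * (P : ℝ) ^ ε := by
    intro n hn
    rw [Finset.mem_range] at hn
    rcases Nat.eq_zero_or_pos n with rfl | hn0
    · simp [powSum]
      positivity
    · have hn0' : (0 : ℝ) < n := by exact_mod_cast hn0
      have hnP : (n : ℝ) ≤ P := by exact_mod_cast (by omega : n ≤ P)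
      have h2 := h n hn0 t
      have h3 : (n : ℝ) ^ 2 ^ (j + 1) = (n : ℝ) ^ (2 ^ (j + 1) - (j + 1)) * (n : ℝ) ^ (j + 1) := by
        rw [← pow_add]; congr 1; omega
      rw [h3] at h2
      have h4 : (∫ α in t..(t + 1), ‖powSum (j + 1) n α‖ ^ 2 ^ (j + 1)) * (n : ℝ) ^ (j + 1) ≤
          (C * (n : ℝ) ^ (2 ^ (j + 1) - (j + 1)) * (n : ℝ) ^ ε) * (n : ℝ) ^ (j + 1) := by
        refine h2.trans_eq ?_; ring
      refine (le_of_mul_le_mul_right h4 (by positivity)).trans ?_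
      gcongr
  calc ∫ α in t..(t + 1), ‖wSum (j + 1) N P α‖ ^ 2 ^ (j + 1)
      ≤ ∫ α in t..(t + 1), ∑ n ∈ Finset.range (P + 1),
          μ n * ‖powSum (j + 1) n α‖ ^ 2 ^ (j + 1) := by
        apply intervalIntegral.integral_mono (by linarith)
        · exact Continuous.intervalIntegrable (by fun_prop) _ _
        · exact Continuous.intervalIntegrable (by fun_prop) _ _
        · exact fun α => hμ _ α
    _ = ∑ n ∈ Finset.range (P + 1),
          μ n * ∫ α in t..(t + 1), ‖powSum (j + 1) n α‖ ^ 2 ^ (j + 1) := by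
        rw [intervalIntegral.integral_finsetSum]
        · simp_rw [intervalIntegral.integral_const_mul]
        · exact fun n _ => Continuous.intervalIntegrable (by fun_prop) _ _
    _ ≤ ∑ n ∈ Finset.range (P + 1),
          μ n * (C * (P : ℝ) ^ (2 ^ (j + 1) - (j + 1)) * (P : ℝ) ^ ε) :=
        Finset.sum_le_sum fun n hn' => mul_le_mul_of_nonneg_left (hn n hn') (h0 n)
    _ = _ := by rw [← Finset.sum_mul, h1, one_mul]

lemma exists_norm_wSum_pow_le_weyl (k : ℕ) (hk : 2 ≤ k) (ε : ℝ) (hε : 0 < ε) :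
    ∃ C : ℝ, 0 ≤ C ∧ ∀ N P q : ℕ, 0 < P → 0 < q → ∀ a : ℤ, IsCoprime a (q : ℤ) → ∀ α : ℝ,
      |α - a / q| ≤ 1 / (q : ℝ) ^ 2 → ‖wSum k N P α‖ ^ 2 ^ (k - 1) ≤
        C * ((P : ℝ) ^ ε * (q : ℝ) ^ ε) * (P : ℝ) ^ 2 ^ (k - 1) *
          (1 / P + 1 / q + q / (P : ℝ) ^ k) := by
  obtain ⟨C, hC, h⟩ := exists_norm_powSum_pow_le k hk ε hε
  refine ⟨C, hC, fun N P q hP hq a ha α hα => ?_⟩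
  obtain ⟨μ, h0, h1, hμ⟩ := exists_norm_wSum_pow_le k N P (by omega)
  refine (hμ _ α).trans ?_
  calc _ ≤ ∑ n ∈ Finset.range (P + 1), μ n * (C * ((P : ℝ) ^ ε * (q : ℝ) ^ ε) *
        (P : ℝ) ^ 2 ^ (k - 1) * (1 / P + 1 / q + q / (P : ℝ) ^ k)) := by
        refine Finset.sum_le_sum fun n hn => mul_le_mul_of_nonneg_left ?_ (h0 n)
        exact h P n q hP (by rw [Finset.mem_range] at hn; omega) hq a ha α hα
    _ = _ := by rw [← Finset.sum_mul, h1, one_mul]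

/-- The integral over any set on which all rational approximations have large denominator. -/
lemma exists_setIntegral_norm_wSum_pow_le (k : ℕ) (hk : 2 ≤ k) :
    ∃ C : ℝ, 0 ≤ C ∧ ∀ (N P : ℕ) (X t : ℝ) (S : Set ℝ), 1 ≤ X → X ≤ P →
      (P : ℝ) ≤ 2 * X ^ (1 + 1 / (64 * 2 ^ (k - 1)) : ℝ) → MeasurableSet S →
      S ⊆ Set.Ioc t (t + 1) →
      (∀ α ∈ S, ∃ (q : ℕ) (a : ℤ), 0 < q ∧ IsCoprime a (q : ℤ) ∧ |α - a / q| ≤ 1 / (q : ℝ) ^ 2 ∧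
        X ^ (1 / 8 : ℝ) ≤ q ∧ (q : ℝ) ≤ X ^ (k - 1 / 8 : ℝ)) →
      ∫ α in S, ‖wSum k N P α‖ ^ 2 ^ (k + 1) ≤ C * X ^ (2 ^ (k + 1) - k - 1 / 8 : ℝ) := by
  set ε : ℝ := 1 / (16 * (6 + 2 * k)) with hεdef
  have hε : 0 < ε := by positivity
  obtain ⟨C₁, hC₁, h₁⟩ := exists_norm_wSum_pow_le_weyl k hk ε hε
  obtain ⟨C₂, hC₂, h₂⟩ := exists_integral_norm_wSum_pow_le k hk ε hε
  refine ⟨(3 * C₁) ^ 2 * C₂ * 2 ^ 2 ^ (k + 1) * 2 ^ (3 * ε), by positivity, ?_⟩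
  intro N P X t S hX hXP hPX hS hSt hq
  have hX0 : 0 < X := by linarith
  have hP0 : (0 : ℝ) < P := by linarith
  have hP : 0 < P := by exact_mod_cast hP0
  set B : ℝ := 3 * C₁ * ((P : ℝ) ^ ε * X ^ (k * ε)) * (P : ℝ) ^ 2 ^ (k - 1) * X ^ (-(1 / 8) : ℝ)
    with hB
  have hB0 : 0 ≤ B := by positivity
  have hpt : ∀ α ∈ S, ‖wSum k N P α‖ ^ 2 ^ (k - 1) ≤ B := by
    intro α hα
    obtain ⟨q, a, hq0, hcop, hαq, hql, hqu⟩ := hq α hα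
    have hq0' : (0 : ℝ) < q := by exact_mod_cast hq0
    refine (h₁ N P q hP hq0 a hcop α hαq).trans ?_
    have e1 : (1 : ℝ) / P ≤ X ^ (-(1 / 8) : ℝ) := by
      calc (1 : ℝ) / P ≤ 1 / X := one_div_le_one_div_of_le hX0 hXP
        _ = X ^ (-1 : ℝ) := by rw [Real.rpow_neg_one, one_div]
        _ ≤ _ := Real.rpow_le_rpow_of_exponent_le hX (by norm_num)
    have e2 : (1 : ℝ) / q ≤ X ^ (-(1 / 8) : ℝ) := by
      rw [Real.rpow_neg hX0.le, ← one_div]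
      exact one_div_le_one_div_of_le (by positivity) hql
    have e3 : (q : ℝ) / (P : ℝ) ^ k ≤ X ^ (-(1 / 8) : ℝ) := by
      calc (q : ℝ) / (P : ℝ) ^ k ≤ X ^ (k - 1 / 8 : ℝ) / X ^ k := by gcongr
        _ = X ^ (-(1 / 8) : ℝ) := by
          rw [← Real.rpow_natCast, ← Real.rpow_sub hX0]; congr 1; ring
    have e4 : (q : ℝ) ^ ε ≤ X ^ (k * ε) := by
      calc (q : ℝ) ^ ε ≤ (X ^ (k : ℝ)) ^ ε := by
            gcongr
            exact hqu.trans (Real.rpow_le_rpow_of_exponent_le hX (by linarith))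
        _ = _ := by rw [← Real.rpow_mul hX0.le]
    calc _ ≤ C₁ * ((P : ℝ) ^ ε * X ^ (k * ε)) * (P : ℝ) ^ 2 ^ (k - 1) *
          (X ^ (-(1 / 8) : ℝ) + X ^ (-(1 / 8) : ℝ) + X ^ (-(1 / 8) : ℝ)) := by gcongr
      _ = B := by rw [hB]; ring
  have hcont : Continuous fun α => ‖wSum k N P α‖ := (continuous_wSum k N P).norm
  have hintS : ∀ m : ℕ, IntegrableOn (fun α => ‖wSum k N P α‖ ^ m) S := fun m =>
    ((hcont.pow m).integrableOn_Ioc (μ := volume) (a := t) (b := t + 1)).mono_set hSt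
  have hsplit : ∀ α, ‖wSum k N P α‖ ^ 2 ^ (k + 1) =
      (‖wSum k N P α‖ ^ 2 ^ (k - 1)) ^ 2 * ‖wSum k N P α‖ ^ 2 ^ k := by
    intro α
    rw [← pow_mul, ← pow_add]
    congr 1
    obtain ⟨j, rfl⟩ : ∃ j, k = j + 1 := ⟨k - 1, by omega⟩
    simp only [Nat.add_sub_cancel, pow_succ]
    ring
  have hstep : ∫ α in S, ‖wSum k N P α‖ ^ 2 ^ (k + 1) ≤
      B ^ 2 * (C₂ * (P : ℝ) ^ (2 ^ k - k) * (P : ℝ) ^ ε) := by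
    calc _ ≤ ∫ α in S, B ^ 2 * ‖wSum k N P α‖ ^ 2 ^ k := by
          refine setIntegral_mono_on (hintS _) ((hintS _).const_mul _) hS fun α hα => ?_
          rw [hsplit]
          gcongr
          exact hpt α hα
      _ = B ^ 2 * ∫ α in S, ‖wSum k N P α‖ ^ 2 ^ k := by rw [integral_const_mul]
      _ ≤ B ^ 2 * ∫ α in t..(t + 1), ‖wSum k N P α‖ ^ 2 ^ k := by
          rw [intervalIntegral.integral_of_le (by linarith)]
          refine mul_le_mul_of_nonneg_left ?_ (by positivity)
          exact setIntegral_mono_set (hcont.pow _).integrableOn_Ioc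
            (ae_of_all _ fun α => by positivity) hSt.eventuallyLE
      _ ≤ _ := by gcongr; exact h₂ N P hP t
  refine hstep.trans ?_
  have hk2 : k < 2 ^ k := Nat.lt_two_pow_self
  have hexp : 2 * 2 ^ (k - 1) + (2 ^ k - k) = 2 ^ (k + 1) - k := by
    obtain ⟨j, rfl⟩ : ∃ j, k = j + 1 := ⟨k - 1, by omega⟩
    simp only [Nat.add_sub_cancel, pow_succ] at hk2 ⊢
    omega
  have hPpow : (P : ℝ) ^ (2 ^ (k + 1) - k) ≤
      2 ^ 2 ^ (k + 1) * X ^ (2 ^ (k + 1) - k + 1 / 16 : ℝ) := by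
    have hle : k ≤ 2 ^ (k + 1) := by rw [pow_succ]; omega
    calc (P : ℝ) ^ (2 ^ (k + 1) - k)
        ≤ (2 * X ^ (1 + 1 / (64 * 2 ^ (k - 1)) : ℝ)) ^ (2 ^ (k + 1) - k) := by gcongr
      _ = 2 ^ (2 ^ (k + 1) - k) *
          X ^ ((1 + 1 / (64 * 2 ^ (k - 1))) * ((2 ^ (k + 1) - k : ℕ) : ℝ) : ℝ) := by
          rw [mul_pow, Real.rpow_mul hX0.le, Real.rpow_natCast]
      _ ≤ _ := by
          gcongr
          · norm_num
          · omega
          · rw [Nat.cast_sub hle]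
            push_cast
            have h2 : (2 : ℝ) ^ (k + 1) = 4 * 2 ^ (k - 1) := by
              rw [show k + 1 = k - 1 + 2 by omega, pow_add]; ring
            have h3 : (0 : ℝ) < 2 ^ (k - 1) := by positivity
            have h4 : (1 : ℝ) / (64 * 2 ^ (k - 1)) * (2 ^ (k + 1) - k) ≤ 1 / 16 := by
              rw [h2, one_div_mul_eq_div, div_le_div_iff₀ (by positivity) (by norm_num)]
              nlinarith [(Nat.cast_nonneg k : (0 : ℝ) ≤ k)]
            nlinarith
  have hPε : (P : ℝ) ^ (3 * ε) ≤ 2 ^ (3 * ε) * X ^ (6 * ε) := by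
    have h5 : (P : ℝ) ≤ 2 * X ^ (2 : ℝ) := by
      refine hPX.trans ?_
      gcongr
      have : (1 : ℝ) ≤ 2 ^ (k - 1) := one_le_pow₀ (by norm_num)
      have : (1 : ℝ) / (64 * 2 ^ (k - 1)) ≤ 1 := by
        rw [div_le_one (by positivity)]; linarith
      linarith
    calc (P : ℝ) ^ (3 * ε) ≤ (2 * X ^ (2 : ℝ)) ^ (3 * ε) := by gcongr
      _ = _ := by
        rw [Real.mul_rpow (by norm_num) (by positivity), ← Real.rpow_mul hX0.le]
        congr 2; ring
  have hεexp : 6 * ε + 2 * (k * ε) = 1 / 16 := by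
    rw [hεdef]; field_simp
  calc B ^ 2 * (C₂ * (P : ℝ) ^ (2 ^ k - k) * (P : ℝ) ^ ε)
      = (3 * C₁) ^ 2 * C₂ * ((P : ℝ) ^ (2 ^ (k + 1) - k) * (P : ℝ) ^ (3 * ε)) *
          (X ^ (2 * (k * ε)) * X ^ (-(1 / 4) : ℝ)) := by
        have f1 : (P : ℝ) ^ (3 * ε) = ((P : ℝ) ^ ε) ^ 2 * (P : ℝ) ^ ε := by
          rw [← Real.rpow_natCast ((P : ℝ) ^ ε), ← Real.rpow_mul hP0.le, ← Real.rpow_add hP0]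
          congr 1; push_cast; ring
        have f2 : X ^ (2 * (k * ε)) = (X ^ (k * ε)) ^ 2 := by
          rw [← Real.rpow_natCast (X ^ (k * ε)), ← Real.rpow_mul hX0.le]
          congr 1; push_cast; ring
        have f3 : X ^ (-(1 / 4) : ℝ) = (X ^ (-(1 / 8) : ℝ)) ^ 2 := by
          rw [← Real.rpow_natCast (X ^ (-(1 / 8) : ℝ)), ← Real.rpow_mul hX0.le]
          congr 1; norm_num
        rw [f1, f2, f3, ← hexp, pow_add, pow_mul', hB]
        ring
    _ ≤ (3 * C₁) ^ 2 * C₂ * ((2 ^ 2 ^ (k + 1) * X ^ (2 ^ (k + 1) - k + 1 / 16 : ℝ)) *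
          (2 ^ (3 * ε) * X ^ (6 * ε))) * (X ^ (2 * (k * ε)) * X ^ (-(1 / 4) : ℝ)) := by
        gcongr
    _ = (3 * C₁) ^ 2 * C₂ * 2 ^ 2 ^ (k + 1) * 2 ^ (3 * ε) *
          (X ^ (2 ^ (k + 1) - k + 1 / 16 : ℝ) * X ^ (6 * ε) * X ^ (2 * (k * ε)) *
            X ^ (-(1 / 4) : ℝ)) := by ring
    _ = _ := by
        rw [← Real.rpow_add hX0, ← Real.rpow_add hX0, ← Real.rpow_add hX0]
        congr 2
        linarith

lemma exists_setIntegral_norm_wSum_pow_le_of_le (k : ℕ) (hk : 2 ≤ k) :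
    ∃ C : ℝ, 0 ≤ C ∧ ∀ (d N P : ℕ) (X t : ℝ) (S : Set ℝ), 2 ^ (k + 1) ≤ d → 1 ≤ X →
      X ^ k = N → X ≤ P →
      (P : ℝ) ≤ 2 * X ^ (1 + 1 / (64 * 2 ^ (k - 1)) : ℝ) → MeasurableSet S →
      S ⊆ Set.Ioc t (t + 1) →
      (∀ α ∈ S, ∃ (q : ℕ) (a : ℤ), 0 < q ∧ IsCoprime a (q : ℤ) ∧ |α - a / q| ≤ 1 / (q : ℝ) ^ 2 ∧
        X ^ (1 / 8 : ℝ) ≤ q ∧ (q : ℝ) ≤ X ^ (k - 1 / 8 : ℝ)) →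
      ∫ α in S, ‖wSum k N P α‖ ^ d ≤
        C * Real.Gamma (1 + 1 / k) ^ d * X ^ (d - k - 1 / 8 : ℝ) := by
  obtain ⟨C, hC, h⟩ := exists_setIntegral_norm_wSum_pow_le k hk
  have hk0 : (0 : ℝ) < k := by exact_mod_cast (by omega : 0 < k)
  set G := Real.Gamma (1 + 1 / k) with hG
  have hG0 : 0 < G := Real.Gamma_pos_of_pos (by positivity)
  refine ⟨C * (G ^ 2 ^ (k + 1))⁻¹, by positivity, ?_⟩
  intro d N P X t S hd hX hXN hXP hPX hS hSt hq
  have hX0 : 0 < X := by linarith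
  have hN : 0 < N := by
    have : (0 : ℝ) < N := hXN ▸ by positivity
    exact_mod_cast this
  have hXroot : (N : ℝ) ^ (1 / k : ℝ) = X := by
    rw [← hXN, ← Real.rpow_natCast, ← Real.rpow_mul hX0.le, mul_one_div_cancel hk0.ne',
      Real.rpow_one]
  have hpt : ∀ α, ‖wSum k N P α‖ ≤ G * X := fun α =>
    hXroot ▸ norm_wSum_le k N P (by omega) hN α
  have hcont : Continuous fun α => ‖wSum k N P α‖ := (continuous_wSum k N P).norm
  have hintS : ∀ m : ℕ, IntegrableOn (fun α => ‖wSum k N P α‖ ^ m) S := fun m =>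
    ((hcont.pow m).integrableOn_Ioc (μ := volume) (a := t) (b := t + 1)).mono_set hSt
  obtain ⟨r, rfl⟩ := Nat.exists_eq_add_of_le hd
  calc ∫ α in S, ‖wSum k N P α‖ ^ (2 ^ (k + 1) + r)
      ≤ ∫ α in S, (G * X) ^ r * ‖wSum k N P α‖ ^ 2 ^ (k + 1) := by
        refine setIntegral_mono_on (hintS _) ((hintS _).const_mul _) hS fun α _ => ?_
        rw [pow_add, mul_comm]
        gcongr
        exact hpt α
    _ = (G * X) ^ r * ∫ α in S, ‖wSum k N P α‖ ^ 2 ^ (k + 1) := by rw [integral_const_mul]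
    _ ≤ (G * X) ^ r * (C * X ^ (2 ^ (k + 1) - k - 1 / 8 : ℝ)) := by
        gcongr
        exact h N P X t S hX hXP hPX hS hSt hq
    _ = _ := by
        have h1 : X ^ (((2 ^ (k + 1) + r : ℕ) : ℝ) - k - 1 / 8 : ℝ) =
            X ^ r * X ^ (2 ^ (k + 1) - k - 1 / 8 : ℝ) := by
          rw [← Real.rpow_natCast X r, ← Real.rpow_add hX0]
          congr 1; push_cast; ring
        rw [h1, pow_add, mul_pow]
        field_simp
        ring

end Waring

namespace Waring

open MeasureTheory

lemma integrableOn_exp_neg_mul_rpow {p b : ℝ} (hp : 0 < p) (hb : 0 < b) :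
    IntegrableOn (fun t : ℝ => Real.exp (-b * t ^ p)) (Set.Ioi 0) := by
  simpa using integrableOn_rpow_mul_exp_neg_mul_rpow (s := 0) (by norm_num) hp hb

lemma integrableOn_cexp_neg_mul_rpow {p : ℝ} (hp : 0 < p) {c : ℂ} (hc : 0 < c.re) :
    IntegrableOn (fun t : ℝ => Complex.exp (-(c * (t ^ p : ℝ)))) (Set.Ioi 0) := by
  refine Integrable.mono' (integrableOn_exp_neg_mul_rpow hp hc) ?_ (ae_of_all _ fun t => ?_)
  · fun_prop
  · rw [Complex.norm_exp]
    simp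

/-- The exponential integral of a power, with complex frequency in the right half plane. -/
lemma integral_cexp_neg_mul_rpow {p : ℝ} (hp : 0 < p) {c : ℂ} (hc : 0 < c.re) :
    ∫ t in Set.Ioi (0 : ℝ), Complex.exp (-(c * (t ^ p : ℝ))) =
      Real.Gamma (1 / p + 1) * c ^ ((-(1 / p) : ℝ) : ℂ) := by
  set μ : Measure ℝ := volume.restrict (Set.Ioi 0)
  set Y : ℝ → ℝ := fun t => -(t ^ p) with hY
  have hset : ∀ r : ℝ, 0 < r → r ∈ interior (ProbabilityTheory.integrableExpSet Y μ) := by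
    intro r hr
    have hsub : Set.Ioi (0 : ℝ) ⊆ ProbabilityTheory.integrableExpSet Y μ := by
      intro b hb
      have h := integrableOn_exp_neg_mul_rpow hp hb
      refine h.congr (ae_of_all _ fun t => ?_)
      simp [hY]
    exact interior_maximal hsub isOpen_Ioi hr
  set U : Set ℂ := {z | 0 < z.re} with hU
  have hUo : IsOpen U := isOpen_lt continuous_const Complex.continuous_re
  have hUc : IsPreconnected U := (convex_halfSpace_re_gt 0).isPreconnected
  have h1 : AnalyticOnNhd ℂ (ProbabilityTheory.complexMGF Y μ) U := fun z hz =>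
    ProbabilityTheory.analyticAt_complexMGF (hset z.re hz)
  have h2 : AnalyticOnNhd ℂ (fun z : ℂ => Real.Gamma (1 / p + 1) * z ^ ((-(1 / p) : ℝ) : ℂ)) U := by
    apply DifferentiableOn.analyticOnNhd _ hUo
    intro z hz
    have : z ∈ Complex.slitPlane := Or.inl hz
    exact ((differentiableAt_id.cpow_const this).const_mul _).differentiableWithinAt
  have hreal : ∀ r : ℝ, 0 < r → ProbabilityTheory.complexMGF Y μ r =
      Real.Gamma (1 / p + 1) * (r : ℂ) ^ ((-(1 / p) : ℝ) : ℂ) := by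
    intro r hr
    rw [ProbabilityTheory.complexMGF_ofReal, ProbabilityTheory.mgf,
      ← Complex.ofReal_cpow hr.le, ← Complex.ofReal_mul]
    congr 1
    have h := integral_exp_neg_mul_rpow hp hr
    rw [mul_comm, ← neg_div, ← h]
    refine integral_congr_ae (ae_of_all _ fun t => ?_)
    simp [hY]
  have hfreq : ∃ᶠ z in nhdsWithin (1 : ℂ) {1}ᶜ, ProbabilityTheory.complexMGF Y μ z =
      (fun z : ℂ => Real.Gamma (1 / p + 1) * z ^ ((-(1 / p) : ℝ) : ℂ)) z := by
    have ht : Filter.Tendsto (fun n : ℕ => ((1 + 1 / ((n : ℝ) + 1) : ℝ) : ℂ)) Filter.atTop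
        (nhdsWithin (1 : ℂ) {1}ᶜ) := by
      rw [tendsto_nhdsWithin_iff]
      constructor
      · have h3 : Filter.Tendsto (fun n : ℕ => (1 + 1 / ((n : ℝ) + 1) : ℝ)) Filter.atTop
            (nhds (1 + 0)) := tendsto_one_div_add_atTop_nhds_zero_nat.const_add 1
        have h4 := (Complex.continuous_ofReal.tendsto (1 + 0)).comp h3
        simpa [Function.comp_def] using h4
      · refine Filter.Eventually.of_forall fun n => ?_
        rw [Set.mem_compl_singleton_iff]
        have : (0 : ℝ) < 1 / ((n : ℝ) + 1) := by positivity
        intro h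
        have h5 : (1 + 1 / ((n : ℝ) + 1) : ℝ) = 1 := by exact_mod_cast h
        linarith
    refine ht.frequently (Filter.Frequently.of_forall fun n => ?_)
    exact hreal _ (by positivity)
  have h := h1.eqOn_of_preconnected_of_frequently_eq h2 hUc
    (show (1 : ℂ) ∈ U by simp [hU]) hfreq hc
  rw [ProbabilityTheory.complexMGF] at h
  refine Eq.trans (integral_congr_ae (ae_of_all _ fun t => ?_)) h
  simp [hY]

/-- Euler's integral with complex frequency in the right half plane. -/
lemma integral_rpow_mul_cexp_neg_mul {s : ℝ} (hs : 0 < s) {c : ℂ} (hc : 0 < c.re) :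
    ∫ u in Set.Ioi (0 : ℝ), ((u ^ (s - 1) : ℝ) : ℂ) * Complex.exp (-(c * u)) =
      Real.Gamma s * c ^ ((-s : ℝ) : ℂ) := by
  have h := integral_cexp_neg_mul_rpow (p := 1 / s) (by positivity) hc
  rw [one_div_one_div, ← integral_comp_rpow_Ioi_of_pos hs] at h
  have h1 : ∫ u in Set.Ioi (0 : ℝ), (s * u ^ (s - 1)) •
      Complex.exp (-(c * (((u ^ s) ^ (1 / s) : ℝ) : ℂ))) =
      s * ∫ u in Set.Ioi (0 : ℝ), ((u ^ (s - 1) : ℝ) : ℂ) * Complex.exp (-(c * u)) := by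
    rw [← integral_const_mul]
    refine setIntegral_congr_fun measurableSet_Ioi fun u hu => ?_
    rw [← Real.rpow_mul (le_of_lt hu), mul_one_div_cancel hs.ne', Real.rpow_one, Complex.real_smul]
    push_cast
    ring
  rw [h1, Real.Gamma_add_one hs.ne', Complex.ofReal_mul, mul_assoc] at h
  exact mul_left_cancel₀ (by exact_mod_cast hs.ne') h

end Waring

namespace Waring

open MeasureTheory FourierTransform

/-- The complex frequency attached to the weight of scale `N` and the displacement `β`. -/
noncomputable def cpar (N : ℕ) (β : ℝ) : ℂ :=
  (((N : ℝ)⁻¹ : ℝ) : ℂ) - 2 * Real.pi * Complex.I * β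

lemma cpar_re (N : ℕ) (β : ℝ) : (cpar N β).re = (N : ℝ)⁻¹ := by
  simp [cpar]

lemma cpar_im (N : ℕ) (β : ℝ) : (cpar N β).im = -(2 * Real.pi * β) := by
  simp [cpar]

lemma cpar_re_pos {N : ℕ} (hN : 0 < N) (β : ℝ) : 0 < (cpar N β).re := by
  rw [cpar_re]
  positivity

lemma cpar_ne_zero {N : ℕ} (hN : 0 < N) (β : ℝ) : cpar N β ≠ 0 := fun h => by
  have := cpar_re_pos hN β
  simp [h] at this

lemma cpar_mem_slitPlane {N : ℕ} (hN : 0 < N) (β : ℝ) : cpar N β ∈ Complex.slitPlane :=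
  Or.inl (cpar_re_pos hN β)

@[fun_prop]
lemma continuous_cpar (N : ℕ) : Continuous (cpar N) := by
  unfold cpar
  fun_prop

lemma sq_norm_cpar (N : ℕ) (β : ℝ) :
    ‖cpar N β‖ ^ 2 = ((N : ℝ)⁻¹) ^ 2 + (2 * Real.pi * β) ^ 2 := by
  rw [Complex.sq_norm, Complex.normSq_apply, cpar_re, cpar_im]
  ring

lemma inv_le_norm_cpar (N : ℕ) (β : ℝ) : (N : ℝ)⁻¹ ≤ ‖cpar N β‖ := by
  rw [← cpar_re N β]
  exact Complex.re_le_norm _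

lemma abs_le_norm_cpar (N : ℕ) (β : ℝ) : |β| ≤ ‖cpar N β‖ := by
  have h := Complex.abs_im_le_norm (cpar N β)
  rw [cpar_im, abs_neg, abs_mul, abs_of_pos (by positivity)] at h
  have h1 : 1 * |β| ≤ 2 * Real.pi * |β| := by
    gcongr
    linarith [Real.pi_gt_three]
  linarith

/-- The continuous analogue of the weighted Weyl sum. -/
noncomputable def vInt (k N : ℕ) (β : ℝ) : ℂ :=
  (Real.Gamma (1 + 1 / k) : ℂ) * cpar N β ^ ((-(1 / k) : ℝ) : ℂ)

lemma continuous_cpar_cpow {N : ℕ} (hN : 0 < N) (s : ℂ) :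
    Continuous fun β => cpar N β ^ s :=
  (continuous_cpar N).cpow continuous_const fun β => cpar_mem_slitPlane hN β

lemma continuous_vInt (k : ℕ) {N : ℕ} (hN : 0 < N) : Continuous (vInt k N) := by
  unfold vInt
  exact continuous_const.mul (continuous_cpar_cpow hN _)

lemma vInt_pow (k d N : ℕ) (β : ℝ) :
    vInt k N β ^ d = ((Real.Gamma (1 + 1 / k) ^ d : ℝ) : ℂ) *
      cpar N β ^ ((-((d : ℝ) / k) : ℝ) : ℂ) := by
  rw [vInt, mul_pow, ← Complex.cpow_nat_mul]
  push_cast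
  congr 2
  ring

lemma norm_cpar_cpow_le {N : ℕ} (hN : 0 < N) {s : ℝ} (hs : 0 ≤ s) (β : ℝ) :
    ‖cpar N β ^ ((-s : ℝ) : ℂ)‖ ≤ (N : ℝ) ^ s := by
  have hN' : (0 : ℝ) < N := by positivity
  rw [Complex.norm_cpow_real, Real.rpow_neg (norm_nonneg _)]
  calc (‖cpar N β‖ ^ s)⁻¹ ≤ (((N : ℝ)⁻¹) ^ s)⁻¹ := by
        have := inv_le_norm_cpar N β
        gcongr
    _ = (N : ℝ) ^ s := by rw [Real.inv_rpow hN'.le, inv_inv]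

lemma norm_vInt_le (k : ℕ) {N : ℕ} (hN : 0 < N) (β : ℝ) :
    ‖vInt k N β‖ ≤ Real.Gamma (1 + 1 / k) * (N : ℝ) ^ (1 / k : ℝ) := by
  have hG : 0 < Real.Gamma (1 + 1 / k) := Real.Gamma_pos_of_pos (by positivity)
  rw [vInt, norm_mul, Complex.norm_real, Real.norm_of_nonneg hG.le]
  gcongr
  exact norm_cpar_cpow_le hN (by positivity) β

lemma norm_cpar_cpow_le_mul {N : ℕ} (hN : 0 < N) {s : ℝ} (hs : 2 ≤ s) (β : ℝ) :
    ‖cpar N β ^ ((-s : ℝ) : ℂ)‖ ≤ (N : ℝ) ^ (s - 2) * (‖cpar N β‖ ^ 2)⁻¹ := by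
  have h := norm_cpar_cpow_le hN (sub_nonneg.2 hs) β
  have h0 : 0 < ‖cpar N β‖ := norm_pos_iff.2 (cpar_ne_zero hN β)
  rw [Complex.norm_cpow_real] at h ⊢
  rw [show -s = -(s - 2) + -2 by ring, Real.rpow_add h0]
  gcongr
  rw [Real.rpow_neg h0.le]
  norm_cast

lemma integrable_inv_sq_norm_cpar {N : ℕ} (hN : 0 < N) :
    Integrable fun β => (‖cpar N β‖ ^ 2)⁻¹ := by
  have hN' : (0 : ℝ) < N := by positivity
  have h := (integrable_inv_one_add_sq.comp_mul_left'
    (show (2 * Real.pi * N : ℝ) ≠ 0 by positivity)).const_mul ((N : ℝ) ^ 2)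
  refine h.congr (ae_of_all _ fun β => ?_)
  simp only
  rw [sq_norm_cpar, ← div_eq_mul_inv, div_eq_iff (by positivity), inv_mul_eq_div,
    eq_div_iff (by positivity)]
  field_simp

lemma integrable_cpar_cpow {N : ℕ} (hN : 0 < N) {s : ℝ} (hs : 2 ≤ s) :
    Integrable fun β => cpar N β ^ ((-s : ℝ) : ℂ) :=
  Integrable.mono' ((integrable_inv_sq_norm_cpar hN).const_mul ((N : ℝ) ^ (s - 2)))
    (continuous_cpar_cpow hN _).aestronglyMeasurable
    (ae_of_all _ fun β => norm_cpar_cpow_le_mul hN hs β)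

/-- The inverse Fourier transform of the Gamma density of scale `N`. -/
lemma fourierInv_gamma {N : ℕ} (hN : 0 < N) {s : ℝ} (hs : 0 < s) (β : ℝ) :
    𝓕⁻ ((Set.Ioi (0 : ℝ)).indicator fun u : ℝ => ((u ^ (s - 1) * Real.exp (-(u / N)) : ℝ) : ℂ)) β =
      Real.Gamma s * cpar N β ^ ((-s : ℝ) : ℂ) := by
  rw [← integral_rpow_mul_cexp_neg_mul hs (cpar_re_pos hN β), Real.fourierInv_eq',
    ← integral_indicator measurableSet_Ioi]
  refine integral_congr_ae (ae_of_all _ fun u => ?_)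
  by_cases hu : u ∈ Set.Ioi (0 : ℝ)
  · simp only [Set.indicator_of_mem hu, smul_eq_mul]
    push_cast
    rw [mul_left_comm, ← Complex.exp_add]
    congr 2
    simp [cpar]
    ring
  · simp [Set.indicator_of_notMem hu]

/-- The Laplace inversion formula for powers, in Fourier form. -/
lemma integral_cpar_cpow_mul_e {N : ℕ} (hN : 0 < N) {s : ℝ} (hs : 2 ≤ s) :
    ∫ β, cpar N β ^ ((-s : ℝ) : ℂ) * e (-(N * β)) =
      ((Real.exp (-1) * (N : ℝ) ^ (s - 1) / Real.Gamma s : ℝ) : ℂ) := by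
  have hN' : (0 : ℝ) < N := by positivity
  have hs0 : 0 < s := by linarith
  have hG : Real.Gamma s ≠ 0 := (Real.Gamma_pos_of_pos hs0).ne'
  set g : ℝ → ℂ :=
    (Set.Ioi (0 : ℝ)).indicator fun u : ℝ => ((u ^ (s - 1) * Real.exp (-(u / N)) : ℝ) : ℂ) with hg
  have hinv : 𝓕⁻ g = fun β => Real.Gamma s * cpar N β ^ ((-s : ℝ) : ℂ) :=
    funext fun β => fourierInv_gamma hN hs0 β
  have hint : Integrable (𝓕⁻ g) := by
    rw [hinv]
    exact (integrable_cpar_cpow hN hs).const_mul _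
  have hF : Integrable (𝓕 g) := by
    refine hint.comp_neg.congr (ae_of_all _ fun w => ?_)
    simp [Real.fourierInv_eq_fourier_neg]
  have hgint : Integrable g := by
    rw [hg, integrable_indicator_iff measurableSet_Ioi]
    have h := integrableOn_rpow_mul_exp_neg_mul_rpow (s := s - 1) (p := 1) (b := (N : ℝ)⁻¹)
      (by linarith) one_pos (by positivity)
    refine (h.congr_fun (fun u _ => ?_) measurableSet_Ioi).ofReal
    simp only [Real.rpow_one]
    congr 2
    ring
  have hcont : ContinuousAt g N := by
    have h1 : ContinuousAt (fun u : ℝ => ((u ^ (s - 1) * Real.exp (-(u / N)) : ℝ) : ℂ)) N := by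
      refine Complex.continuous_ofReal.continuousAt.comp
        (ContinuousAt.mul (Real.continuousAt_rpow_const _ _ (Or.inl hN'.ne')) ?_)
      fun_prop
    refine h1.congr ?_
    filter_upwards [isOpen_Ioi.mem_nhds hN'] with u hu
    rw [hg, Set.indicator_of_mem hu]
  have h := hgint.fourier_fourierInv_eq hF hcont
  rw [hinv, Real.fourier_eq', hg, Set.indicator_of_mem (show (N : ℝ) ∈ Set.Ioi 0 from hN'),
    div_self hN'.ne'] at h
  have h2 : ∫ β : ℝ, Complex.exp (((-2 * Real.pi * inner ℝ β (N : ℝ) : ℝ) : ℂ) * Complex.I) •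
      (Real.Gamma s * cpar N β ^ ((-s : ℝ) : ℂ)) =
      Real.Gamma s * ∫ β, cpar N β ^ ((-s : ℝ) : ℂ) * e (-(N * β)) := by
    rw [← integral_const_mul]
    refine integral_congr_ae (ae_of_all _ fun β => ?_)
    simp only [e, smul_eq_mul]
    rw [mul_left_comm, mul_comm (Complex.exp _)]
    congr 3
    simp
    ring
  rw [h2] at h
  rw [Complex.ofReal_div, eq_div_iff (by exact_mod_cast hG), mul_comm, h, mul_comm (Real.exp _)]

/-- The completed singular integral. -/
lemma integral_vInt_pow (k d : ℕ) {N : ℕ} (hN : 0 < N) (hd : 2 ≤ (d : ℝ) / k) :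
    ∫ β, vInt k N β ^ d * e (-(N * β)) =
      ((Real.exp (-1) * (Real.Gamma (1 + 1 / k) ^ d / Real.Gamma (d / k) *
        (N : ℝ) ^ ((d : ℝ) / k - 1)) : ℝ) : ℂ) := by
  simp only [vInt_pow, mul_assoc]
  rw [integral_const_mul, integral_cpar_cpow_mul_e hN hd]
  push_cast
  ring

lemma integrable_vInt_pow (k d : ℕ) {N : ℕ} (hN : 0 < N) (hd : 2 ≤ (d : ℝ) / k) :
    Integrable fun β => vInt k N β ^ d * e (-(N * β)) := by
  simp only [vInt_pow, mul_assoc]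
  refine Integrable.const_mul ?_ _
  refine (integrable_cpar_cpow hN hd).mono ?_ (ae_of_all _ fun β => ?_)
  · exact ((continuous_cpar_cpow hN _).mul (by fun_prop)).aestronglyMeasurable
  · rw [norm_mul, norm_e, mul_one]

lemma norm_vInt_pow_mul_e_le (k d : ℕ) {N : ℕ} (hN : 0 < N) (hd : 2 ≤ (d : ℝ) / k) {β : ℝ}
    (hβ : β ≠ 0) : ‖vInt k N β ^ d * e (-(N * β))‖ ≤
      Real.Gamma (1 + 1 / k) ^ d * (N : ℝ) ^ ((d : ℝ) / k - 2) * |β| ^ (-2 : ℝ) := by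
  have hG : 0 < Real.Gamma (1 + 1 / k) := Real.Gamma_pos_of_pos (by positivity)
  have h0 : 0 < |β| := abs_pos.2 hβ
  rw [norm_mul, norm_e, mul_one, vInt_pow, norm_mul, Complex.norm_real,
    Real.norm_of_nonneg (by positivity), mul_assoc]
  gcongr
  refine (norm_cpar_cpow_le_mul hN hd β).trans ?_
  gcongr
  rw [Real.rpow_neg h0.le]
  norm_cast
  gcongr
  exact abs_le_norm_cpar N β

/-- Truncation of the singular integral. -/
lemma norm_integral_vInt_pow_sub_le (k d : ℕ) {N : ℕ} (hN : 0 < N) (hd : 2 ≤ (d : ℝ) / k) {τ : ℝ}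
    (hτ : 0 < τ) :
    ‖(∫ β, vInt k N β ^ d * e (-(N * β))) - ∫ β in Set.Ioc (-τ) τ, vInt k N β ^ d * e (-(N * β))‖ ≤
      2 * Real.Gamma (1 + 1 / k) ^ d * (N : ℝ) ^ ((d : ℝ) / k - 2) / τ := by
  set f : ℝ → ℂ := fun β => vInt k N β ^ d * e (-(N * β)) with hf
  have hfi : Integrable f := integrable_vInt_pow k d hN hd
  set A : ℝ := Real.Gamma (1 + 1 / k) ^ d * (N : ℝ) ^ ((d : ℝ) / k - 2)
  have hrpow : ∫ t in Set.Ioi τ, A * t ^ (-2 : ℝ) = A / τ := by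
    rw [integral_const_mul, integral_Ioi_rpow_of_lt (by norm_num) hτ]
    norm_num [Real.rpow_neg_one]
    ring
  have hIoi : ∀ g : ℝ → ℂ, (∀ t ∈ Set.Ioi τ, ‖g t‖ ≤ A * t ^ (-2 : ℝ)) →
      ‖∫ t in Set.Ioi τ, g t‖ ≤ A / τ := by
    intro g hg
    rw [← hrpow]
    exact norm_integral_le_of_norm_le
      ((integrableOn_Ioi_rpow_of_lt (by norm_num) hτ).const_mul A)
      ((ae_restrict_iff' measurableSet_Ioi).2 (ae_of_all _ hg))
  have hright : ‖∫ t in Set.Ioi τ, f t‖ ≤ A / τ := hIoi f fun t ht => by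
    have ht0 : 0 < t := hτ.trans ht
    have h := norm_vInt_pow_mul_e_le k d hN hd ht0.ne'
    rwa [abs_of_pos ht0] at h
  have hleft : ‖∫ t in Set.Iic (-τ), f t‖ ≤ A / τ := by
    have h1 : ∫ t in Set.Iic (-τ), f t = ∫ t in Set.Ioi τ, f (-t) := by
      simp
    rw [h1]
    refine hIoi _ fun t ht => ?_
    have ht0 : 0 < t := hτ.trans ht
    have h := norm_vInt_pow_mul_e_le k d hN hd (neg_ne_zero.2 ht0.ne')
    rwa [abs_neg, abs_of_pos ht0] at h
  have hsplit : ∫ t, f t = (∫ t in Set.Iic (-τ), f t) + ((∫ t in Set.Ioc (-τ) τ, f t) +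
      ∫ t in Set.Ioi τ, f t) := by
    rw [← setIntegral_union (Set.Ioc_disjoint_Ioi le_rfl) measurableSet_Ioi hfi.integrableOn
      hfi.integrableOn, Set.Ioc_union_Ioi_eq_Ioi (by linarith), ← setIntegral_union
      (Set.Iic_disjoint_Ioi le_rfl) measurableSet_Ioi hfi.integrableOn hfi.integrableOn,
      Set.Iic_union_Ioi, setIntegral_univ]
  rw [hsplit, show ∀ a b c : ℂ, a + (b + c) - b = a + c by intros; ring]
  refine (norm_add_le _ _).trans ((add_le_add hleft hright).trans_eq ?_)
  ring

end Waring

namespace Waring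

open MeasureTheory

/-- The smooth weight twisted by a small displacement. -/
noncomputable def twist (k N : ℕ) (β t : ℝ) : ℂ := Complex.exp (-(cpar N β * (t ^ k : ℝ)))

@[fun_prop]
lemma continuous_twist (k N : ℕ) (β : ℝ) : Continuous (twist k N β) := by
  unfold twist
  fun_prop

lemma norm_twist (k N : ℕ) (β t : ℝ) : ‖twist k N β t‖ = wt k N t := by
  rw [twist, wt, Complex.norm_exp, Complex.neg_re, Complex.re_mul_ofReal, cpar_re]
  congr 2
  ring

lemma twist_eq (k N : ℕ) (β t : ℝ) : twist k N β t = wt k N t * e (β * t ^ k) := by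
  rw [twist, wt, e, Complex.ofReal_exp, ← Complex.exp_add]
  congr 1
  simp [cpar]
  ring

lemma norm_twist_sub_le (k : ℕ) {N : ℕ} (hN : 0 < N) (β : ℝ) {s t : ℝ} (hs : 0 ≤ s) (hst : s ≤ t) :
    ‖twist k N β t - twist k N β s‖ ≤ ‖cpar N β‖ * N * (wt k N s - wt k N t) := by
  have hN' : (0 : ℝ) < N := by positivity
  have key : ∀ u v : ℝ, u ≤ v →
      ‖Complex.exp (-(cpar N β * v)) - Complex.exp (-(cpar N β * u))‖ ≤
        ‖cpar N β‖ * N * (Real.exp (-(u / N)) - Real.exp (-(v / N))) := by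
    intro u v huv
    have hd : ∀ x : ℝ, HasDerivAt (fun x : ℝ => Complex.exp (-(cpar N β * x)) -
        Complex.exp (-(cpar N β * u))) (Complex.exp (-(cpar N β * x)) * -(cpar N β * 1)) x :=
      fun x => ((((hasDerivAt_id x).ofReal_comp.const_mul (cpar N β)).neg).cexp).sub_const _
    have hB : ∀ x : ℝ, HasDerivAt (fun x : ℝ => ‖cpar N β‖ * N * (Real.exp (-(u / N)) -
        Real.exp (-(x / N)))) (‖cpar N β‖ * N * -(Real.exp (-(x / N)) * -(1 / N))) x :=
      fun x => (((((hasDerivAt_id x).div_const (N : ℝ)).neg).exp).const_sub _).const_mul _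
    refine image_norm_le_of_norm_deriv_right_le_deriv_boundary
      (fun x _ => (hd x).continuousAt.continuousWithinAt) (fun x _ => (hd x).hasDerivWithinAt)
      (by simp) hB (fun x _ => ?_) (Set.right_mem_Icc.2 huv)
    rw [norm_mul, Complex.norm_exp, norm_neg, mul_one, Complex.neg_re, Complex.re_mul_ofReal,
      cpar_re]
    apply le_of_eq
    rw [show -((N : ℝ)⁻¹ * x) = -(x / N) by ring]
    field_simp
  exact key _ _ (by gcongr)

lemma sum_wt_sub (k N P : ℕ) :
    ∑ n ∈ Finset.range P, (wt k N n - wt k N (n + 1)) = wt k N 0 - wt k N P := by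
  have h := Finset.sum_range_sub' (fun n : ℕ => wt k N n) P
  simpa using h

lemma norm_sum_sub_le_of_periodic (f : ℕ → ℂ) {q : ℕ} (hq : 0 < q) (hf : ∀ r, f (r + q) = f r)
    (h0 : ∑ r ∈ Finset.range q, f r = 0) {B : ℝ} (hB : ∀ r, ‖f r‖ ≤ B) (n : ℕ) :
    ‖∑ r ∈ Finset.range n, f r‖ ≤ B * q := by
  have hB0 : 0 ≤ B := (norm_nonneg _).trans (hB 0)
  rw [← Nat.div_add_mod' n q, Finset.sum_range_add, sum_range_mul_of_periodic f q hf, h0, smul_zero,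
    zero_add]
  refine (norm_sum_le_of_le _ fun r _ => hB _).trans ?_
  rw [Finset.sum_const, Finset.card_range, nsmul_eq_mul, mul_comm]
  gcongr
  exact (Nat.mod_lt n hq).le

lemma norm_sum_e_sub_warGauss_le (k a : ℕ) {q : ℕ} (hq : 0 < q) (n : ℕ) :
    ‖∑ m ∈ Finset.Icc 1 n, (e ((a : ℝ) * (m : ℝ) ^ k / q) - warGauss k q a)‖ ≤ 2 * q := by
  have hq' : (q : ℂ) ≠ 0 := by exact_mod_cast hq.ne'
  rw [sum_Icc_eq_sum_range]
  refine norm_sum_sub_le_of_periodic (fun r => e ((a : ℝ) * ((r + 1 : ℕ) : ℝ) ^ k / q) -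
    warGauss k q a) hq (fun r => ?_) ?_ (fun r => ?_) n
  · rw [show r + q + 1 = r + 1 + q by ring, e_mul_pow_div_periodic]
  · rw [← sum_Icc_eq_sum_range (fun r => e ((a : ℝ) * (r : ℝ) ^ k / q) - warGauss k q a),
      Finset.sum_sub_distrib, warGauss]
    simp [hq']
  · refine (norm_sub_le _ _).trans ?_
    rw [norm_e]
    linarith [norm_warGauss_le_one k q a]

lemma norm_wSum_sub_sum_twist_le {k : ℕ} (hk : 0 < k) {N : ℕ} (hN : 0 < N) (P a : ℕ) {q : ℕ}
    (hq : 0 < q) (β : ℝ) :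
    ‖wSum k N P (a / q + β) - warGauss k q a * ∑ n ∈ Finset.Icc 1 P, twist k N β n‖ ≤
      2 * q * (‖cpar N β‖ * N + 1) := by
  have h1 : wSum k N P (a / q + β) - warGauss k q a * ∑ n ∈ Finset.Icc 1 P, twist k N β n =
      ∑ n ∈ Finset.Icc 1 P, twist k N β n * (e ((a : ℝ) * (n : ℝ) ^ k / q) - warGauss k q a) := by
    rw [wSum, Finset.mul_sum, ← Finset.sum_sub_distrib]
    refine Finset.sum_congr rfl fun n _ => ?_
    rw [twist_eq, show ((a : ℝ) / q + β) * (n : ℝ) ^ k = β * (n : ℝ) ^ k + a * (n : ℝ) ^ k / q by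
      ring, e_add]
    ring
  rw [h1, sum_Icc_mul_eq_sub _ fun n : ℕ => twist k N β n]
  have hE := norm_sum_e_sub_warGauss_le k a hq
  have hw0 := wt_zero hk N
  calc _ ≤ ∑ n ∈ Finset.range P, ‖cpar N β‖ * N * (wt k N n - wt k N (n + 1)) * (2 * q) +
        1 * (2 * q) := by
        refine (norm_add_le _ _).trans (add_le_add (norm_sum_le_of_le _ fun n _ => ?_) ?_)
        · rw [norm_mul, norm_sub_rev]
          have h2 := norm_twist_sub_le k hN β (s := n) (t := (n : ℝ) + 1) (by positivity)
            (by linarith)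
          push_cast
          exact mul_le_mul h2 (hE n) (norm_nonneg _) ((norm_nonneg _).trans h2)
        · rw [norm_mul, norm_twist]
          gcongr
          · rw [← hw0]
            exact wt_anti k N le_rfl (by positivity)
          · exact hE P
    _ = 2 * q * (‖cpar N β‖ * N * (1 - wt k N P) + 1) := by
        rw [← Finset.sum_mul, ← Finset.mul_sum, sum_wt_sub, hw0]
        ring
    _ ≤ _ := by
        have := (wt_pos k N P).le
        have h2 : ‖cpar N β‖ * N * (1 - wt k N P) ≤ ‖cpar N β‖ * N :=
          mul_le_of_le_one_right (by positivity) (by linarith)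
        gcongr

lemma norm_sum_twist_sub_integral_le {k : ℕ} (hk : 0 < k) {N : ℕ} (hN : 0 < N) (P : ℕ) (β : ℝ) :
    ‖∑ n ∈ Finset.Icc 1 P, twist k N β n - ∫ t in (0 : ℝ)..P, twist k N β t‖ ≤
      ‖cpar N β‖ * N := by
  have hint : ∀ a b : ℝ, IntervalIntegrable (twist k N β) volume a b := fun a b =>
    (continuous_twist k N β).intervalIntegrable a b
  have h1 : ∫ t in (0 : ℝ)..P, twist k N β t =
      ∑ n ∈ Finset.range P, ∫ t in (n : ℝ)..(n + 1 : ℕ), twist k N β t := by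
    rw [intervalIntegral.sum_integral_adjacent_intervals (a := fun n : ℕ => (n : ℝ))
      fun n _ => hint _ _]
    simp
  rw [h1, sum_Icc_eq_sum_range, ← Finset.sum_sub_distrib]
  calc _ ≤ ∑ n ∈ Finset.range P, ‖cpar N β‖ * N * (wt k N n - wt k N (n + 1)) := by
        refine norm_sum_le_of_le _ fun n _ => ?_
        have h2 : twist k N β (n + 1 : ℕ) - ∫ t in (n : ℝ)..(n + 1 : ℕ), twist k N β t =
            ∫ t in (n : ℝ)..(n + 1 : ℕ), (twist k N β (n + 1 : ℕ) - twist k N β t) := by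
          rw [intervalIntegral.integral_sub intervalIntegrable_const (hint _ _),
            intervalIntegral.integral_const]
          simp
        rw [h2]
        refine (intervalIntegral.norm_integral_le_of_norm_le_const
          (C := ‖cpar N β‖ * N * (wt k N n - wt k N (n + 1))) fun t ht => ?_).trans ?_
        · rw [Set.uIoc_of_le (by push_cast; linarith)] at ht
          have hn : (0 : ℝ) ≤ n := by positivity
          refine (norm_twist_sub_le k hN β (by linarith [ht.1]) ht.2).trans ?_
          push_cast
          gcongr
          exact wt_anti k N hn ht.1.le
        · simp
    _ = ‖cpar N β‖ * N * (1 - wt k N P) := by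
        rw [← Finset.mul_sum, sum_wt_sub, wt_zero hk]
    _ ≤ _ := by
        have := wt_pos k N P
        have : (0 : ℝ) ≤ ‖cpar N β‖ * N := by positivity
        nlinarith

lemma integrableOn_twist {k : ℕ} (hk : 0 < k) {N : ℕ} (hN : 0 < N) (β : ℝ) :
    IntegrableOn (twist k N β) (Set.Ioi 0) := by
  have h := integrableOn_cexp_neg_mul_rpow (p := k) (by positivity) (cpar_re_pos hN β)
  simp only [Real.rpow_natCast] at h
  exact h

lemma integral_twist {k : ℕ} (hk : 0 < k) {N : ℕ} (hN : 0 < N) (β : ℝ) :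
    ∫ t in Set.Ioi (0 : ℝ), twist k N β t = vInt k N β := by
  have h := integral_cexp_neg_mul_rpow (p := k) (by positivity) (cpar_re_pos hN β)
  rw [add_comm (1 / (k : ℝ))] at h
  simpa [twist, vInt] using h

lemma norm_integral_Ioi_twist_le {k : ℕ} (hk : 0 < k) {N : ℕ} {X : ℝ} (hX : 1 ≤ X)
    (hXN : X ^ k = N) {P : ℝ} (hP : X ≤ P) (β : ℝ) :
    ‖∫ t in Set.Ioi P, twist k N β t‖ ≤ X * Real.exp (-(P / X)) := by
  have hX0 : 0 < X := by linarith
  have ha : -X⁻¹ < 0 := by simpa using hX0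
  have h1 : X * Real.exp (-(P / X)) = ∫ t in Set.Ioi P, Real.exp (-X⁻¹ * t) := by
    rw [integral_exp_mul_Ioi ha, show -X⁻¹ * P = -(P / X) by ring]
    field_simp
  rw [h1]
  refine norm_integral_le_of_norm_le (integrableOn_exp_mul_Ioi ha P)
    ((ae_restrict_iff' measurableSet_Ioi).2 (ae_of_all _ fun t ht => ?_))
  have ht : P < t := ht
  rw [norm_twist, wt]
  gcongr
  have h2 : t / X ≤ (t / X) ^ k := le_self_pow₀ (by rw [le_div_iff₀ hX0]; linarith) hk.ne'
  rw [div_pow, hXN] at h2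
  rw [show -X⁻¹ * t = -(t / X) by ring]
  linarith

lemma mul_exp_neg_div_le {X P : ℝ} (hX : 1 ≤ X) {m : ℕ} (hm : 0 < m)
    (hP : X ^ (1 + 1 / (m : ℝ)) ≤ P) : X * Real.exp (-(P / X)) ≤ m.factorial := by
  have hX0 : 0 < X := by linarith
  have hm' : (m : ℝ) ≠ 0 := by positivity
  have h1 : X ^ (1 / (m : ℝ)) ≤ P / X := by
    rw [le_div_iff₀ hX0, ← Real.rpow_add_one hX0.ne', add_comm]
    exact hP
  have h2 : X ≤ (P / X) ^ m := by
    calc X = (X ^ (1 / (m : ℝ))) ^ m := by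
          rw [← Real.rpow_mul_natCast hX0.le, one_div_mul_cancel hm', Real.rpow_one]
      _ ≤ _ := by gcongr
  have hy : 0 ≤ P / X := (by positivity : (0 : ℝ) ≤ X ^ (1 / (m : ℝ))).trans h1
  have h3 := Real.pow_div_factorial_le_exp (P / X) hy m
  rw [Real.exp_neg, ← div_eq_mul_inv, div_le_iff₀ (Real.exp_pos _)]
  rw [div_le_iff₀ (by positivity)] at h3
  linarith

/-- The approximation of the weighted Weyl sum on a major arc. -/
lemma norm_wSum_sub_mul_vInt_le {k : ℕ} (hk : 0 < k) {N : ℕ} {X : ℝ} (hX : 1 ≤ X)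
    (hXN : X ^ k = N) {P m : ℕ} (hm : 0 < m) (hP : X ^ (1 + 1 / (m : ℝ)) ≤ P) (a : ℕ) {q : ℕ}
    (hq : 0 < q) (β : ℝ) :
    ‖wSum k N P (a / q + β) - warGauss k q a * vInt k N β‖ ≤
      2 * q * (‖cpar N β‖ * N + 1) + ‖cpar N β‖ * N + m.factorial := by
  have hN : 0 < N := by
    have : (0 : ℝ) < N := by rw [← hXN]; positivity
    exact_mod_cast this
  have hXP : X ≤ P := by
    refine le_trans ?_ hP
    exact Real.self_le_rpow_of_one_le hX (by simp)
  have h1 := norm_wSum_sub_sum_twist_le hk hN P a hq β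
  have h2 := norm_sum_twist_sub_integral_le hk hN P β
  have h3 := (norm_integral_Ioi_twist_le hk hX hXN hXP β).trans (mul_exp_neg_div_le hX hm hP)
  have h4 : vInt k N β = (∫ t in (0 : ℝ)..P, twist k N β t) + ∫ t in Set.Ioi (P : ℝ), twist k N β t := by
    rw [← integral_twist hk hN, intervalIntegral.integral_interval_add_Ioi
      (integrableOn_twist hk hN β)]
    exact (integrableOn_twist hk hN β).mono_set (Set.Ioi_subset_Ioi (by positivity))
  set S := ∑ n ∈ Finset.Icc 1 P, twist k N β n
  set J := ∫ t in (0 : ℝ)..P, twist k N β t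
  set T := ∫ t in Set.Ioi (P : ℝ), twist k N β t
  have hG := norm_warGauss_le_one k q a
  rw [h4, show wSum k N P (a / q + β) - warGauss k q a * (J + T) =
    (wSum k N P (a / q + β) - warGauss k q a * S) + warGauss k q a * (S - J) +
      -(warGauss k q a * T) by ring]
  refine (norm_add₃_le).trans ?_
  rw [norm_neg, norm_mul, norm_mul]
  have h5 : ‖warGauss k q a‖ * ‖S - J‖ ≤ 1 * (‖cpar N β‖ * N) := by gcongr
  have h6 : ‖warGauss k q a‖ * ‖T‖ ≤ 1 * m.factorial := by gcongr
  linarith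

lemma norm_cpar_mul_le {N : ℕ} (hN : 0 < N) (β : ℝ) :
    ‖cpar N β‖ * N ≤ 1 + 2 * Real.pi * (|β| * N) := by
  have hN' : (0 : ℝ) < N := by positivity
  have h : ‖cpar N β‖ ≤ (N : ℝ)⁻¹ + 2 * Real.pi * |β| := by
    refine (norm_sub_le _ _).trans_eq ?_
    simp [abs_of_pos Real.pi_pos]
  calc ‖cpar N β‖ * N ≤ ((N : ℝ)⁻¹ + 2 * Real.pi * |β|) * N := by gcongr
    _ = _ := by field_simp

/-- The approximation of the weighted Weyl sum on the major arcs, with explicit widths. -/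
lemma norm_wSum_sub_mul_vInt_le_rpow {k : ℕ} (hk : 0 < k) {N : ℕ} {X : ℝ} (hX : 1 ≤ X)
    (hXN : X ^ k = N) {P m : ℕ} (hm : 0 < m) (hP : X ^ (1 + 1 / (m : ℝ)) ≤ P) (a : ℕ) {q : ℕ}
    (hq : 0 < q) (hqX : (q : ℝ) ≤ X ^ (1 / 8 : ℝ)) {β : ℝ} (hβ : |β| ≤ X ^ (1 / 8 - k : ℝ)) :
    ‖wSum k N P (a / q + β) - warGauss k q a * vInt k N β‖ ≤
      (26 + m.factorial) * X ^ (1 / 4 : ℝ) := by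
  have hX0 : 0 < X := by linarith
  have hN' : (0 : ℝ) < N := by rw [← hXN]; positivity
  have hN : 0 < N := by exact_mod_cast hN'
  set Z : ℝ := X ^ (1 / 8 : ℝ) with hZ
  have hZ1 : 1 ≤ Z := Real.one_le_rpow hX (by norm_num)
  have hZ2 : X ^ (1 / 4 : ℝ) = Z ^ 2 := by
    rw [hZ, ← Real.rpow_mul_natCast hX0.le]
    norm_num
  have hβN : |β| * N ≤ Z := by
    calc |β| * N ≤ X ^ (1 / 8 - k : ℝ) * X ^ k := by rw [hXN]; gcongr
      _ = Z := by rw [hZ, ← Real.rpow_add_natCast hX0.ne']; simp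
  have hc : ‖cpar N β‖ * N ≤ 8 * Z := by
    refine (norm_cpar_mul_le hN β).trans ?_
    have h1 : 2 * Real.pi * (|β| * N) ≤ 2 * 3.15 * Z := by
      gcongr
      exact Real.pi_lt_d2.le
    linarith
  have h := norm_wSum_sub_mul_vInt_le hk hX hXN hm hP a hq β
  have hc0 : 0 ≤ ‖cpar N β‖ * N := by positivity
  have hf : (0 : ℝ) ≤ m.factorial := by positivity
  have h1 : (q : ℝ) * (‖cpar N β‖ * N + 1) ≤ Z * (9 * Z) := by
    gcongr
    linarith
  have h2 : Z ≤ Z ^ 2 := by nlinarith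
  have h3 : (m.factorial : ℝ) * 1 ≤ m.factorial * Z ^ 2 := by
    gcongr
    linarith
  rw [hZ2]
  nlinarith

end Waring

namespace Waring

open MeasureTheory

/-- The reduced fractions `a / q` in `(0, 1]` with denominator at most `Y`. -/
def majorIndex (Y : ℕ) : Finset (Σ _ : ℕ, ℕ) :=
  (Finset.range (Y + 1)).sigma fun q => (Finset.Icc 1 q).filter fun a => Nat.Coprime a q

/-- The arc of radius `τ` about the fraction `a / q`. -/
def majorArc (τ : ℝ) (i : Σ _ : ℕ, ℕ) : Set ℝ :=
  Set.Ioc ((i.2 : ℝ) / i.1 - τ) ((i.2 : ℝ) / i.1 + τ)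

/-- The union of the major arcs. -/
def majorSet (Y : ℕ) (τ : ℝ) : Set ℝ := ⋃ i ∈ majorIndex Y, majorArc τ i

lemma mem_majorIndex {Y : ℕ} {i : Σ _ : ℕ, ℕ} :
    i ∈ majorIndex Y ↔ i.1 ≤ Y ∧ 1 ≤ i.2 ∧ i.2 ≤ i.1 ∧ Nat.Coprime i.2 i.1 := by
  simp [majorIndex, and_assoc]

lemma card_majorIndex_le (Y : ℕ) : (majorIndex Y).card ≤ Y ^ 2 := by
  rw [majorIndex, Finset.card_sigma, Finset.sum_range_succ']
  calc _ ≤ ∑ q ∈ Finset.range Y, Y + 0 := by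
        gcongr with q hq
        · refine (Finset.card_filter_le _ _).trans ?_
          rw [Nat.card_Icc]
          have := Finset.mem_range.1 hq
          omega
        · simp
    _ = Y ^ 2 := by simp [sq]

lemma measurableSet_majorArc (τ : ℝ) (i : Σ _ : ℕ, ℕ) : MeasurableSet (majorArc τ i) :=
  measurableSet_Ioc

lemma measurableSet_majorSet (Y : ℕ) (τ : ℝ) : MeasurableSet (majorSet Y τ) :=
  Finset.measurableSet_biUnion _ fun i _ => measurableSet_majorArc τ i

lemma majorSet_subset {Y : ℕ} {τ : ℝ} (hτ : 2 * τ * Y ≤ 1) (hτ0 : 0 ≤ τ) :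
    majorSet Y τ ⊆ Set.Ioc τ (τ + 1) := by
  refine Set.iUnion₂_subset fun i hi => ?_
  obtain ⟨h1, h2, h3, -⟩ := mem_majorIndex.1 hi
  have hq : (0 : ℝ) < i.1 := by exact_mod_cast h2.trans h3
  have ha : (1 : ℝ) ≤ i.2 := by exact_mod_cast h2
  refine Set.Ioc_subset_Ioc ?_ ?_
  · rw [le_sub_iff_add_le, le_div_iff₀ hq]
    have : τ * i.1 ≤ τ * Y := by gcongr
    linarith
  · have : (i.2 : ℝ) / i.1 ≤ 1 := by
      rw [div_le_one hq]
      exact_mod_cast h3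
    linarith

lemma one_div_le_abs_sub {q r a b : ℕ} (hq : 0 < q) (hr : 0 < r) (h : a * r ≠ b * q) :
    1 / ((q : ℝ) * r) ≤ |(a : ℝ) / q - b / r| := by
  have hq' : (0 : ℝ) < q := by positivity
  have hr' : (0 : ℝ) < r := by positivity
  have h1 : (1 : ℝ) ≤ |(a : ℝ) * r - b * q| := by
    have : (1 : ℤ) ≤ |(a : ℤ) * r - b * q| := Int.one_le_abs (sub_ne_zero.2 (by exact_mod_cast h))
    exact_mod_cast this
  rw [div_sub_div _ _ hq'.ne' hr'.ne', abs_div, abs_of_pos (mul_pos hq' hr'), mul_comm (q : ℝ) b]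
  gcongr

lemma pairwise_disjoint_majorArc {Y : ℕ} {τ : ℝ} (hτ : 2 * τ * (Y : ℝ) ^ 2 ≤ 1) (hτ0 : 0 ≤ τ) :
    Set.Pairwise (majorIndex Y : Set (Σ _ : ℕ, ℕ)) (Function.onFun Disjoint (majorArc τ)) := by
  intro i hi j hj hij
  obtain ⟨h1, h2, h3, h4⟩ := mem_majorIndex.1 hi
  obtain ⟨g1, g2, g3, g4⟩ := mem_majorIndex.1 hj
  have hne : i.2 * j.1 ≠ j.2 * i.1 := by
    intro h
    have e1 : i.1 = j.1 := Nat.dvd_antisymm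
      (h4.symm.dvd_of_dvd_mul_left (Dvd.intro_left _ h.symm))
      (g4.symm.dvd_of_dvd_mul_left (Dvd.intro_left _ h))
    have e2 : i.2 = j.2 := by
      rw [e1] at h
      exact Nat.eq_of_mul_eq_mul_right (g2.trans g3) h
    exact hij (Sigma.ext e1 (heq_of_eq e2))
  have hd := one_div_le_abs_sub (h2.trans h3) (g2.trans g3) hne
  have hq : (0 : ℝ) < i.1 := by exact_mod_cast h2.trans h3
  have hr : (0 : ℝ) < j.1 := by exact_mod_cast g2.trans g3
  have hsep : 2 * τ ≤ 1 / ((i.1 : ℝ) * j.1) := by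
    rw [le_div_iff₀ (by positivity)]
    refine le_trans ?_ hτ
    rw [sq]
    gcongr
  rw [Function.onFun, Set.disjoint_left]
  rintro x ⟨hx1, hx2⟩ ⟨hx3, hx4⟩
  rcases le_abs.1 (hsep.trans hd) with h | h <;> linarith

/-- Outside the major arcs, Dirichlet approximations have large denominators. -/
lemma exists_approx_of_notMem_majorSet {Y Q : ℕ} {τ : ℝ} (hQ : 0 < Q) (hQτ : 1 < τ * (Q + 1))
    (hτ : 2 * τ * Y ≤ 1) (hτ0 : 0 ≤ τ) {α : ℝ} (hα : α ∈ Set.Ioc τ (τ + 1)) (hα' : α ∉ majorSet Y τ) :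
    ∃ (q : ℕ) (a : ℤ), 0 < q ∧ IsCoprime a (q : ℤ) ∧ |α - a / q| ≤ 1 / (q : ℝ) ^ 2 ∧
      Y + 1 ≤ q ∧ q ≤ Q := by
  obtain ⟨r, hr, hrQ⟩ := Real.exists_rat_abs_sub_le_and_den_le α hQ
  have hden : (0 : ℝ) < r.den := by exact_mod_cast r.den_pos
  have hden1 : (1 : ℝ) ≤ r.den := by exact_mod_cast r.den_pos
  rw [Rat.cast_def] at hr
  refine ⟨r.den, r.num, r.den_pos, ?_, hr.trans ?_, ?_, hrQ⟩
  · rw [Int.isCoprime_iff_nat_coprime]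
    simpa using r.reduced
  · rw [sq]
    gcongr
    have : (r.den : ℝ) ≤ Q := by exact_mod_cast hrQ
    linarith
  · by_contra! hY
    apply hα'
    have hY' : (r.den : ℝ) ≤ Y := by exact_mod_cast Nat.lt_succ_iff.1 hY
    have hlt : |α - r.num / r.den| < τ := by
      refine hr.trans_lt ?_
      rw [div_lt_iff₀ (by positivity)]
      have : τ * (Q + 1) * 1 ≤ τ * (Q + 1) * r.den := by gcongr
      linarith
    rw [abs_lt] at hlt
    have hτd : 2 * τ * r.den ≤ 1 := by
      refine le_trans ?_ hτ
      gcongr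
    have hnum : 0 < r.num := by
      have h1 : (0 : ℝ) < r.num / r.den := by linarith [hα.1]
      rw [div_pos_iff_of_pos_right hden] at h1
      exact_mod_cast h1
    have hnum' : r.num ≤ r.den := by
      by_contra! h
      have h1 : (r.den : ℝ) + 1 ≤ r.num := by exact_mod_cast h
      have h2 : (r.num : ℝ) / r.den < 1 + 2 * τ := by linarith [hα.2]
      rw [div_lt_iff₀ hden] at h2
      linarith
    obtain ⟨a, ha⟩ := Int.eq_ofNat_of_zero_le hnum.le
    have har : (r.num : ℝ) = a := by exact_mod_cast congrArg (Int.cast (R := ℝ)) ha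
    refine Set.mem_iUnion₂.2 ⟨⟨r.den, a⟩, mem_majorIndex.2 ⟨Nat.lt_succ_iff.1 hY, ?_, ?_, ?_⟩, ?_⟩
    · simp only
      omega
    · simp only
      omega
    · have := r.reduced
      rw [ha] at this
      simpa using this
    · rw [har] at hlt
      constructor <;> simp only <;> linarith

lemma norm_pow_sub_pow_le {x y : ℂ} {B : ℝ} (hx : ‖x‖ ≤ B) (hy : ‖y‖ ≤ B) (d : ℕ) :
    ‖x ^ d - y ^ d‖ ≤ d * B ^ (d - 1) * ‖x - y‖ := by
  have hB : 0 ≤ B := (norm_nonneg _).trans hx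
  rw [← geom_sum₂_mul, norm_mul]
  gcongr
  refine (norm_sum_le_of_le _ (f := fun i => x ^ i * y ^ (d - 1 - i)) fun i hi => ?_).trans
    (b := ∑ i ∈ Finset.range d, B ^ (d - 1)) ?_
  · have := Finset.mem_range.1 hi
    rw [norm_mul, norm_pow, norm_pow]
    calc ‖x‖ ^ i * ‖y‖ ^ (d - 1 - i) ≤ B ^ i * B ^ (d - 1 - i) := by gcongr
      _ = B ^ (d - 1) := by rw [← pow_add]; congr 1; omega
  · simp

/-- The contribution of a single major arc. -/
lemma norm_setIntegral_majorArc_sub_le (k d N P : ℕ) (hN : 0 < N) {τ B E : ℝ} (hτ : 0 ≤ τ)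
    {i : Σ _ : ℕ, ℕ}
    (hF : ∀ α, ‖wSum k N P α‖ ≤ B) (hv : ∀ β, ‖vInt k N β‖ ≤ B)
    (hE : ∀ β, |β| ≤ τ →
      ‖wSum k N P ((i.2 : ℝ) / i.1 + β) - warGauss k i.1 i.2 * vInt k N β‖ ≤ E) :
    ‖(∫ α in majorArc τ i, wSum k N P α ^ d * e (-(N * α))) -
      warGauss k i.1 i.2 ^ d * e (-((N : ℝ) * i.2 / i.1)) *
        ∫ β in Set.Ioc (-τ) τ, vInt k N β ^ d * e (-(N * β))‖ ≤
      d * B ^ (d - 1) * E * (2 * τ) := by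
  have hB : 0 ≤ B := (norm_nonneg _).trans (hF 0)
  have hcv := continuous_vInt k hN
  have h1 : ∫ α in majorArc τ i, wSum k N P α ^ d * e (-(N * α)) =
      ∫ β in (-τ)..τ, wSum k N P ((i.2 : ℝ) / i.1 + β) ^ d * e (-(N * ((i.2 : ℝ) / i.1 + β))) := by
    rw [intervalIntegral.integral_comp_add_left
      (fun α => wSum k N P α ^ d * e (-(N * α))), majorArc,
      ← intervalIntegral.integral_of_le (by linarith)]
    rfl
  rw [h1, ← intervalIntegral.integral_of_le (by linarith), ← intervalIntegral.integral_const_mul,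
    ← intervalIntegral.integral_sub
      (Continuous.intervalIntegrable (by fun_prop) _ _)
      (Continuous.intervalIntegrable (by fun_prop) _ _)]
  refine (intervalIntegral.norm_integral_le_of_norm_le_const (C := d * B ^ (d - 1) * E)
    fun β hβ => ?_).trans_eq ?_
  · rw [Set.uIoc_of_le (by linarith)] at hβ
    have hβ' : |β| ≤ τ := abs_le.2 ⟨hβ.1.le, hβ.2⟩
    rw [show -(N * ((i.2 : ℝ) / i.1 + β)) = -((N : ℝ) * i.2 / i.1) + -(N * β) by ring, e_add,
      show ∀ w g v x y : ℂ, w ^ d * (x * y) - g ^ d * x * (v ^ d * y) =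
        (w ^ d - (g * v) ^ d) * (x * y) by intros; rw [mul_pow]; ring, norm_mul, norm_mul,
      norm_e, norm_e, mul_one, mul_one]
    refine (norm_pow_sub_pow_le (hF _) ?_ d).trans ?_
    · rw [norm_mul]
      calc _ ≤ 1 * B := by
            gcongr
            exacts [norm_warGauss_le_one _ _ _, hv β]
        _ = B := one_mul B
    · gcongr
      exact hE β hβ'
  · rw [abs_of_nonneg (by linarith)]
    ring

/-- The total contribution of the major arcs. -/
lemma norm_setIntegral_majorSet_sub_le (k d N P Y : ℕ) (hN : 0 < N) (hY : 0 < Y) {τ B E : ℝ}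
    (hτ0 : 0 ≤ τ)
    (hτ : 2 * τ * (Y : ℝ) ^ 2 ≤ 1)
    (hF : ∀ α, ‖wSum k N P α‖ ≤ B) (hv : ∀ β, ‖vInt k N β‖ ≤ B)
    (hE : ∀ q a : ℕ, 0 < q → q ≤ Y → ∀ β, |β| ≤ τ →
      ‖wSum k N P ((a : ℝ) / q + β) - warGauss k q a * vInt k N β‖ ≤ E) :
    ‖(∫ α in majorSet Y τ, wSum k N P α ^ d * e (-(N * α))) -
      (∑ q ∈ Finset.range (Y + 1), singTerm k d N q) *
        ∫ β in Set.Ioc (-τ) τ, vInt k N β ^ d * e (-(N * β))‖ ≤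
      (Y : ℝ) ^ 2 * (d * B ^ (d - 1) * E * (2 * τ)) := by
  have hB : 0 ≤ B := (norm_nonneg _).trans (hF 0)
  have hE0 : 0 ≤ E := (norm_nonneg _).trans (hE 1 0 one_pos hY 0 (by simpa using hτ0))
  have hcont : Continuous fun α => wSum k N P α ^ d * e (-(N * α)) := by fun_prop
  have h1 : (∑ q ∈ Finset.range (Y + 1), singTerm k d N q) =
      ∑ i ∈ majorIndex Y, warGauss k i.1 i.2 ^ d * e (-((N : ℝ) * i.2 / i.1)) := by
    rw [majorIndex, Finset.sum_sigma]
    rfl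
  rw [majorSet, integral_biUnion_finset _ (fun i _ => measurableSet_majorArc τ i)
    (pairwise_disjoint_majorArc hτ hτ0) fun i _ => hcont.integrableOn_Ioc, h1, Finset.sum_mul,
    ← Finset.sum_sub_distrib]
  calc _ ≤ ∑ i ∈ majorIndex Y, d * B ^ (d - 1) * E * (2 * τ) := by
        refine norm_sum_le_of_le _ fun i hi => ?_
        obtain ⟨h1, h2, h3, -⟩ := mem_majorIndex.1 hi
        exact norm_setIntegral_majorArc_sub_le k d N P hN hτ0 hF hv
          (hE i.1 i.2 (h2.trans h3) h1)
    _ ≤ _ := by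
        rw [Finset.sum_const, nsmul_eq_mul]
        gcongr
        exact_mod_cast card_majorIndex_le Y

end Waring

namespace Waring

open MeasureTheory

lemma exists_norm_sum_singTerm_le (k : ℕ) (hk : 2 ≤ k) : ∃ C : ℝ, 0 ≤ C ∧ ∀ d N Y : ℕ,
    2 ^ (k + 1) ≤ d → ‖∑ q ∈ Finset.range (Y + 1), singTerm k d N q‖ ≤ C := by
  obtain ⟨C, hC0, hC⟩ := exists_norm_singTerm_le k hk
  have hs : Summable fun q : ℕ => C * (q : ℝ) ^ (-(5 / 2) : ℝ) :=
    (Real.summable_nat_rpow.2 (by norm_num)).mul_left C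
  refine ⟨∑' q : ℕ, C * (q : ℝ) ^ (-(5 / 2) : ℝ), tsum_nonneg fun q => by positivity,
    fun d N Y hd => ?_⟩
  exact (norm_sum_le_of_le _ fun q _ => hC d N q hd).trans
    (hs.sum_le_tsum _ fun q _ => by positivity)

lemma two_le_div {k d : ℕ} (hk : 2 ≤ k) (hd : 2 ^ (k + 1) ≤ d) : 2 ≤ (d : ℝ) / k := by
  have h1 : 4 * k ≤ d := (four_mul_le_two_pow hk).trans hd
  have h2 : (4 * k : ℝ) ≤ d := by exact_mod_cast h1
  have hk' : (0 : ℝ) < k := by positivity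
  rw [le_div_iff₀ hk']
  linarith

lemma one_le_Gamma {s : ℝ} (hs : 2 ≤ s) : 1 ≤ Real.Gamma s := by
  rw [← Real.Gamma_two]
  exact Real.Gamma_strictMonoOn_Ici.monotoneOn (Set.mem_Ici.2 le_rfl) hs hs

lemma Gamma_le_rpow_self {s : ℝ} (hs : 2 ≤ s) : Real.Gamma s ≤ s ^ s := by
  obtain ⟨n, hn⟩ : ∃ n : ℕ, ⌈s⌉₊ = n + 1 :=
    Nat.exists_eq_add_of_le' (Nat.one_le_ceil_iff.2 (by linarith))
  have h1 : s ≤ n + 1 := by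
    have := Nat.le_ceil s
    rw [hn] at this
    exact_mod_cast this
  have h2 : (n : ℝ) < s := by
    rw [← Nat.lt_ceil, hn]
    exact n.lt_succ_self
  calc Real.Gamma s ≤ Real.Gamma (n + 1) :=
        Real.Gamma_strictMonoOn_Ici.monotoneOn hs (Set.mem_Ici.2 (hs.trans h1)) h1
    _ = n.factorial := Real.Gamma_nat_eq_factorial n
    _ ≤ (n : ℝ) ^ n := by exact_mod_cast n.factorial_le_pow
    _ ≤ s ^ n := by gcongr
    _ = s ^ (n : ℝ) := (Real.rpow_natCast s n).symm
    _ ≤ s ^ s := by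
        have : 1 ≤ s := by linarith
        gcongr

/-- The asymptotic formula with a power-saving error term, uniformly in the number of variables. -/
lemma exists_norm_rep_sub_le (k : ℕ) (hk : 2 ≤ k) : ∃ C : ℝ, 0 ≤ C ∧ ∀ (d N : ℕ) (X : ℝ),
    2 ^ (k + 1) ≤ d → 2 ≤ X → X ^ k = N →
    ‖((Real.exp (-1) : ℝ) : ℂ) * rep k d N -
      singularSeries k d N * ∫ β, vInt k N β ^ d * e (-(N * β))‖ ≤
      C * d * Real.Gamma (1 + 1 / k) ^ d * X ^ (d - k - 1 / 8 : ℝ) := by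
  obtain ⟨C₁, hC₁0, hC₁⟩ := exists_setIntegral_norm_wSum_pow_le_of_le k hk
  obtain ⟨C₂, hC₂0, hC₂⟩ := exists_norm_sum_singTerm_le k hk
  obtain ⟨C₃, hC₃0, hC₃⟩ := exists_norm_singularSeries_sub_sum_le k hk
  set m : ℕ := 64 * 2 ^ (k - 1) with hm
  set G : ℝ := Real.Gamma (1 + 1 / k) with hG
  have hm0 : 0 < m := by positivity
  have hk0 : 0 < k := by omega
  have hk2 : (2 : ℝ) ≤ k := by exact_mod_cast hk
  have hG0 : 0 < G := Real.Gamma_pos_of_pos (by positivity)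
  refine ⟨C₁ + 2 * (26 + m.factorial) / G + 2 * C₂ + C₃, by positivity, ?_⟩
  intro d N X hd hX hXN
  have hX0 : 0 < X := by linarith
  have hX1 : 1 ≤ X := by linarith
  have hN' : (0 : ℝ) < N := by rw [← hXN]; positivity
  have hN : 0 < N := by exact_mod_cast hN'
  have hdk := two_le_div hk hd
  have hd0 : 0 < d := lt_of_lt_of_le (by positivity) hd
  have hd1 : (1 : ℝ) ≤ d := by exact_mod_cast hd0
  have hNX : ∀ s : ℝ, (N : ℝ) ^ s = X ^ (k * s) := fun s => by
    rw [← hXN, ← Real.rpow_natCast_mul hX0.le]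
  have hNXk : (N : ℝ) ^ (1 / k : ℝ) = X := by
    rw [hNX, mul_one_div_cancel (by positivity), Real.rpow_one]
  set P : ℕ := ⌈X ^ (1 + 1 / (m : ℝ))⌉₊
  set Y : ℕ := ⌊X ^ (1 / 8 : ℝ)⌋₊
  set Q : ℕ := ⌊X ^ (k - 1 / 8 : ℝ)⌋₊
  set τ : ℝ := X ^ (1 / 8 - k : ℝ) with hτ
  have hτ0 : 0 < τ := by positivity
  have hP : X ^ (1 + 1 / (m : ℝ)) ≤ P := Nat.le_ceil _
  have hXP : X ≤ P := (Real.self_le_rpow_of_one_le hX1 (by simp)).trans hP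
  have hP2 : (P : ℝ) ≤ 2 * X ^ (1 + 1 / (m : ℝ)) := by
    have h1 := Nat.ceil_lt_add_one (show 0 ≤ X ^ (1 + 1 / (m : ℝ)) by positivity)
    have h2 : 1 ≤ X ^ (1 + 1 / (m : ℝ)) := Real.one_le_rpow hX1 (by positivity)
    linarith
  have hNP : N ≤ P ^ k := by
    have : (N : ℝ) ≤ (P : ℝ) ^ k := by rw [← hXN]; gcongr
    exact_mod_cast this
  have hY : 0 < Y := Nat.floor_pos.2 (Real.one_le_rpow hX1 (by norm_num))
  have hY1 : (1 : ℝ) ≤ Y := by exact_mod_cast hY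
  have hYX : (Y : ℝ) ≤ X ^ (1 / 8 : ℝ) := Nat.floor_le (by positivity)
  have hXY : X ^ (1 / 8 : ℝ) < Y + 1 := Nat.lt_floor_add_one _
  have hY2 : (Y : ℝ) ^ 2 ≤ X ^ (1 / 4 : ℝ) := by
    calc (Y : ℝ) ^ 2 ≤ (X ^ (1 / 8 : ℝ)) ^ 2 := by gcongr
      _ = X ^ (1 / 4 : ℝ) := by
        rw [← Real.rpow_mul_natCast hX0.le]
        norm_num
  have hQ : 0 < Q := Nat.floor_pos.2 (Real.one_le_rpow hX1 (by linarith))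
  have hQX : (Q : ℝ) ≤ X ^ (k - 1 / 8 : ℝ) := Nat.floor_le (by positivity)
  have hXQ : X ^ (k - 1 / 8 : ℝ) < Q + 1 := Nat.lt_floor_add_one _
  have hQτ : 1 < τ * (Q + 1) := by
    calc (1 : ℝ) = τ * X ^ (k - 1 / 8 : ℝ) := by
          rw [hτ, ← Real.rpow_add hX0]
          simp
      _ < _ := by gcongr
  have hτY2 : 2 * τ * (Y : ℝ) ^ 2 ≤ 1 := by
    calc 2 * τ * (Y : ℝ) ^ 2 ≤ X ^ (1 : ℝ) * τ * X ^ (1 / 4 : ℝ) := by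
          rw [Real.rpow_one]
          gcongr
      _ = X ^ (1 + (1 / 8 - k) + 1 / 4 : ℝ) := by rw [Real.rpow_add hX0, Real.rpow_add hX0]
      _ ≤ 1 := Real.rpow_le_one_of_one_le_of_nonpos hX1 (by linarith)
  have hτY : 2 * τ * Y ≤ 1 := by
    refine le_trans ?_ hτY2
    gcongr
    nlinarith
  set f : ℝ → ℂ := fun α => wSum k N P α ^ d * e (-(N * α)) with hf
  have hfc : Continuous f := by fun_prop
  set J : ℂ := ∫ β, vInt k N β ^ d * e (-(N * β)) with hJ
  set Jτ : ℂ := ∫ β in Set.Ioc (-τ) τ, vInt k N β ^ d * e (-(N * β)) with hJτ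
  set S : ℂ := ∑ q ∈ Finset.range (Y + 1), singTerm k d N q
  set R : ℝ := G ^ d * X ^ (d - k - 1 / 8 : ℝ) with hR
  have hR0 : 0 ≤ R := by positivity
  have hsplit : ((Real.exp (-1) : ℝ) : ℂ) * rep k d N =
      (∫ α in majorSet Y τ, f α) + ∫ α in Set.Ioc τ (τ + 1) \ majorSet Y τ, f α := by
    rw [← integral_wSum_pow k d N P hk0 hN hNP τ, intervalIntegral.integral_of_le (by linarith),
      ← setIntegral_union Set.disjoint_sdiff_right
        (measurableSet_Ioc.diff (measurableSet_majorSet Y τ))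
        ((hfc.integrableOn_Ioc).mono_set (majorSet_subset hτY hτ0.le))
        ((hfc.integrableOn_Ioc).mono_set Set.sdiff_subset),
      Set.union_sdiff_cancel (majorSet_subset hτY hτ0.le)]
  have hminor : ‖∫ α in Set.Ioc τ (τ + 1) \ majorSet Y τ, f α‖ ≤ C₁ * R := by
    refine (norm_integral_le_integral_norm _).trans ?_
    have h := hC₁ d N P X τ (Set.Ioc τ (τ + 1) \ majorSet Y τ) hd hX1 hXN hXP
      (by simpa [hm] using hP2) (measurableSet_Ioc.diff (measurableSet_majorSet Y τ))
      Set.sdiff_subset fun α hα => by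
        obtain ⟨q, a, hq, hc, ha, hYq, hqQ⟩ :=
          exists_approx_of_notMem_majorSet hQ hQτ hτY hτ0.le hα.1 hα.2
        refine ⟨q, a, hq, hc, ha, hXY.le.trans (by exact_mod_cast hYq), le_trans ?_ hQX⟩
        exact_mod_cast hqQ
    simp only [hf, norm_mul, norm_pow, norm_e, mul_one]
    rwa [mul_assoc] at h
  have hmajor : ‖(∫ α in majorSet Y τ, f α) - S * Jτ‖ ≤ 2 * (26 + m.factorial) / G * d * R := by
    refine (norm_setIntegral_majorSet_sub_le k d N P Y hN hY hτ0.le hτY2 (B := G * X)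
      (E := (26 + m.factorial) * X ^ (1 / 4 : ℝ)) ?_ ?_ ?_).trans ?_
    · intro α
      simpa only [hNXk] using norm_wSum_le k N P hk0 hN α
    · intro β
      simpa only [hNXk] using norm_vInt_le k hN β
    · intro q a hq hqY β hβ
      exact norm_wSum_sub_mul_vInt_le_rpow hk0 hX1 hXN hm0 hP a hq
        (le_trans (by exact_mod_cast hqY) hYX) hβ
    · have hGd : G ^ d = G ^ (d - 1) * G := (pow_sub_one_mul hd0.ne' G).symm
      have hXd : X ^ (d - 1) = X ^ (d - 1 : ℝ) := by
        rw [← Real.rpow_natCast, Nat.cast_pred hd0]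
      calc (Y : ℝ) ^ 2 * (d * (G * X) ^ (d - 1) * ((26 + m.factorial) * X ^ (1 / 4 : ℝ)) * (2 * τ))
          ≤ X ^ (1 / 4 : ℝ) * (d * (G * X) ^ (d - 1) * ((26 + m.factorial) * X ^ (1 / 4 : ℝ)) *
            (2 * τ)) := by gcongr
        _ = 2 * (26 + m.factorial) / G * d *
            (G ^ d * X ^ (1 / 4 + (d - 1) + 1 / 4 + (1 / 8 - k) : ℝ)) := by
            rw [Real.rpow_add hX0, Real.rpow_add hX0, Real.rpow_add hX0, mul_pow, hXd, hGd,
              ← hτ]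
            field_simp
        _ ≤ _ := by
            rw [hR]
            gcongr
            linarith
  have htrunc : ‖S * Jτ - S * J‖ ≤ 2 * C₂ * R := by
    rw [← mul_sub, norm_mul, norm_sub_rev]
    calc _ ≤ C₂ * (2 * G ^ d * (N : ℝ) ^ ((d : ℝ) / k - 2) / τ) := by
          gcongr
          · exact hC₂ d N Y hd
          · exact norm_integral_vInt_pow_sub_le k d hN hdk hτ0
      _ = 2 * C₂ * R := by
          rw [hR, hNX, hτ, mul_div_assoc, ← Real.rpow_sub hX0,
            show (k : ℝ) * ((d : ℝ) / k - 2) - (1 / 8 - k) = d - k - 1 / 8 by field_simp; ring]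
          ring
  have hJle : ‖J‖ ≤ G ^ d * X ^ (d - k : ℝ) := by
    rw [hJ, integral_vInt_pow k d hN hdk, Complex.norm_real, Real.norm_of_nonneg, hNX,
      show (k : ℝ) * ((d : ℝ) / k - 1) = d - k by field_simp]
    · have hΓ := one_le_Gamma hdk
      calc Real.exp (-1) * (G ^ d / Real.Gamma (d / k) * X ^ (d - k : ℝ))
          ≤ 1 * (G ^ d / 1 * X ^ (d - k : ℝ)) := by
            gcongr
            exact Real.exp_le_one_iff.2 (by norm_num)
        _ = _ := by ring
    · have hΓ := one_le_Gamma hdk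
      positivity
  have htail : ‖S * J - singularSeries k d N * J‖ ≤ C₃ * R := by
    rw [← sub_mul, norm_mul, norm_sub_rev]
    calc _ ≤ C₃ / (Y + 1) * (G ^ d * X ^ (d - k : ℝ)) := by
          gcongr
          exact hC₃ d N Y hd
      _ ≤ C₃ / X ^ (1 / 8 : ℝ) * (G ^ d * X ^ (d - k : ℝ)) := by gcongr
      _ = C₃ * R := by
          rw [hR, Real.rpow_sub hX0 (d - k : ℝ)]
          ring
  have htot : ((Real.exp (-1) : ℝ) : ℂ) * rep k d N - singularSeries k d N * J =
      (∫ α in Set.Ioc τ (τ + 1) \ majorSet Y τ, f α) + ((∫ α in majorSet Y τ, f α) - S * Jτ) +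
        (S * Jτ - S * J) + (S * J - singularSeries k d N * J) := by
    rw [hsplit]
    ring
  rw [htot]
  refine (norm_add_le _ _).trans ((add_le_add (norm_add₃_le.trans
    (add_le_add (add_le_add hminor hmajor) htrunc)) htail).trans ?_)
  rw [mul_assoc _ (G ^ d), ← hR]
  have h1 : (C₁ + 2 * C₂ + C₃) * R * 1 ≤ (C₁ + 2 * C₂ + C₃) * R * d := by gcongr
  linarith

lemma mul_Gamma_le {k d N : ℕ} {X : ℝ} (hk : 2 ≤ k) (hd : 2 ^ (k + 1) ≤ d) (hX : 0 < X)
    (hXN : X ^ k = N) (hN : (d : ℝ) ^ (20 * d) ≤ N) :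
    d * Real.Gamma (d / k) ≤ X ^ (1 / 16 : ℝ) := by
  have hk0 : (0 : ℝ) < k := by positivity
  have hk1 : (1 : ℝ) ≤ k := by exact_mod_cast (by omega : 1 ≤ k)
  have hd0 : (1 : ℝ) ≤ d := by exact_mod_cast Nat.one_le_two_pow.trans hd
  have h4 : (4 * k : ℝ) ≤ d := by exact_mod_cast (four_mul_le_two_pow hk).trans hd
  have h1 : Real.Gamma (d / k) ≤ (d : ℝ) ^ ((d : ℝ) / k) := by
    refine (Gamma_le_rpow_self (two_le_div hk hd)).trans ?_
    gcongr
    exact div_le_self (by positivity) hk1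
  have h2 : (d : ℝ) ≤ (d : ℝ) ^ ((d : ℝ) / (4 * k)) := by
    refine Real.self_le_rpow_of_one_le hd0 ?_
    rw [le_div_iff₀ (by positivity)]
    linarith
  have h3 : (X : ℝ) ^ (1 / 16 : ℝ) = (N : ℝ) ^ (1 / (16 * k) : ℝ) := by
    rw [← hXN, ← Real.rpow_natCast_mul hX.le]
    congr 1
    field_simp
  calc d * Real.Gamma (d / k) ≤ (d : ℝ) ^ ((d : ℝ) / (4 * k)) * (d : ℝ) ^ ((d : ℝ) / k) := by
        gcongr
    _ = (d : ℝ) ^ ((20 * d : ℕ) * (1 / (16 * k)) : ℝ) := by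
        rw [← Real.rpow_add (by positivity)]
        congr 1
        push_cast
        field_simp
        norm_num
    _ = ((d : ℝ) ^ (20 * d)) ^ (1 / (16 * k) : ℝ) := Real.rpow_natCast_mul (by positivity) _ _
    _ ≤ _ := by
        rw [h3]
        gcongr

end Waring

/-- Dimension-free asymptotic formula in Waring's problem for `N ≥ C_k d^{20d}`. -/
theorem waring_asymptotic_dimension_free (k : ℕ) (hk : 2 ≤ k) :
    ∃ C : ℝ, 0 < C ∧ ∀ η : ℝ, 0 < η → ∃ C' : ℝ, 0 < C' ∧
      ∀ d N : ℕ, 2 ^ (k + 1) ≤ d → C * (d : ℝ) ^ (20 * d) ≤ (N : ℝ) → C' ≤ (N : ℝ) →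
        ‖(rep k d N : ℂ) -
            singularSeries k d N *
              ((Real.Gamma (1 + 1 / k) ^ d / Real.Gamma (d / k) : ℝ) : ℂ) *
              (((N : ℝ) ^ ((d : ℝ) / k - 1) : ℝ) : ℂ)‖ ≤
          η * ‖singularSeries k d N *
              ((Real.Gamma (1 + 1 / k) ^ d / Real.Gamma (d / k) : ℝ) : ℂ) *
              (((N : ℝ) ^ ((d : ℝ) / k - 1) : ℝ) : ℂ)‖ := by
  obtain ⟨c, hc0, hc⟩ := Waring.exists_le_norm_singularSeries k hk
  obtain ⟨A, hA0, hA⟩ := Waring.exists_norm_rep_sub_le k hk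
  have hk0 : (0 : ℝ) < k := by positivity
  refine ⟨1, one_pos, fun η hη => ?_⟩
  set D : ℝ := Real.exp 1 * A / c with hD
  set X₀ : ℝ := max 2 ((D / η) ^ (16 : ℝ)) with hX₀
  have hX₀2 : 2 ≤ X₀ := le_max_left _ _
  refine ⟨X₀ ^ k, by positivity, fun d N hd hdN hN => ?_⟩
  rw [one_mul] at hdN
  set X : ℝ := (N : ℝ) ^ (1 / k : ℝ) with hX
  have hXN : X ^ k = N := by
    rw [hX, ← Real.rpow_mul_natCast (by positivity), one_div_mul_cancel hk0.ne', Real.rpow_one]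
  have hX₀X : X₀ ≤ X := by
    rw [← hXN] at hN
    exact le_of_pow_le_pow_left₀ (by omega) (by positivity) hN
  have hX2 : 2 ≤ X := hX₀2.trans hX₀X
  have hX0 : 0 < X := by linarith
  have hN0 : 0 < N := by
    have : (0 : ℝ) < N := by rw [← hXN]; positivity
    exact_mod_cast this
  have hdk := Waring.two_le_div hk hd
  have hΓ : 0 < Real.Gamma (d / k) := Real.Gamma_pos_of_pos (by linarith)
  have hG : 0 < Real.Gamma (1 + 1 / k) := Real.Gamma_pos_of_pos (by positivity)
  have hNX : (N : ℝ) ^ ((d : ℝ) / k - 1) = X ^ (d - k : ℝ) := by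
    rw [← hXN, ← Real.rpow_natCast_mul hX0.le]
    congr 1
    field_simp
  have hsmall : D ≤ η * X ^ (1 / 16 : ℝ) := by
    have hD0 : 0 ≤ D / η := by positivity
    have h1 : (D / η) ^ (16 : ℝ) ≤ X := (le_max_right _ _).trans hX₀X
    have h2 : D / η ≤ X ^ (1 / 16 : ℝ) := by
      calc D / η = ((D / η) ^ (16 : ℝ)) ^ (1 / 16 : ℝ) := by
            rw [← Real.rpow_mul hD0]
            norm_num
        _ ≤ _ := by gcongr
    rw [div_le_iff₀ hη] at h2
    linarith
  have hdΓ := Waring.mul_Gamma_le hk hd hX0 hXN hdN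
  set G : ℝ := Real.Gamma (1 + 1 / k)
  set M : ℂ := singularSeries k d N * ((G ^ d / Real.Gamma (d / k) : ℝ) : ℂ) *
    (((N : ℝ) ^ ((d : ℝ) / k - 1) : ℝ) : ℂ) with hM
  have hMle : c * (G ^ d / Real.Gamma (d / k)) * X ^ (d - k : ℝ) ≤ ‖M‖ := by
    rw [hM, norm_mul, norm_mul, Complex.norm_real, Complex.norm_real,
      Real.norm_of_nonneg (by positivity), Real.norm_of_nonneg (by positivity), hNX]
    gcongr
    exact hc d N hd
  have herr := hA d N X hd hX2 hXN
  have hfac : ((Real.exp (-1) : ℝ) : ℂ) * rep k d N -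
      singularSeries k d N * ∫ β, Waring.vInt k N β ^ d * e (-(N * β)) =
      ((Real.exp (-1) : ℝ) : ℂ) * (rep k d N - M) := by
    rw [Waring.integral_vInt_pow k d hN0 hdk, hM]
    push_cast
    ring
  rw [hfac, norm_mul, Complex.norm_real, Real.norm_of_nonneg (Real.exp_pos _).le, Real.exp_neg,
    inv_mul_le_iff₀ (Real.exp_pos _)] at herr
  have hX16 : X ^ (d - k - 1 / 8 : ℝ) * X ^ (1 / 16 : ℝ) * X ^ (1 / 16 : ℝ) = X ^ (d - k : ℝ) := by
    rw [← Real.rpow_add hX0, ← Real.rpow_add hX0]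
    congr 1
    ring
  calc ‖(rep k d N : ℂ) - M‖
      ≤ Real.exp 1 * (A * d * G ^ d * X ^ (d - k - 1 / 8 : ℝ)) := herr
    _ = D * c * (d * Real.Gamma (d / k)) * (G ^ d / Real.Gamma (d / k)) *
        X ^ (d - k - 1 / 8 : ℝ) := by
        rw [hD]
        field_simp
    _ ≤ (η * X ^ (1 / 16 : ℝ)) * c * X ^ (1 / 16 : ℝ) * (G ^ d / Real.Gamma (d / k)) *
        X ^ (d - k - 1 / 8 : ℝ) := by gcongr
    _ = η * (c * (G ^ d / Real.Gamma (d / k)) * X ^ (d - k : ℝ)) := by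
        rw [← hX16]
        ring
    _ ≤ η * ‖M‖ := by gcongr
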